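/- Let 1 < γ < 3/2, F(t) = exp((log t)^γ), f(k) = ⌊F(k)⌋, and let C₁ > 1/(3 − 2γ). For every A > 1, B > 0 and C₅ > 0 there exist κ > 0 and x₀ ≥ 2 (depending only on γ, C₁, A, B, C₅) such that the following holds for all x ≥ x₀: if K, K₁ are reals with K ≤ K₁ ≤ 2K, log K > (log log x)^{C₁}, and x (log x)^{−B} ≤ F(K) ≤ x, if q is an integer with 1 < q ≤ (log x)^{C₅}, and ℓ is any integer, then | #{ k ∈ ℤ : K < k ≤ K₁, ⌊F(k)⌋ ≡ ℓ (mod q) } − (K₁ − K)/q | ≤ κ K (log x)^{−4A}. -/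

import Mathlib

/-- `F(t) = exp((log t)^γ)`. -/
noncomputable def Fγ (γ t : ℝ) : ℝ := Real.exp (Real.log t ^ γ)

namespace Vinogradov

open Finset

/-! ### Additive characters and additive energy -/

/-- The additive character `e(x) = exp(2πix)`. -/
noncomputable def e (x : ℝ) : ℂ := Complex.exp (2 * Real.pi * x * Complex.I)

lemma e_add (x y : ℝ) : e (x + y) = e x * e y := by
  rw [e, e, e, ← Complex.exp_add]
  push_cast
  ring_nf

lemma norm_e (x : ℝ) : ‖e x‖ = 1 := by
  have : (2 * Real.pi * x * Complex.I : ℂ) = ((2 * Real.pi * x : ℝ) : ℂ) * Complex.I := by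
    push_cast; ring
  rw [e, this, Complex.norm_exp_ofReal_mul_I]

lemma e_zero : e 0 = 1 := by simp [e]

lemma e_int (n : ℤ) : e n = 1 := by
  rw [e, Complex.exp_eq_one_iff]
  exact ⟨n, by push_cast; ring⟩

lemma conj_e (x : ℝ) : (starRingEnd ℂ) (e x) = e (-x) := by
  rw [e, e, ← Complex.exp_conj]
  congr 1
  simp [map_ofNat]

lemma e_sub (x y : ℝ) : e (x - y) = e x * (starRingEnd ℂ) (e y) := by
  rw [sub_eq_add_neg, e_add, conj_e]

lemma e_nat_mul (n : ℕ) (x : ℝ) : e (n * x) = e x ^ n := by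
  rw [e, e, ← Complex.exp_nat_mul]
  congr 1
  push_cast
  ring

lemma e_sum {ι : Type*} (s : Finset ι) (f : ι → ℝ) : e (∑ i ∈ s, f i) = ∏ i ∈ s, e (f i) := by
  classical
  induction s using Finset.induction_on with
  | empty => simp [e_zero]
  | insert a s ha ih => rw [sum_insert ha, prod_insert ha, e_add, ih]

lemma e_eq_one_iff (x : ℝ) : e x = 1 ↔ ∃ n : ℤ, x = n := by
  constructor
  · intro h
    rw [e, Complex.exp_eq_one_iff] at h
    obtain ⟨n, hn⟩ := h
    refine ⟨n, ?_⟩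
    have h2 : (2 * Real.pi * Complex.I : ℂ) ≠ 0 := by simp [Real.pi_ne_zero]
    have : (x : ℂ) = n := by
      apply mul_left_cancel₀ h2
      linear_combination hn
    exact_mod_cast this
  · rintro ⟨n, rfl⟩
    exact e_int n

lemma sum_range_e (Q : ℕ) (hQ : 0 < Q) (l : ℤ) :
    ∑ a ∈ range Q, e ((l : ℝ) * a / Q) = if (Q : ℤ) ∣ l then (Q : ℂ) else 0 := by
  have hQ' : (Q : ℝ) ≠ 0 := by positivity
  have h1 : ∀ a : ℕ, e ((l : ℝ) * a / Q) = e ((l : ℝ) / Q) ^ a := by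
    intro a
    rw [← e_nat_mul]
    congr 1
    ring
  simp_rw [h1]
  split_ifs with h
  · obtain ⟨m, rfl⟩ := h
    have : (((Q : ℤ) * m : ℤ) : ℝ) / Q = m := by push_cast; field_simp
    rw [this, e_int]
    simp
  · have hne : e ((l : ℝ) / Q) ≠ 1 := by
      rw [Ne, e_eq_one_iff]
      rintro ⟨n, hn⟩
      apply h
      refine ⟨n, ?_⟩
      rw [div_eq_iff hQ'] at hn
      have : (l : ℝ) = ((Q * n : ℤ) : ℝ) := by push_cast; linarith
      exact_mod_cast this
    rw [geom_sum_eq hne, ← e_nat_mul]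
    have : (Q : ℝ) * (l / Q) = l := by field_simp
    rw [this, e_int]
    simp

/-- The number of pairs in `A` on which `φ` takes equal values. -/
noncomputable def energy {α G : Type*} (A : Finset α) (φ : α → G) : ℕ := by
  classical
  exact #{p ∈ A ×ˢ A | φ p.1 = φ p.2}

section energy
open scoped Classical

variable {α β G : Type*}

lemma energy_eq_sum_sq (A : Finset α) (φ : α → G) (L : Finset G) (hL : ∀ a ∈ A, φ a ∈ L) :
    energy A φ = ∑ l ∈ L, #{a ∈ A | φ a = l} ^ 2 := by
  rw [energy, Finset.card_eq_sum_card_fiberwise (f := fun p => φ p.1) (t := L)]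
  · refine sum_congr rfl fun l _ => ?_
    rw [sq, ← card_product]
    congr 1
    ext ⟨a, b⟩
    simp only [mem_filter, mem_product]
    constructor
    · rintro ⟨⟨⟨h1, h2⟩, h3⟩, h4⟩; exact ⟨⟨h1, h4⟩, h2, h3 ▸ h4⟩
    · rintro ⟨⟨h1, h2⟩, h3, h4⟩; exact ⟨⟨⟨h1, h3⟩, h2.trans h4.symm⟩, h2⟩
  · intro p hp
    simp only [coe_filter, mem_product, Set.mem_ofPred_eq] at hp
    exact hL _ hp.1.1

lemma card_shift_le_energy [AddCommGroup G] (A : Finset α) (φ : α → G) (m : G) :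
    #{p ∈ A ×ˢ A | φ p.1 = φ p.2 + m} ≤ energy A φ := by
  set L := A.image φ with hLdef
  set r : G → ℕ := fun l => #{a ∈ A | φ a = l} with hr
  have h1 : #{p ∈ A ×ˢ A | φ p.1 = φ p.2 + m} = ∑ l ∈ L, r l * r (l - m) := by
    rw [Finset.card_eq_sum_card_fiberwise (f := fun p => φ p.1) (t := L)]
    · refine sum_congr rfl fun l _ => ?_
      rw [hr, ← card_product]
      congr 1
      ext ⟨a, b⟩
      simp only [mem_filter, mem_product]
      constructor
      · rintro ⟨⟨⟨h1, h2⟩, h3⟩, h4⟩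
        exact ⟨⟨h1, h4⟩, h2, by rw [← h4, h3]; abel⟩
      · rintro ⟨⟨h1, h2⟩, h3, h4⟩
        exact ⟨⟨⟨h1, h3⟩, by rw [h2, h4]; abel⟩, h2⟩
    · intro p hp
      simp only [coe_filter, mem_product, Set.mem_ofPred_eq] at hp
      exact mem_image_of_mem _ hp.1.1
  have h2 : ∑ l ∈ L, r l ^ 2 = energy A φ :=
    (energy_eq_sum_sq A φ L fun a ha => mem_image_of_mem _ ha).symm
  have h3 : ∑ l ∈ L, r (l - m) ^ 2 ≤ energy A φ := by
    rw [energy_eq_sum_sq A φ (L ∪ L.image (fun l => l - m))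
      fun a ha => mem_union_left _ (mem_image_of_mem _ ha)]
    calc ∑ l ∈ L, r (l - m) ^ 2 = ∑ l ∈ L.image (fun l => l - m), r l ^ 2 := by
          rw [sum_image (s := L) (g := fun l => l - m)]
          intro x _ y _ h
          simpa using h
      _ ≤ _ := sum_le_sum_of_subset subset_union_right
  rw [h1]
  have h4 : 2 * ∑ l ∈ L, r l * r (l - m) ≤ ∑ l ∈ L, r l ^ 2 + ∑ l ∈ L, r (l - m) ^ 2 := by
    rw [mul_sum, ← sum_add_distrib]
    refine sum_le_sum fun l _ => ?_
    have := two_mul_le_add_sq (r l) (r (l - m))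
    linarith
  linarith

/-- The energy of a set is controlled by the energies of the sets of a cover. -/
lemma energy_le_card_mul_sum {ι : Type*} (I : Finset ι) (A : Finset α) (B : ι → Finset α)
    (φ : α → G) (h : ∀ a ∈ A, ∃ i ∈ I, a ∈ B i) :
    energy A φ ≤ #I * ∑ i ∈ I, energy (B i) φ := by
  set L := A.image φ ∪ I.biUnion (fun i => (B i).image φ)
  have hA : ∀ a ∈ A, φ a ∈ L := fun a ha => mem_union_left _ (mem_image_of_mem _ ha)
  have hB : ∀ i ∈ I, ∀ a ∈ B i, φ a ∈ L := fun i hi a ha =>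
    mem_union_right _ (mem_biUnion.2 ⟨i, hi, mem_image_of_mem _ ha⟩)
  rw [energy_eq_sum_sq A φ L hA, sum_congr rfl fun i hi => energy_eq_sum_sq (B i) φ L (hB i hi),
    sum_comm, mul_sum]
  refine sum_le_sum fun l _ => ?_
  refine le_trans ?_ (sq_sum_le_card_mul_sum_sq (s := I) (f := fun i => #{a ∈ B i | φ a = l}))
  refine Nat.pow_le_pow_left ?_ 2
  refine le_trans (card_le_card (t := I.biUnion fun i => {a ∈ B i | φ a = l}) ?_) card_biUnion_le
  intro a ha
  rw [mem_filter] at ha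
  obtain ⟨i, hi, hai⟩ := h a ha.1
  exact mem_biUnion.2 ⟨i, hi, mem_filter.2 ⟨hai, ha.2⟩⟩

lemma energy_le_card_sq (A : Finset α) (φ : α → G) : energy A φ ≤ #A * #A := by
  rw [energy, ← card_product]
  exact card_filter_le _ _

/-- Transport along an injection. -/
lemma energy_le_of_injOn {H : Type*} (A : Finset α) (B : Finset β) (φ : α → G) (ψ : β → H)
    (f : α → β)
    (hf : ∀ a ∈ A, f a ∈ B) (hinj : Set.InjOn f A)
    (h : ∀ a ∈ A, ∀ b ∈ A, φ a = φ b → ψ (f a) = ψ (f b)) : energy A φ ≤ energy B ψ := by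
  rw [energy, energy]
  refine card_le_card_of_injOn (fun p => (f p.1, f p.2)) ?_ ?_
  · intro p hp
    simp only [coe_filter, mem_product, Set.mem_ofPred_eq] at hp ⊢
    exact ⟨⟨hf _ hp.1.1, hf _ hp.1.2⟩, h _ hp.1.1 _ hp.1.2 hp.2⟩
  · intro p hp p' hp' heq
    simp only [coe_filter, mem_product, Set.mem_ofPred_eq, Prod.mk.injEq] at hp hp' heq
    exact Prod.ext (hinj hp.1.1 hp'.1.1 heq.1) (hinj hp.1.2 hp'.1.2 heq.2)

end energy

/-- The character of `ℤ^d` attached to the rational point `ω / Q`. -/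
noncomputable def ch {d : ℕ} (Q : ℕ) (ω : Fin d → ℕ) (l : Fin d → ℤ) : ℂ :=
  e (∑ j, (l j : ℝ) * ω j / Q)

lemma ch_add {d : ℕ} (Q : ℕ) (ω : Fin d → ℕ) (l m : Fin d → ℤ) :
    ch Q ω (l + m) = ch Q ω l * ch Q ω m := by
  rw [ch, ch, ch, ← e_add, ← sum_add_distrib]
  congr 1
  refine sum_congr rfl fun j _ => ?_
  simp only [Pi.add_apply]
  push_cast
  ring

lemma norm_ch {d : ℕ} (Q : ℕ) (ω : Fin d → ℕ) (l : Fin d → ℤ) : ‖ch Q ω l‖ = 1 := norm_e _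

lemma ch_sum {d : ℕ} {ι : Type*} (Q : ℕ) (ω : Fin d → ℕ) (s : Finset ι) (f : ι → Fin d → ℤ) :
    ch Q ω (∑ i ∈ s, f i) = ∏ i ∈ s, ch Q ω (f i) := by
  classical
  induction s using Finset.induction_on with
  | empty => simp [ch, e_zero]
  | insert a s ha ih => rw [sum_insert ha, prod_insert ha, ch_add, ih]

/-- The grid of points over which characters are averaged. -/
def grid (d Q : ℕ) : Finset (Fin d → ℕ) := Fintype.piFinset fun _ => range Q

lemma sum_grid_ch {d : ℕ} (Q : ℕ) (hQ : 0 < Q) (l m : Fin d → ℤ)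
    (hl : ∀ j, 2 * |l j| < Q) (hm : ∀ j, 2 * |m j| < Q) :
    ∑ ω ∈ grid d Q, ch Q ω l * (starRingEnd ℂ) (ch Q ω m) = if l = m then (Q : ℂ) ^ d else 0 := by
  have h1 : ∀ ω : Fin d → ℕ, ch Q ω l * (starRingEnd ℂ) (ch Q ω m)
      = ∏ j, e (((l j - m j : ℤ) : ℝ) * ω j / Q) := by
    intro ω
    rw [ch, ch, ← e_sub, ← e_sum, ← sum_sub_distrib]
    congr 1
    refine sum_congr rfl fun j _ => ?_
    push_cast
    ring
  simp_rw [h1, grid]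
  rw [← prod_univ_sum (fun _ => range Q) (fun j a => e (((l j - m j : ℤ) : ℝ) * a / Q))]
  simp_rw [sum_range_e Q hQ]
  split_ifs with h
  · subst h; simp
  · obtain ⟨j, hj⟩ := Function.ne_iff.1 h
    refine prod_eq_zero (mem_univ j) ?_
    rw [if_neg]
    intro hd
    apply hj
    have := hl j
    have := hm j
    have h0 : l j - m j = 0 := by
      refine Int.eq_zero_of_abs_lt_dvd hd ?_
      have := abs_sub (l j) (m j)
      omega
    omega

/-- Parseval: the mean square of an exponential sum is the energy. -/
lemma eventually_sum_grid_eq {α : Type*} {d : ℕ} (A : Finset α) (φ : α → Fin d → ℤ) :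
    ∀ᶠ Q : ℕ in Filter.atTop,
      ∑ ω ∈ grid d Q, ‖∑ a ∈ A, ch Q ω (φ a)‖ ^ 2 = (Q : ℝ) ^ d * energy A φ := by
  classical
  filter_upwards [Filter.eventually_gt_atTop (∑ a ∈ A, ∑ j, 2 * (φ a j).natAbs)] with Q hQ
  have hQ0 : 0 < Q := by omega
  have hb : ∀ a ∈ A, ∀ j, 2 * |φ a j| < Q := by
    intro a ha j
    have h1 : 2 * (φ a j).natAbs ≤ ∑ j, 2 * (φ a j).natAbs :=
      single_le_sum (f := fun j => 2 * (φ a j).natAbs) (fun _ _ => Nat.zero_le _) (mem_univ j)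
    have h2 := single_le_sum (f := fun a => ∑ j, 2 * (φ a j).natAbs) (fun _ _ => Nat.zero_le _) ha
    rw [Int.abs_eq_natAbs]
    omega
  have key : ((∑ ω ∈ grid d Q, ‖∑ a ∈ A, ch Q ω (φ a)‖ ^ 2 : ℝ) : ℂ)
      = ((Q : ℝ) ^ d * energy A φ : ℝ) := by
    push_cast
    have h1 : ∀ ω : Fin d → ℕ, ((‖∑ a ∈ A, ch Q ω (φ a)‖ : ℂ)) ^ 2
        = ∑ p ∈ A ×ˢ A, ch Q ω (φ p.1) * (starRingEnd ℂ) (ch Q ω (φ p.2)) := by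
      intro ω
      rw [← Complex.mul_conj', map_sum, sum_mul_sum, sum_product]
    rw [sum_congr rfl fun ω _ => h1 ω, sum_comm]
    rw [sum_congr rfl fun p hp => sum_grid_ch Q hQ0 (φ p.1) (φ p.2)
      (hb _ (mem_product.1 hp).1) (hb _ (mem_product.1 hp).2)]
    rw [← sum_filter, sum_const, nsmul_eq_mul, energy, mul_comm]
    congr!
  exact_mod_cast key

/-! ### Power sums and the Linnik lemma -/

open MvPolynomial in
/-- By Newton's identities, power sums determine the polynomial with given roots. -/
lemma prod_sub_eq_of_power_sums_eq {R : Type*} [CommRing R] {d : ℕ} (x y : Fin d → R)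
    (hu : ∀ k : ℕ, 1 ≤ k → k ≤ d → IsUnit (k : R))
    (h : ∀ k : ℕ, 1 ≤ k → k ≤ d → ∑ i, x i ^ k = ∑ i, y i ^ k) (T : R) :
    ∏ i, (T - x i) = ∏ i, (T - y i) := by
  have he : ∀ k : ℕ, k ≤ d → aeval x (esymm (Fin d) R k) = aeval y (esymm (Fin d) R k) := by
    intro k
    induction k using Nat.strong_induction_on with
    | _ k ih =>
      intro hk
      rcases Nat.eq_zero_or_pos k with rfl | hpos
      · simp
      · apply (hu k hpos hk).mul_left_cancel
        have key : ∀ z : Fin d → R, (k : R) * aeval z (esymm (Fin d) R k)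
            = (-1) ^ (k + 1) * ∑ a ∈ antidiagonal k with a.1 < k,
              (-1) ^ a.1 * aeval z (esymm (Fin d) R a.1) * ∑ i, z i ^ a.2 := by
          intro z
          have := congrArg (aeval z) (mul_esymm_eq_sum (Fin d) R k)
          simpa [psum] using this
        rw [key, key]
        congr 1
        refine sum_congr rfl fun a ha => ?_
        rw [mem_filter, HasAntidiagonal.mem_antidiagonal] at ha
        rw [ih a.1 ha.2 (by omega), h a.2 (by omega) (by omega)]
  have hp : ∀ z : Fin d → R, ∏ i, (T - z i)
      = ∑ j ∈ range (d + 1), (-1) ^ j * (aeval z (esymm (Fin d) R j) * T ^ (d - j)) := by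
    intro z
    have h1 := Multiset.prod_X_sub_X_eq_sum_esymm (univ.val.map z)
    have h2 := congrArg (Polynomial.eval T) h1
    simp only [Multiset.map_map, Multiset.card_map, card_val, card_univ, Fintype.card_fin] at h2
    rw [Polynomial.eval_multiset_prod, Multiset.map_map] at h2
    simp only [Function.comp_def, Polynomial.eval_sub, Polynomial.eval_X, Polynomial.eval_C,
      Polynomial.eval_finsetSum, Polynomial.eval_mul, Polynomial.eval_pow, Polynomial.eval_neg,
      Polynomial.eval_one, ← aeval_esymm_eq_multiset_esymm (Fin d) R] at h2
    exact h2
  rw [hp, hp]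
  refine sum_congr rfl fun j hj => ?_
  rw [he j (by rw [mem_range] at hj; omega)]

/-- Power sums modulo `p ^ d` determine a tuple of integers distinct modulo `p`, up to the choice of
order. -/
lemma exists_modEq_of_power_sums {p d : ℕ} (hp : p.Prime) (hpd : d < p) (x y : Fin d → ℤ)
    (hx : Function.Injective fun i => (x i : ZMod p))
    (h : ∀ k : ℕ, 1 ≤ k → k ≤ d → ((p ^ d : ℕ) : ℤ) ∣ ∑ i, x i ^ k - ∑ i, y i ^ k) (i : Fin d) :
    ∃ j, ((p ^ d : ℕ) : ℤ) ∣ y i - x j := by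
  have hu : ∀ k : ℕ, 1 ≤ k → k ≤ d → IsUnit (k : ZMod (p ^ d)) := by
    intro k h1 h2
    rw [ZMod.isUnit_iff_coprime]
    apply Nat.Coprime.pow_right
    rw [Nat.coprime_comm, hp.coprime_iff_not_dvd]
    intro hd
    have := Nat.le_of_dvd (by omega) hd
    omega
  have h2 := prod_sub_eq_of_power_sums_eq (R := ZMod (p ^ d)) (fun i => (x i : ZMod (p ^ d)))
    (fun i => (y i : ZMod (p ^ d))) hu (by
      intro k h1 h2
      have := (ZMod.intCast_zmod_eq_zero_iff_dvd _ _).2 (h k h1 h2)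
      push_cast at this
      exact sub_eq_zero.1 this) (y i : ZMod (p ^ d))
  have h3 : ∏ j, ((y i : ZMod (p ^ d)) - x j) = 0 := by
    rw [h2]
    exact prod_eq_zero (mem_univ i) (sub_self _)
  have h4 : ((p ^ d : ℕ) : ℤ) ∣ ∏ j, (y i - x j) := by
    rw [← ZMod.intCast_zmod_eq_zero_iff_dvd]
    push_cast
    exact h3
  have hd : 0 < d := i.pos
  have hpp : Prime (p : ℤ) := Nat.prime_iff_prime_int.1 hp
  have h5 : (p : ℤ) ∣ ∏ j, (y i - x j) := by
    refine dvd_trans ?_ h4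
    push_cast
    exact dvd_pow_self _ hd.ne'
  obtain ⟨j, -, hj⟩ := (hpp.dvd_finsetProd_iff _).1 h5
  refine ⟨j, ?_⟩
  rw [← mul_prod_erase univ _ (mem_univ j)] at h4
  refine IsCoprime.dvd_of_dvd_mul_right ?_ h4
  push_cast
  apply IsCoprime.pow_left
  rw [hpp.irreducible.coprime_iff_not_dvd]
  intro hdd
  obtain ⟨j', hj', hj2⟩ := (hpp.dvd_finsetProd_iff _).1 hdd
  apply (mem_erase.1 hj').1
  apply hx
  have := dvd_sub hj hj2
  rw [sub_sub_sub_cancel_left] at this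
  simp only
  rw [← sub_eq_zero, ← Int.cast_sub, ZMod.intCast_zmod_eq_zero_iff_dvd]
  exact this

/-- The Linnik lemma. -/
lemma card_congruence_solutions_le {p d : ℕ} (hp : p.Prime) (hpd : d < p) (S : Finset (Fin d → ℤ))
    (c : ℤ) (hS : ∀ x ∈ S, ∀ i, 1 ≤ x i ∧ x i ≤ (p ^ d : ℕ))
    (hinj : ∀ x ∈ S, Function.Injective fun i => (x i : ZMod p)) (m : Fin d → ℤ)
    (hm : ∀ x ∈ S, ∀ j : Fin d,
      ((p ^ (j.val + 1) : ℕ) : ℤ) ∣ ∑ i, (x i - c) ^ (j.val + 1) - m j) :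
    #S ≤ d ^ d * p ^ (d * (d - 1) / 2) := by
  classical
  have hp0 : 0 < p := hp.pos
  let F : (Fin d → ℤ) → (j : Fin d) → ZMod (p ^ (d - 1 - j.val)) := fun x j =>
    (((∑ i, (x i - c) ^ (j.val + 1) - m j) / ((p ^ (j.val + 1) : ℕ) : ℤ) : ℤ) : ZMod _)
  have : ∀ j : Fin d, NeZero (p ^ (d - 1 - j.val)) := fun j => ⟨by positivity⟩
  have hcard : Fintype.card ((j : Fin d) → ZMod (p ^ (d - 1 - j.val))) = p ^ (d * (d - 1) / 2) := by
    rw [Fintype.card_pi]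
    simp only [ZMod.card]
    rw [prod_pow_eq_pow_sum, Fin.sum_univ_eq_sum_range (fun j => d - 1 - j) d,
      sum_range_reflect (fun j => j) d, sum_range_id]
  have hfib : ∀ z ∈ (univ : Finset ((j : Fin d) → ZMod (p ^ (d - 1 - j.val)))),
      #{x ∈ S | F x = z} ≤ d ^ d := by
    intro z _
    rcases (filter (fun x => F x = z) S).eq_empty_or_nonempty with h0 | ⟨x, hx⟩
    · rw [h0]; simp
    · rw [mem_filter] at hx
      have : (filter (fun x => F x = z) S) ⊆ Fintype.piFinset fun _ => univ.image x := by
        intro y hy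
        rw [mem_filter] at hy
        rw [Fintype.mem_piFinset]
        intro i
        have hk : ∀ k : ℕ, 1 ≤ k → k ≤ d →
            ((p ^ d : ℕ) : ℤ) ∣ ∑ i, (x i - c) ^ k - ∑ i, (y i - c) ^ k := by
          intro k h1 h2
          obtain ⟨k, rfl⟩ : ∃ k', k = k' + 1 := ⟨k - 1, by omega⟩
          have hF : F x ⟨k, by omega⟩ = F y ⟨k, by omega⟩ := by rw [hx.2, hy.2]
          simp only [F] at hF
          obtain ⟨a, ha⟩ := hm x hx.1 ⟨k, by omega⟩
          obtain ⟨b, hb⟩ := hm y hy.1 ⟨k, by omega⟩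
          simp only at ha hb
          have hne : ((p ^ (k + 1) : ℕ) : ℤ) ≠ 0 := by positivity
          rw [ha, hb, Int.mul_ediv_cancel_left _ hne, Int.mul_ediv_cancel_left _ hne,
            ← sub_eq_zero, ← Int.cast_sub, ZMod.intCast_zmod_eq_zero_iff_dvd] at hF
          have e1 : ∑ i, (x i - c) ^ (k + 1) - ∑ i, (y i - c) ^ (k + 1)
              = ((p ^ (k + 1) : ℕ) : ℤ) * (a - b) := by linear_combination ha - hb
          rw [e1]
          have e2 : ((p ^ d : ℕ) : ℤ) = ((p ^ (k + 1) : ℕ) : ℤ) * ((p ^ (d - 1 - k) : ℕ) : ℤ) := by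
            rw [← Nat.cast_mul, ← pow_add]
            congr 2
            omega
          rw [e2]
          exact mul_dvd_mul_left _ hF
        obtain ⟨j, hj⟩ := exists_modEq_of_power_sums hp hpd (fun i => x i - c) (fun i => y i - c)
          (by
            intro i j hij
            apply hinj x hx.1
            push_cast at hij
            simpa using hij) hk i
        rw [mem_image]
        refine ⟨j, mem_univ _, ?_⟩
        rw [sub_sub_sub_cancel_right] at hj
        have b1 := hS x hx.1 j
        have b2 := hS y hy.1 i
        have : y i - x j = 0 := by
          refine Int.eq_zero_of_abs_lt_dvd hj ?_
          rw [abs_lt]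
          constructor <;> omega
        omega
      refine (card_le_card this).trans ?_
      rw [Fintype.card_piFinset]
      simp only [prod_const, card_univ, Fintype.card_fin]
      exact Nat.pow_le_pow_left (card_image_le.trans (by simp)) d
  have := card_le_mul_card_image_of_maps_to (f := F) (s := S) (t := univ) (fun _ _ => mem_univ _)
      (d ^ d) hfib
  rw [card_univ, hcard] at this
  exact this

/-! ### Vinogradov systems -/

/-- The vector of the first `d` power sums of a tuple. -/
def powSum (d : ℕ) {s : ℕ} (x : Fin s → ℤ) : Fin d → ℤ := fun j => ∑ i, x i ^ (j.val + 1)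

/-- Tuples with entries in `A`. -/
def tup (s : ℕ) (A : Finset ℤ) : Finset (Fin s → ℤ) := Fintype.piFinset fun _ => A

lemma mem_tup {s : ℕ} {A : Finset ℤ} {x : Fin s → ℤ} : x ∈ tup s A ↔ ∀ i, x i ∈ A :=
  Fintype.mem_piFinset

lemma card_tup (s : ℕ) (A : Finset ℤ) : #(tup s A) = #A ^ s := by
  simp [tup, Fintype.card_piFinset]

/-- Vinogradov's system: the number of solutions in `A` of the equations of degree at most `d` in
`2 s` variables. -/
noncomputable def J (d s : ℕ) (A : Finset ℤ) : ℕ := energy (tup s A) (powSum d)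

/-- The exponential sum over `A` on the moment curve. -/
noncomputable def expSum {d : ℕ} (Q : ℕ) (ω : Fin d → ℕ) (A : Finset ℤ) : ℂ :=
  ∑ a ∈ A, ch Q ω (fun j => a ^ (j.val + 1))

lemma ch_powSum {d s : ℕ} (Q : ℕ) (ω : Fin d → ℕ) (x : Fin s → ℤ) :
    ch Q ω (powSum d x) = ∏ i, ch Q ω (fun j => x i ^ (j.val + 1)) := by
  rw [← ch_sum]
  congr 1
  ext j
  simp [powSum]

lemma sum_tup_ch {d s : ℕ} (Q : ℕ) (ω : Fin d → ℕ) (A : Finset ℤ) :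
    ∑ x ∈ tup s A, ch Q ω (powSum d x) = expSum Q ω A ^ s := by
  simp_rw [ch_powSum]
  rw [tup, ← prod_univ_sum (fun _ => A) (fun _ a => ch Q ω (fun j => a ^ (j.val + 1)))]
  simp [expSum]

lemma eventually_sum_expSum (d s : ℕ) (A : Finset ℤ) :
    ∀ᶠ Q : ℕ in Filter.atTop,
      ∑ ω ∈ grid d Q, ‖expSum Q ω A‖ ^ (2 * s) = (Q : ℝ) ^ d * J d s A := by
  filter_upwards [eventually_sum_grid_eq (tup s A) (powSum d)] with Q hQ
  rw [J, ← hQ]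
  refine sum_congr rfl fun ω _ => ?_
  rw [sum_tup_ch, norm_pow, ← pow_mul, mul_comm s]

lemma norm_expSum_le {d : ℕ} (Q : ℕ) (ω : Fin d → ℕ) (A : Finset ℤ) : ‖expSum Q ω A‖ ≤ #A := by
  refine (norm_sum_le _ _).trans ?_
  simp [norm_ch]

lemma J_add_le (d s t : ℕ) (A : Finset ℤ) : J d (t + s) A ≤ #A ^ (2 * t) * J d s A := by
  obtain ⟨Q, h1, h2, h3⟩ := ((eventually_sum_expSum d (t + s) A).and
    ((eventually_sum_expSum d s A).and (Filter.eventually_gt_atTop 0))).exists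
  have hQ : (0 : ℝ) < (Q : ℝ) ^ d := by positivity
  have : (Q : ℝ) ^ d * J d (t + s) A ≤ (Q : ℝ) ^ d * (#A ^ (2 * t) * J d s A) := by
    rw [← h1, mul_left_comm, ← h2, mul_sum]
    refine sum_le_sum fun ω _ => ?_
    rw [mul_add, pow_add]
    gcongr
    exact norm_expSum_le Q ω A
  have := le_of_mul_le_mul_left this hQ
  exact_mod_cast this

lemma J_le_card_pow (d s : ℕ) (A : Finset ℤ) : J d s A ≤ #A ^ (2 * s) := by
  refine (energy_le_card_sq _ _).trans ?_
  rw [card_tup, two_mul, pow_add]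

lemma sum_sub_pow_eq {d s : ℕ} {x y : Fin s → ℤ} (h : powSum d x = powSum d y) (c : ℤ) {k : ℕ}
    (hk : k ≤ d) : ∑ i, (x i - c) ^ k = ∑ i, (y i - c) ^ k := by
  simp_rw [sub_eq_add_neg, add_pow]
  rw [sum_comm, sum_comm (s := univ)]
  refine sum_congr rfl fun m hm => ?_
  rw [← sum_mul, ← sum_mul, ← sum_mul, ← sum_mul]
  congr 2
  rw [mem_range] at hm
  rcases Nat.eq_zero_or_pos m with rfl | h0
  · simp
  · have := congrFun h ⟨m - 1, by omega⟩
    simpa [powSum, Nat.sub_add_cancel h0] using this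

/-- Translation-dilation invariance. -/
lemma J_le_of_affine {d s : ℕ} {A B : Finset ℤ} (c p : ℤ) (hp : p ≠ 0) (g : ℤ → ℤ)
    (hg : ∀ a ∈ A, a = c + p * g a) (hB : ∀ a ∈ A, g a ∈ B) : J d s A ≤ J d s B := by
  refine energy_le_of_injOn _ _ _ _ (fun x i => g (x i)) ?_ ?_ ?_
  · intro x hx
    rw [mem_tup] at hx ⊢
    exact fun i => hB _ (hx i)
  · intro x hx y hy hxy
    rw [mem_coe, mem_tup] at hx hy
    funext i
    have h1 : g (x i) = g (y i) := congrFun hxy i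
    rw [hg _ (hx i), hg _ (hy i), h1]
  · intro x hx y hy hxy
    rw [mem_tup] at hx hy
    funext j
    have h1 := sum_sub_pow_eq hxy c (k := j.val + 1) (by omega)
    have h2 : ∀ z : Fin s → ℤ, (∀ i, z i ∈ A) →
        ∑ i, (z i - c) ^ (j.val + 1) = p ^ (j.val + 1) * ∑ i, g (z i) ^ (j.val + 1) := by
      intro z hz
      rw [mul_sum]
      refine sum_congr rfl fun i _ => ?_
      rw [← mul_pow]
      congr 1
      linear_combination hg _ (hz i)
    rw [h2 x hx, h2 y hy] at h1
    exact mul_left_cancel₀ (pow_ne_zero _ hp) h1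

/-- The part of `A` lying in the residue class `r` modulo `p`. -/
def cls (p : ℕ) (A : Finset ℤ) (r : ZMod p) : Finset ℤ := {a ∈ A | (a : ZMod p) = r}

lemma mem_cls {p : ℕ} {A : Finset ℤ} {r : ZMod p} {a : ℤ} :
    a ∈ cls p A r ↔ a ∈ A ∧ (a : ZMod p) = r := mem_filter

lemma dvd_of_mem_cls {p : ℕ} [NeZero p] {A : Finset ℤ} {r : ZMod p} {a : ℤ}
    (h : a ∈ cls p A r) : (p : ℤ) ∣ a - r.val := by
  rw [← ZMod.intCast_zmod_eq_zero_iff_dvd]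
  push_cast
  rw [(mem_cls.1 h).2]
  simp

lemma J_cls_le (d s p X : ℕ) [NeZero p] (r : ZMod p) :
    J d s (cls p (Icc 1 (X : ℤ)) r) ≤ J d s (Icc 1 ((X / p + 1 : ℕ) : ℤ)) := by
  have hp : (p : ℤ) ≠ 0 := by exact_mod_cast NeZero.ne p
  have hp0 : (0 : ℤ) < p := by exact_mod_cast NeZero.pos p
  have hkey : ∀ a ∈ cls p (Icc 1 (X : ℤ)) r, (p : ℤ) * ((a - r.val) / p) = a - r.val :=
    fun a ha => Int.mul_ediv_cancel' (dvd_of_mem_cls ha)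
  refine J_le_of_affine (r.val - p : ℤ) p hp (fun a => (a - r.val) / p + 1) ?_ ?_
  · intro a ha
    linear_combination -(hkey a ha)
  · intro a ha
    have h1 := (mem_Icc.1 (mem_cls.1 ha).1)
    have h2 := ZMod.val_lt r
    rw [mem_Icc]
    push_cast
    constructor
    · have h3 : (-1 : ℤ) < (a - r.val) / p := by
        by_contra hcon
        have h4 : (a - (r.val : ℤ)) / p ≤ -1 := by omega
        have h5 := mul_le_mul_of_nonneg_left h4 hp0.le
        rw [hkey a ha] at h5
        omega
      omega
    · have := Int.ediv_le_ediv hp0 (show a - (r.val : ℤ) ≤ X by omega)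
      omega

lemma norm_sum_pow_le {ι : Type*} (C : Finset ι) (z : ι → ℂ) (n m : ℕ) (hC : #C ≤ n) :
    ‖∑ r ∈ C, z r‖ ^ (m + 1) ≤ (n : ℝ) ^ m * ∑ r ∈ C, ‖z r‖ ^ (m + 1) := by
  have h0 : 0 ≤ ∑ r ∈ C, ‖z r‖ ^ (m + 1) := sum_nonneg fun _ _ => by positivity
  rcases C.eq_empty_or_nonempty with rfl | hne
  · simp
  have h1 := pow_sum_div_card_le_sum_pow (s := C) (f := fun r => ‖z r‖) (fun _ _ => norm_nonneg _) m
  have h2 : (0 : ℝ) < (#C : ℝ) ^ m := by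
    have := hne.card_pos
    positivity
  rw [div_le_iff₀ h2] at h1
  calc ‖∑ r ∈ C, z r‖ ^ (m + 1) ≤ (∑ r ∈ C, ‖z r‖) ^ (m + 1) := by gcongr; exact norm_sum_le _ _
    _ ≤ (∑ r ∈ C, ‖z r‖ ^ (m + 1)) * (#C : ℝ) ^ m := h1
    _ ≤ (∑ r ∈ C, ‖z r‖ ^ (m + 1)) * (n : ℝ) ^ m := by gcongr
    _ = _ := mul_comm _ _

lemma expSum_filter_eq {d p : ℕ} (Q : ℕ) (ω : Fin d → ℕ) (A : Finset ℤ) (C : Finset (ZMod p)) :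
    expSum Q ω {a ∈ A | (a : ZMod p) ∈ C} = ∑ r ∈ C, expSum Q ω (cls p A r) := by
  classical
  rw [expSum, ← sum_fiberwise_of_maps_to (t := C) (g := fun a : ℤ => (a : ZMod p))
    (fun a ha => (mem_filter.1 ha).2)]
  refine sum_congr rfl fun r hr => ?_
  rw [expSum]
  refine sum_congr ?_ fun _ _ => rfl
  ext a
  simp only [mem_filter, mem_cls]
  constructor
  · rintro ⟨⟨h1, h2⟩, h3⟩; exact ⟨h1, h3⟩
  · rintro ⟨h1, h3⟩; exact ⟨⟨h1, h3 ▸ hr⟩, h3⟩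

/-- Weighted energy estimate by splitting one factor into residue classes. -/
lemma energy_prod_le {β : Type*} {d p s n N : ℕ} (hs : 1 ≤ s) (G : Finset β) (ψ : β → Fin d → ℤ)
    (A : Finset ℤ) (C : Finset (ZMod p)) (hC : #C ≤ n)
    (hN : ∀ r ∈ C, energy (G ×ˢ tup s (cls p A r)) (fun z => ψ z.1 + powSum d z.2) ≤ N) :
    energy (G ×ˢ tup s {a ∈ A | (a : ZMod p) ∈ C}) (fun z => ψ z.1 + powSum d z.2)
      ≤ n ^ (2 * s) * N := by
  have hfac : ∀ (Q : ℕ) (ω : Fin d → ℕ) (B : Finset ℤ),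
      ∑ z ∈ G ×ˢ tup s B, ch Q ω (ψ z.1 + powSum d z.2)
        = (∑ b ∈ G, ch Q ω (ψ b)) * expSum Q ω B ^ s := by
    intro Q ω B
    rw [← sum_tup_ch, sum_mul_sum, sum_product]
    simp_rw [ch_add]
  obtain ⟨Q, h1, h2, h3⟩ := ((eventually_sum_grid_eq
      (G ×ˢ tup s {a ∈ A | (a : ZMod p) ∈ C}) (fun z => ψ z.1 + powSum d z.2)).and
    (((Filter.eventually_all_finset C).2 fun r _ => eventually_sum_grid_eq
      (G ×ˢ tup s (cls p A r)) (fun z => ψ z.1 + powSum d z.2)).and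
      (Filter.eventually_gt_atTop 0))).exists
  have hQ : (0 : ℝ) < (Q : ℝ) ^ d := by positivity
  simp_rw [hfac, norm_mul, mul_pow, norm_pow, ← pow_mul] at h1 h2
  obtain ⟨m, hm⟩ : ∃ m, s * 2 = m + 1 := ⟨s * 2 - 1, by omega⟩
  have key : (Q : ℝ) ^ d * energy (G ×ˢ tup s {a ∈ A | (a : ZMod p) ∈ C})
      (fun z => ψ z.1 + powSum d z.2) ≤ (Q : ℝ) ^ d * ((n : ℝ) ^ (m + 1) * N) := by
    rw [← h1]
    calc ∑ ω ∈ grid d Q, ‖∑ b ∈ G, ch Q ω (ψ b)‖ ^ 2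
          * ‖expSum Q ω {a ∈ A | (a : ZMod p) ∈ C}‖ ^ (s * 2)
        ≤ ∑ ω ∈ grid d Q, ‖∑ b ∈ G, ch Q ω (ψ b)‖ ^ 2
          * ((n : ℝ) ^ m * ∑ r ∈ C, ‖expSum Q ω (cls p A r)‖ ^ (s * 2)) := by
          refine sum_le_sum fun ω _ => ?_
          gcongr
          rw [expSum_filter_eq, hm]
          exact norm_sum_pow_le C _ n m hC
      _ = (n : ℝ) ^ m * ∑ r ∈ C, ∑ ω ∈ grid d Q, ‖∑ b ∈ G, ch Q ω (ψ b)‖ ^ 2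
          * ‖expSum Q ω (cls p A r)‖ ^ (s * 2) := by
          rw [sum_comm, mul_sum]
          refine sum_congr rfl fun ω _ => ?_
          rw [mul_left_comm, mul_sum, mul_sum]
      _ ≤ (n : ℝ) ^ m * ∑ r ∈ C, (Q : ℝ) ^ d * N := by
          gcongr with r hr
          rw [h2 r hr]
          gcongr
          exact_mod_cast hN r hr
      _ = (Q : ℝ) ^ d * ((n : ℝ) ^ m * #C * N) := by
          rw [sum_const, nsmul_eq_mul]; ring
      _ ≤ (Q : ℝ) ^ d * ((n : ℝ) ^ m * n * N) := by gcongr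
      _ = _ := by rw [pow_succ]
  have := le_of_mul_le_mul_left key hQ
  rw [mul_comm 2 s, hm]
  exact_mod_cast this

/-! ### The recursive inequality for the mean value -/

open scoped Classical in
/-- Tuples whose entries are distinct modulo `p`. -/
noncomputable def distinctTup (p d : ℕ) (A : Finset ℤ) : Finset (Fin d → ℤ) :=
  {x ∈ tup d A | Function.Injective fun i => (x i : ZMod p)}

lemma mem_distinctTup {p d : ℕ} {A : Finset ℤ} {x : Fin d → ℤ} :
    x ∈ distinctTup p d A ↔ x ∈ tup d A ∧ Function.Injective fun i => (x i : ZMod p) := by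
  rw [distinctTup, mem_filter]

lemma energy_distinct_cls_le {p d s X : ℕ} (hp : p.Prime) (hpd : d < p) (hX : X ≤ p ^ d)
    (r : ZMod p) :
    energy (distinctTup p d (Icc 1 (X : ℤ)) ×ˢ tup s (cls p (Icc 1 (X : ℤ)) r))
      (fun z => powSum d z.1 + powSum d z.2)
      ≤ J d s (Icc 1 ((X / p + 1 : ℕ) : ℤ)) * (d ^ d * p ^ (d * (d - 1) / 2) * X ^ d) := by
  classical
  have : NeZero p := ⟨hp.pos.ne'⟩
  set G := distinctTup p d (Icc 1 (X : ℤ)) with hG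
  set B := tup s (cls p (Icc 1 (X : ℤ)) r) with hB
  set c : ℤ := ((ZMod.val r : ℕ) : ℤ) with hc
  set P : Finset ((Fin d → ℤ) × (Fin d → ℤ)) := {z ∈ G ×ˢ G | ∀ j : Fin d,
    ((p ^ (j.val + 1) : ℕ) : ℤ) ∣ ∑ i, (z.1 i - c) ^ (j.val + 1)
      - ∑ i, (z.2 i - c) ^ (j.val + 1)} with hP
  have hGm : ∀ x ∈ G, (∀ i, 1 ≤ x i ∧ x i ≤ (X : ℤ)) ∧
      Function.Injective fun i => (x i : ZMod p) := by
    intro x hx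
    rw [hG, mem_distinctTup, mem_tup] at hx
    exact ⟨fun i => mem_Icc.1 (hx.1 i), hx.2⟩
  have hcardG : #G ≤ X ^ d := by
    refine (card_le_card (t := tup d (Icc 1 (X : ℤ))) fun x hx => (mem_distinctTup.1 hx).1).trans ?_
    rw [card_tup]
    simp
  have hcardP : #P ≤ d ^ d * p ^ (d * (d - 1) / 2) * X ^ d := by
    have h1 := card_le_mul_card_image_of_maps_to (f := Prod.snd) (s := P) (t := G)
      (fun z hz => (mem_product.1 (mem_filter.1 hz).1).2) (d ^ d * p ^ (d * (d - 1) / 2)) (by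
        intro y hy
        refine le_trans (card_le_card_of_injOn (t := {x ∈ G | ∀ j : Fin d,
          ((p ^ (j.val + 1) : ℕ) : ℤ) ∣ ∑ i, (x i - c) ^ (j.val + 1)
            - ∑ i, (y i - c) ^ (j.val + 1)}) Prod.fst ?_ ?_)
          (card_congruence_solutions_le hp hpd _ c ?_ ?_
            (fun j => ∑ i, (y i - c) ^ (j.val + 1)) ?_)
        · intro z hz
          rw [mem_coe, mem_filter, hP, mem_filter, mem_product] at hz
          rw [mem_coe, mem_filter]
          exact ⟨hz.1.1.1, hz.2 ▸ hz.1.2⟩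
        · intro z hz w hw h
          rw [mem_coe, mem_filter] at hz hw
          exact Prod.ext h (hz.2.trans hw.2.symm)
        · intro x hx i
          have := (hGm x (mem_filter.1 hx).1).1 i
          have h2 : (X : ℤ) ≤ (p ^ d : ℕ) := by exact_mod_cast hX
          exact ⟨this.1, this.2.trans h2⟩
        · exact fun x hx => (hGm x (mem_filter.1 hx).1).2
        · exact fun x hx => (mem_filter.1 hx).2)
    exact h1.trans (by gcongr)
  have hB2 : ∀ u ∈ B, ∀ i, (p : ℤ) ∣ u i - c := fun u hu i => dvd_of_mem_cls (mem_tup.1 hu i)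
  have hshift : ∀ (z : (Fin d → ℤ) × (Fin s → ℤ)) (w : (Fin d → ℤ) × (Fin s → ℤ)),
      z.2 ∈ B → w.2 ∈ B → powSum d z.1 + powSum d z.2 = powSum d w.1 + powSum d w.2 →
      ∀ j : Fin d, ((p ^ (j.val + 1) : ℕ) : ℤ) ∣ ∑ i, (z.1 i - c) ^ (j.val + 1)
      - ∑ i, (w.1 i - c) ^ (j.val + 1) := by
    intro z w hz hw h j
    have h1 : powSum d (Fin.append z.1 z.2) = powSum d (Fin.append w.1 w.2) := by
      funext j
      have := congrFun h j
      simpa [powSum, Fin.sum_univ_add] using this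
    have h2 := sum_sub_pow_eq h1 c (k := j.val + 1) (by omega)
    simp only [Fin.sum_univ_add, Fin.append_left, Fin.append_right] at h2
    have h3 : ∀ u ∈ B, ((p ^ (j.val + 1) : ℕ) : ℤ) ∣ ∑ i, (u i - c) ^ (j.val + 1) := by
      intro u hu
      refine dvd_sum fun i _ => ?_
      push_cast
      exact pow_dvd_pow_of_dvd (hB2 u hu i) _
    have h4 : ∑ i, (z.1 i - c) ^ (j.val + 1) - ∑ i, (w.1 i - c) ^ (j.val + 1)
        = ∑ i, (w.2 i - c) ^ (j.val + 1) - ∑ i, (z.2 i - c) ^ (j.val + 1) := by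
      linear_combination h2
    rw [h4]
    exact dvd_sub (h3 _ hw) (h3 _ hz)
  rw [energy]
  refine (card_le_mul_card_image_of_maps_to (f := fun q => (q.1.1, q.2.1)) (t := P) ?_
    (J d s (Icc 1 ((X / p + 1 : ℕ) : ℤ))) ?_).trans (Nat.mul_le_mul_left _ hcardP)
  · intro q hq
    simp only [mem_filter, mem_product] at hq
    rw [hP, mem_filter, mem_product]
    exact ⟨⟨hq.1.1.1, hq.1.2.1⟩, hshift _ _ hq.1.1.2 hq.1.2.2 hq.2⟩
  · intro xy _
    refine le_trans ?_ ((card_shift_le_energy B (powSum d) (powSum d xy.2 - powSum d xy.1)).trans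
      (J_cls_le d s p X r))
    refine card_le_card_of_injOn (fun q => (q.1.2, q.2.2)) ?_ ?_
    · intro q hq
      simp only [mem_coe, mem_filter, mem_product] at hq ⊢
      refine ⟨⟨hq.1.1.1.2, hq.1.1.2.2⟩, ?_⟩
      have h1 := hq.1.2
      rw [← hq.2]
      linear_combination h1
    · intro q hq q' hq' h
      rw [mem_coe, mem_filter] at hq hq'
      have h1 := hq.2.trans hq'.2.symm
      simp only [Prod.mk.injEq] at h h1
      exact Prod.ext (Prod.ext h1.1 h.1) (Prod.ext h1.2 h.2)

lemma J_filter_le {d s p n N : ℕ} (hs : 1 ≤ s) (A : Finset ℤ) (C : Finset (ZMod p)) (hC : #C ≤ n)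
    (hN : ∀ r ∈ C, J d s (cls p A r) ≤ N) :
    J d s {a ∈ A | (a : ZMod p) ∈ C} ≤ n ^ (2 * s) * N := by
  refine (energy_le_of_injOn _ ((univ : Finset Unit) ×ˢ tup s {a ∈ A | (a : ZMod p) ∈ C}) _
    (fun z => (fun _ => (0 : Fin d → ℤ)) z.1 + powSum d z.2) (fun x => ((), x)) ?_ ?_ ?_).trans
    (energy_prod_le hs univ (fun _ => 0) A C hC fun r hr => ?_)
  · intro x hx; simpa using hx
  · intro x _ y _ h; simpa using h
  · intro x _ y _ h; simpa using h
  · refine (energy_le_of_injOn _ (tup s (cls p A r)) _ (powSum d) Prod.snd ?_ ?_ ?_).trans (hN r hr)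
    · intro x hx; exact (mem_product.1 hx).2
    · intro x _ y _ h; exact Prod.ext rfl h
    · intro x _ y _ h; simpa using h

lemma energy_few_classes_le {d b p X : ℕ} [NeZero p] (hb : 1 ≤ b) :
    energy {x ∈ tup b (Icc 1 (X : ℤ)) | #(univ.image fun i => (x i : ZMod p)) < d} (powSum d)
      ≤ p ^ (2 * d) * (d ^ (2 * b) * J d b (Icc 1 ((X / p + 1 : ℕ) : ℤ))) := by
  classical
  refine (energy_le_card_mul_sum (univ : Finset (Fin d → ZMod p)) _
    (fun c => tup b {a ∈ Icc 1 (X : ℤ) | (a : ZMod p) ∈ univ.image c}) _ ?_).trans ?_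
  · intro x hx
    rw [mem_filter, mem_tup] at hx
    set I := univ.image fun i => (x i : ZMod p) with hI
    refine ⟨fun i => if h : i.val < #I then (I.equivFin.symm ⟨i, h⟩ : ZMod p) else 0,
      mem_univ _, ?_⟩
    rw [mem_tup]
    intro i
    rw [mem_filter]
    refine ⟨hx.1 i, ?_⟩
    have hi : (x i : ZMod p) ∈ I := mem_image_of_mem _ (mem_univ i)
    have hlt := (I.equivFin ⟨_, hi⟩).2
    rw [mem_image]
    refine ⟨⟨(I.equivFin ⟨_, hi⟩).val, by omega⟩, mem_univ _, ?_⟩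
    simp
  · have h1 : ∀ c ∈ (univ : Finset (Fin d → ZMod p)),
        energy (tup b {a ∈ Icc 1 (X : ℤ) | (a : ZMod p) ∈ univ.image c}) (powSum d)
          ≤ d ^ (2 * b) * J d b (Icc 1 ((X / p + 1 : ℕ) : ℤ)) := fun c _ =>
      J_filter_le hb _ _ (card_image_le.trans (by simp)) fun r _ => J_cls_le d b p X r
    refine (Nat.mul_le_mul_left _ (sum_le_card_nsmul _ _ _ h1)).trans_eq ?_
    simp only [card_univ, Fintype.card_fun, ZMod.card, Fintype.card_fin, smul_eq_mul]
    ring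

lemma energy_many_classes_le {d s p X : ℕ} (hp : p.Prime) (hpd : d < p) (hX : X ≤ p ^ d)
    (hs : 1 ≤ s) :
    energy {x ∈ tup (d + s) (Icc 1 (X : ℤ)) | d ≤ #(univ.image fun i => (x i : ZMod p))} (powSum d)
      ≤ ((d + s).factorial) ^ 2 * (p ^ (2 * s) * (J d s (Icc 1 ((X / p + 1 : ℕ) : ℤ))
        * (d ^ d * p ^ (d * (d - 1) / 2) * X ^ d))) := by
  classical
  have : NeZero p := ⟨hp.pos.ne'⟩
  set A := Icc 1 (X : ℤ) with hA
  set T : Finset (Fin (d + s) → ℤ) :=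
    {x ∈ tup (d + s) A | Function.Injective fun i : Fin d => (x (Fin.castAdd s i) : ZMod p)} with hT
  have hTE : energy T (powSum d) ≤ p ^ (2 * s) * (J d s (Icc 1 ((X / p + 1 : ℕ) : ℤ))
        * (d ^ d * p ^ (d * (d - 1) / 2) * X ^ d)) := by
    refine (energy_le_of_injOn _ (distinctTup p d A ×ˢ
      tup s {a ∈ A | (a : ZMod p) ∈ (univ : Finset (ZMod p))}) _
      (fun z => powSum d z.1 + powSum d z.2)
      (fun x => (fun i => x (Fin.castAdd s i), fun i => x (Fin.natAdd d i))) ?_ ?_ ?_).trans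
      (energy_prod_le hs _ _ A univ (n := p) (by simp)
        fun r _ => energy_distinct_cls_le hp hpd hX r)
    · intro x hx
      rw [hT, mem_filter, mem_tup] at hx
      rw [mem_product, mem_distinctTup, mem_tup, mem_tup]
      exact ⟨⟨fun i => hx.1 _, hx.2⟩, fun i => by simpa using hx.1 _⟩
    · intro x _ y _ h
      simp only [Prod.mk.injEq] at h
      funext i
      refine Fin.addCases (fun i => ?_) (fun i => ?_) i
      · exact congrFun h.1 i
      · exact congrFun h.2 i
    · intro x _ y _ h
      funext j
      have := congrFun h j
      simpa [powSum, Fin.sum_univ_add] using this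
  refine (energy_le_card_mul_sum (univ : Finset (Equiv.Perm (Fin (d + s)))) _
    (fun σ => {x ∈ tup (d + s) A | x ∘ σ ∈ T}) _ ?_).trans ?_
  · intro x hx
    rw [mem_filter] at hx
    set I := univ.image fun i => (x i : ZMod p) with hI
    have hmem : ∀ i : Fin d, ∃ k, (x k : ZMod p)
        = (I.equivFin.symm (Fin.castLE hx.2 i) : ZMod p) := by
      intro i
      obtain ⟨k, -, hk⟩ := mem_image.1 (I.equivFin.symm (Fin.castLE hx.2 i)).2
      exact ⟨k, hk⟩
    choose h hh using hmem
    have hinj : Function.Injective fun i => (x (h i) : ZMod p) := by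
      intro i j hij
      simp only [hh] at hij
      have := I.equivFin.symm.injective (Subtype.ext hij)
      exact Fin.castLE_injective _ this
    have hinj' : Function.Injective h := fun i j hij => hinj (by simp only [hij])
    let ε : {k // k ∈ Set.range (Fin.castAdd s : Fin d → Fin (d + s))} ≃ {k // k ∈ Set.range h} :=
      (Equiv.ofInjective _ (Fin.castAdd_injective d s)).symm.trans (Equiv.ofInjective h hinj')
    have hσ : ∀ i, ε.extendSubtype (Fin.castAdd s i) = h i := by
      intro i
      rw [Equiv.extendSubtype_apply_of_mem ε _ ⟨i, rfl⟩]
      simp only [ε, Equiv.trans_apply]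
      have : (⟨Fin.castAdd s i, ⟨i, rfl⟩⟩ :
          {k // k ∈ Set.range (Fin.castAdd s : Fin d → Fin (d + s))})
        = Equiv.ofInjective _ (Fin.castAdd_injective d s) i := rfl
      rw [this, Equiv.symm_apply_apply]
      rfl
    refine ⟨ε.extendSubtype, mem_univ _, ?_⟩
    rw [mem_filter, hT, mem_filter]
    refine ⟨hx.1, mem_tup.2 fun i => mem_tup.1 hx.1 _, ?_⟩
    simp only [Function.comp_apply, hσ]
    exact hinj
  · have h1 : ∀ σ ∈ (univ : Finset (Equiv.Perm (Fin (d + s)))),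
        energy {x ∈ tup (d + s) A | x ∘ σ ∈ T} (powSum d) ≤ energy T (powSum d) := by
      intro σ _
      refine energy_le_of_injOn _ _ _ _ (fun x => x ∘ σ) ?_ ?_ ?_
      · exact fun x hx => (mem_filter.1 hx).2
      · intro x _ y _ hxy
        exact σ.surjective.injective_comp_right hxy
      · intro x _ y _ hxy
        have : ∀ z : Fin (d + s) → ℤ, powSum d (z ∘ σ) = powSum d z := by
          intro z
          funext j
          exact Equiv.sum_comp σ (fun i => z i ^ (j.val + 1))
        rw [this, this, hxy]
    refine (Nat.mul_le_mul_left _ (sum_le_card_nsmul _ _ _ h1)).trans ?_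
    simp only [card_univ, Fintype.card_perm, Fintype.card_fin, smul_eq_mul]
    rw [← mul_assoc, ← sq]
    gcongr

/-- The basic recursive inequality for the mean value. -/
lemma J_recursion {d s p X : ℕ} (hp : p.Prime) (hpd : d < p) (hX : X ≤ p ^ d) (hs : 1 ≤ s) :
    J d (d + s) (Icc 1 (X : ℤ)) ≤ 2 * (p ^ (2 * d) * (d ^ (2 * (d + s)) *
        ((X / p + 1) ^ (2 * d) * J d s (Icc 1 ((X / p + 1 : ℕ) : ℤ))))
      + ((d + s).factorial) ^ 2 * (p ^ (2 * s) * (J d s (Icc 1 ((X / p + 1 : ℕ) : ℤ))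
        * (d ^ d * p ^ (d * (d - 1) / 2) * X ^ d)))) := by
  classical
  have : NeZero p := ⟨hp.pos.ne'⟩
  refine (energy_le_card_mul_sum (univ : Finset Bool) _
    (fun t => if t then
        {x ∈ tup (d + s) (Icc 1 (X : ℤ)) | #(univ.image fun i => (x i : ZMod p)) < d}
      else {x ∈ tup (d + s) (Icc 1 (X : ℤ)) | d ≤ #(univ.image fun i => (x i : ZMod p))}) _
          ?_).trans ?_
  · intro x hx
    by_cases h : #(univ.image fun i => (x i : ZMod p)) < d
    · exact ⟨true, mem_univ _, by simpa using ⟨hx, h⟩⟩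
    · exact ⟨false, mem_univ _, by simpa using ⟨hx, not_lt.1 h⟩⟩
  · simp only [Fintype.sum_bool, card_univ, Fintype.card_bool, if_true, Bool.false_eq_true,
        if_false]
    gcongr
    · refine (energy_few_classes_le (by omega)).trans ?_
      gcongr
      refine (J_add_le d s d _).trans_eq ?_
      rw [show #(Icc 1 ((X / p + 1 : ℕ) : ℤ)) = X / p + 1 by
        rw [Int.card_Icc, add_sub_cancel_right, Int.toNat_natCast]]
    · exact energy_many_classes_le hp hpd hX hs

/-! ### The mean value theorem -/

lemma J_Icc_le (d s X : ℕ) : J d s (Icc 1 (X : ℤ)) ≤ X ^ (2 * s) := by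
  refine (J_le_card_pow d s _).trans_eq ?_
  rw [Int.card_Icc, add_sub_cancel_right, Int.toNat_natCast]

/-- A prime slightly larger than `X ^ (1 / d)`. -/
lemma exists_prime_root {d X : ℕ} (hd : 3 ≤ d) (hX : d ^ d ≤ X) :
    ∃ p : ℕ, p.Prime ∧ d < p ∧ X ≤ p ^ d ∧ p ≤ X ∧
      (X : ℝ) ^ (1 / d : ℝ) ≤ p ∧ (p : ℝ) ≤ 4 * (X : ℝ) ^ (1 / d : ℝ) := by
  set y : ℝ := (X : ℝ) ^ (1 / d : ℝ) with hy
  have hd0 : (d : ℝ) ≠ 0 := by positivity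
  have hyd : y ^ d = X := by
    rw [hy, ← Real.rpow_natCast, ← Real.rpow_mul (by positivity), one_div_mul_cancel hd0,
      Real.rpow_one]
  have hy0 : 0 ≤ y := by positivity
  have hdy : (d : ℝ) ≤ y := by
    refine le_of_pow_le_pow_left₀ (by omega : d ≠ 0) hy0 ?_
    rw [hyd]
    exact_mod_cast hX
  have hd3 : (3 : ℝ) ≤ d := by exact_mod_cast hd
  obtain ⟨p, hp, h1, h2⟩ := Nat.exists_prime_lt_and_le_two_mul ⌈y⌉₊ (by
    rw [Ne, Nat.ceil_eq_zero]; linarith)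
  have hyp : y < p := (Nat.le_ceil y).trans_lt (by exact_mod_cast h1)
  have hp4 : (p : ℝ) ≤ 4 * y := by
    have h3 : (p : ℝ) ≤ 2 * ⌈y⌉₊ := by exact_mod_cast h2
    have h4 := Nat.ceil_lt_add_one hy0
    linarith
  refine ⟨p, hp, ?_, ?_, ?_, hyp.le, hp4⟩
  · exact_mod_cast hdy.trans_lt hyp
  · have : (X : ℝ) ≤ (p : ℝ) ^ d := by
      rw [← hyd]
      exact pow_le_pow_left₀ hy0 hyp.le d
    exact_mod_cast this
  · have : (p : ℝ) ≤ X := by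
      rw [← hyd]
      have h5 : y ^ 3 ≤ y ^ d := pow_le_pow_right₀ (by linarith) hd
      have h6 : 4 * y ≤ y ^ 3 := by
        have : (4 : ℝ) ≤ y ^ 2 := by nlinarith
        calc 4 * y ≤ y ^ 2 * y := by gcongr
          _ = y ^ 3 := by ring
      linarith
    exact_mod_cast this

lemma J_step {d s : ℕ} (hd : 3 ≤ d) (hs : d ^ 2 ≤ s) {δ D : ℝ} (hδ : 0 ≤ δ) (hD : 0 ≤ D)
    (hδN : δ ≤ d * (d + 1) / 2)
    (h : ∀ X : ℕ, 1 ≤ X →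
      (J d s (Icc 1 (X : ℤ)) : ℝ) ≤ D * (X : ℝ) ^ (2 * s - d * (d + 1) / 2 + δ : ℝ))
    {X : ℕ} (hX : d ^ d ≤ X) :
    (J d (d + s) (Icc 1 (X : ℤ)) : ℝ) ≤
      (4 * ((d + s : ℕ) : ℝ) ^ (2 * (d + s)) * d ^ d * 4 ^ d ^ 2 * 4 ^ s) * D *
        (X : ℝ) ^ (2 * (d + s) - d * (d + 1) / 2 + δ * (1 - 1 / d) : ℝ) := by
  obtain ⟨p, hp, hpd, hXp, hpX, hyp, hp4⟩ := exists_prime_root hd hX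
  have hd3 : (3 : ℝ) ≤ d := by exact_mod_cast hd
  have hs' : (d : ℝ) ^ 2 ≤ s := by exact_mod_cast hs
  have hp0 : (0 : ℝ) < p := by exact_mod_cast hp.pos
  have hX1 : 1 ≤ X := hp.one_lt.le.trans hpX
  have hX0 : (0 : ℝ) < X := by exact_mod_cast hX1
  have hX1' : (1 : ℝ) ≤ X := by exact_mod_cast hX1
  set N : ℝ := d * (d + 1) / 2 with hN
  set E : ℝ := 2 * s - N + δ with hE
  have hNd : N ≤ (d : ℝ) ^ 2 := by rw [hN]; nlinarith
  have hE0 : δ ≤ E := by rw [hE]; nlinarith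
  have hE2 : E ≤ 2 * s := by rw [hE]; linarith
  set X' : ℕ := X / p + 1 with hX'
  have hX'2 : (X' : ℝ) ≤ 2 * (X / p) := by
    have h1 : ((X / p : ℕ) : ℝ) ≤ X / p := Nat.cast_div_le
    have h2 : (1 : ℝ) ≤ X / p := by rw [le_div_iff₀ hp0, one_mul]; exact_mod_cast hpX
    rw [hX']; push_cast; linarith
  have hJ : (J d s (Icc 1 (X' : ℤ)) : ℝ) ≤ D * (4 ^ s * (X / p : ℝ) ^ E) := by
    refine (h X' (Nat.succ_pos _)).trans ?_
    gcongr
    calc (X' : ℝ) ^ E ≤ (2 * (X / p) : ℝ) ^ E := by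
          refine Real.rpow_le_rpow (by positivity) hX'2 (hδ.trans hE0)
      _ = 2 ^ E * (X / p : ℝ) ^ E := by rw [Real.mul_rpow (by norm_num) (by positivity)]
      _ ≤ 4 ^ s * (X / p : ℝ) ^ E := by
          gcongr
          calc (2 : ℝ) ^ E ≤ 2 ^ (2 * s : ℝ) := Real.rpow_le_rpow_of_exponent_le (by norm_num) hE2
            _ = 4 ^ s := by
              rw [show (2 * s : ℝ) = ((2 * s : ℕ) : ℝ) by push_cast; ring, Real.rpow_natCast,
                  pow_mul]
              norm_num
  set Jx : ℝ := (J d s (Icc 1 (X' : ℤ)) : ℝ) with hJx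
  have hJx0 : 0 ≤ Jx := by positivity
  have key : (J d (d + s) (Icc 1 (X : ℤ)) : ℝ) ≤ 2 * ((p : ℝ) ^ (2 * d) *
      ((d : ℝ) ^ (2 * (d + s)) * ((X' : ℝ) ^ (2 * d) * Jx))
      + (((d + s).factorial : ℕ) : ℝ) ^ 2 * ((p : ℝ) ^ (2 * s) * (Jx
        * ((d : ℝ) ^ d * (p : ℝ) ^ (d * (d - 1) / 2) * (X : ℝ) ^ d)))) := by
    have := J_recursion hp hpd hXp (show 1 ≤ s by nlinarith)
    rw [← hX'] at this
    rw [hJx]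
    exact_mod_cast this
  set M : ℝ := ((d + s : ℕ) : ℝ) ^ (2 * (d + s)) with hM
  have hfac : (((d + s).factorial : ℕ) : ℝ) ^ 2 ≤ M := by
    have : (((d + s).factorial : ℕ) : ℝ) ≤ ((d + s : ℕ) : ℝ) ^ (d + s) := by
      exact_mod_cast Nat.factorial_le_pow (d + s)
    calc _ ≤ (((d + s : ℕ) : ℝ) ^ (d + s)) ^ 2 := by gcongr
      _ = M := by rw [hM, ← pow_mul, mul_comm 2]
  have hM1 : (d : ℝ) ^ (2 * (d + s)) ≤ M := by
    rw [hM]; gcongr; omega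
  set T : ℝ := (X : ℝ) ^ (2 * (d + s) - N + δ * (1 - 1 / d) : ℝ) with hT
  have hd1 : (1 : ℝ) ≤ (d : ℝ) ^ d := one_le_pow₀ (by linarith)
  -- the two powers of `X`
  have hA : (X : ℝ) ^ (2 * d) * (X / p : ℝ) ^ E ≤ T := by
    have h1 : (X / p : ℝ) ^ E ≤ ((X : ℝ) ^ (1 - 1 / d : ℝ)) ^ E := by
      refine Real.rpow_le_rpow (by positivity) ?_ (hδ.trans hE0)
      rw [Real.rpow_sub hX0, Real.rpow_one]
      gcongr
    rw [← Real.rpow_mul hX0.le] at h1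
    calc _ ≤ (X : ℝ) ^ (2 * d) * (X : ℝ) ^ ((1 - 1 / d : ℝ) * E) := by gcongr
      _ = (X : ℝ) ^ (2 * d + (1 - 1 / d : ℝ) * E) := by
        rw [Real.rpow_add hX0]
        norm_cast
      _ ≤ T := by
        refine Real.rpow_le_rpow_of_exponent_le hX1' ?_
        have h2 : (1 / d : ℝ) * δ ≤ 1 / d * E := by gcongr
        rw [hE] at h2 ⊢
        linarith
  have hB : (p : ℝ) ^ (2 * s) * (p : ℝ) ^ (d * (d - 1) / 2) * (X : ℝ) ^ d * (X / p : ℝ) ^ E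
      ≤ 4 ^ d ^ 2 * T := by
    have h0 : ((d * (d - 1) / 2 : ℕ) : ℝ) = (d : ℝ) ^ 2 - N := by
      rw [Nat.cast_div (Nat.even_mul_pred_self d).two_dvd (by norm_num)]
      rw [Nat.cast_mul, Nat.cast_sub (by omega), hN]
      push_cast
      ring
    have h1 : (p : ℝ) ^ (2 * s) * (p : ℝ) ^ (d * (d - 1) / 2) * (X : ℝ) ^ d * (X / p : ℝ) ^ E
        = (p : ℝ) ^ ((d : ℝ) ^ 2 - δ) * (X : ℝ) ^ (d + E) := by
      rw [Real.div_rpow hX0.le hp0.le, Real.rpow_add hX0 d E, Real.rpow_natCast,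
        show (d : ℝ) ^ 2 - δ = ((2 * s : ℕ) : ℝ) + ((d * (d - 1) / 2 : ℕ) : ℝ) - E by
          rw [h0, hE]; push_cast; ring, Real.rpow_sub hp0 _ E, Real.rpow_add hp0 ((2 * s : ℕ) : ℝ),
        Real.rpow_natCast, Real.rpow_natCast]
      ring
    have h2 : 0 ≤ (d : ℝ) ^ 2 - δ := by linarith
    rw [h1]
    calc _ ≤ (4 * (X : ℝ) ^ (1 / d : ℝ)) ^ ((d : ℝ) ^ 2 - δ) * (X : ℝ) ^ (d + E) := by gcongr
      _ = 4 ^ ((d : ℝ) ^ 2 - δ) * (X : ℝ) ^ ((1 / d : ℝ) * ((d : ℝ) ^ 2 - δ) + (d + E)) := by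
        rw [Real.mul_rpow (by norm_num) (by positivity), ← Real.rpow_mul hX0.le,
          mul_assoc, ← Real.rpow_add hX0]
      _ = 4 ^ ((d : ℝ) ^ 2 - δ) * T := by
        rw [hT, hE]
        congr 2
        field_simp
        ring
      _ ≤ 4 ^ d ^ 2 * T := by
        gcongr
        rw [← Real.rpow_natCast 4]
        refine Real.rpow_le_rpow_of_exponent_le (by norm_num) ?_
        push_cast
        linarith
  have hT0 : 0 ≤ T := by positivity
  have hpX' : (p : ℝ) ^ (2 * d) * (X' : ℝ) ^ (2 * d) ≤ 4 ^ d ^ 2 * (X : ℝ) ^ (2 * d) := by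
    calc _ = (p * X' : ℝ) ^ (2 * d) := by rw [mul_pow]
      _ ≤ (p * (2 * (X / p)) : ℝ) ^ (2 * d) := by gcongr
      _ = 4 ^ d * (X : ℝ) ^ (2 * d) := by
        rw [show (p * (2 * (X / p)) : ℝ) = 2 * X by field_simp, mul_pow, pow_mul 2]
        norm_num
      _ ≤ _ := by
        refine mul_le_mul_of_nonneg_right (pow_le_pow_right₀ (by norm_num : (1 : ℝ) ≤ 4) ?_)
          (by positivity)
        exact Nat.le_self_pow two_ne_zero d
  have t1 : (p : ℝ) ^ (2 * d) * ((d : ℝ) ^ (2 * (d + s)) * ((X' : ℝ) ^ (2 * d) * Jx))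
      ≤ M * d ^ d * 4 ^ d ^ 2 * 4 ^ s * D * T := by
    calc _ = ((p : ℝ) ^ (2 * d) * (X' : ℝ) ^ (2 * d)) * (d : ℝ) ^ (2 * (d + s)) * 1 * Jx := by ring
      _ ≤ (4 ^ d ^ 2 * (X : ℝ) ^ (2 * d)) * M * d ^ d * (D * (4 ^ s * (X / p : ℝ) ^ E)) := by gcongr
      _ = M * d ^ d * 4 ^ d ^ 2 * 4 ^ s * D * ((X : ℝ) ^ (2 * d) * (X / p : ℝ) ^ E) := by ring
      _ ≤ _ := by gcongr
  have t2 : (((d + s).factorial : ℕ) : ℝ) ^ 2 * ((p : ℝ) ^ (2 * s) * (Jx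
        * ((d : ℝ) ^ d * (p : ℝ) ^ (d * (d - 1) / 2) * (X : ℝ) ^ d)))
      ≤ M * d ^ d * 4 ^ d ^ 2 * 4 ^ s * D * T := by
    calc _ ≤ M * ((p : ℝ) ^ (2 * s) * ((D * (4 ^ s * (X / p : ℝ) ^ E))
        * ((d : ℝ) ^ d * (p : ℝ) ^ (d * (d - 1) / 2) * (X : ℝ) ^ d))) := by gcongr
      _ = M * d ^ d * 4 ^ s * D * ((p : ℝ) ^ (2 * s) * (p : ℝ) ^ (d * (d - 1) / 2) * (X : ℝ) ^ d *
          (X / p : ℝ) ^ E) := by ring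
      _ ≤ M * d ^ d * 4 ^ s * D * (4 ^ d ^ 2 * T) := by gcongr
      _ = _ := by ring
  refine key.trans ((mul_le_mul_of_nonneg_left (add_le_add t1 t2) (by norm_num)).trans_eq ?_)
  ring

lemma J_iterate {d S : ℕ} (hd : 3 ≤ d) (r : ℕ) (hS : d ^ 2 + r * d ≤ S) {X : ℕ} (hX : 1 ≤ X) :
    (J d (d ^ 2 + r * d) (Icc 1 (X : ℤ)) : ℝ) ≤
      (4 * (S : ℝ) ^ (2 * S) * d ^ d * 4 ^ d ^ 2 * 4 ^ S) ^ r * (d : ℝ) ^ d ^ 3 *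
        (X : ℝ) ^ (2 * ((d ^ 2 + r * d : ℕ) : ℝ) - d * (d + 1) / 2
          + d * (d + 1) / 2 * (1 - 1 / d) ^ r : ℝ) := by
  have hd3 : (3 : ℝ) ≤ d := by exact_mod_cast hd
  set c : ℝ := 4 * (S : ℝ) ^ (2 * S) * d ^ d * 4 ^ d ^ 2 * 4 ^ S with hc
  have hS1 : (1 : ℝ) ≤ S := by
    have : 1 ≤ S := by nlinarith
    exact_mod_cast this
  have hc1 : 1 ≤ c := by
    rw [hc]
    have h1 : (1 : ℝ) ≤ (S : ℝ) ^ (2 * S) := one_le_pow₀ hS1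
    have h2 : (1 : ℝ) ≤ (d : ℝ) ^ d := one_le_pow₀ (by linarith)
    have h3 : (1 : ℝ) ≤ 4 ^ d ^ 2 := one_le_pow₀ (by norm_num)
    have h4 : (1 : ℝ) ≤ 4 ^ S := one_le_pow₀ (by norm_num)
    calc (1 : ℝ) ≤ 4 * 1 * 1 * 1 * 1 := by norm_num
      _ ≤ _ := by gcongr
  set N : ℝ := d * (d + 1) / 2 with hN
  have hN0 : 0 ≤ N := by positivity
  have hNd : N ≤ (d : ℝ) ^ 2 := by rw [hN]; nlinarith
  have hq0 : (0 : ℝ) ≤ 1 - 1 / d := by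
    rw [sub_nonneg, div_le_one (by positivity)]; linarith
  have hq1 : (1 - 1 / d : ℝ) ≤ 1 := by
    have : (0 : ℝ) ≤ 1 / d := by positivity
    linarith
  have hdd : (1 : ℝ) ≤ (d : ℝ) ^ d ^ 3 := one_le_pow₀ (by linarith)
  induction r generalizing X with
  | zero =>
    have h1 : (J d (d ^ 2 + 0 * d) (Icc 1 (X : ℤ)) : ℝ) ≤ (X : ℝ) ^ (2 * (d ^ 2 + 0 * d)) := by
      exact_mod_cast J_Icc_le d (d ^ 2 + 0 * d) X
    refine h1.trans ?_
    rw [pow_zero, one_mul, pow_zero, mul_one, sub_add_cancel, ← Real.rpow_natCast]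
    push_cast
    exact le_mul_of_one_le_left (by positivity) hdd
  | succ r ih =>
    set s := d ^ 2 + r * d with hs
    have hsr : d ^ 2 + (r + 1) * d = d + s := by rw [hs]; ring
    have hsS : d + s ≤ S := hsr ▸ hS
    rw [hsr]
    set δ : ℝ := N * (1 - 1 / d) ^ r with hδ
    have hpr1 : (1 - 1 / d : ℝ) ^ r ≤ 1 := pow_le_one₀ hq0 hq1
    have hδ0 : 0 ≤ δ := by positivity
    have hδN : δ ≤ N := mul_le_of_le_one_right hN0 hpr1
    have hδ' : N * (1 - 1 / d) ^ (r + 1) = δ * (1 - 1 / d) := by rw [hδ, pow_succ]; ring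
    rw [hδ']
    by_cases hXd : d ^ d ≤ X
    · refine (J_step hd (by rw [hs]; omega) hδ0 (D := c ^ r * (d : ℝ) ^ d ^ 3) (by positivity) hδN
        (fun X hX => ih (by omega) hX) hXd).trans ?_
      rw [pow_succ c, mul_comm (c ^ r) c, mul_assoc c (c ^ r)]
      push_cast
      gcongr
      rw [hc]
      have h5 : (d + s : ℝ) ≤ S := by exact_mod_cast hsS
      have h6 : s ≤ S := by omega
      have h7 : (d + s : ℝ) ^ (2 * (d + s)) ≤ (S : ℝ) ^ (2 * S) := by
        calc _ ≤ (S : ℝ) ^ (2 * (d + s)) := by gcongr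
          _ ≤ _ := pow_le_pow_right₀ hS1 (by omega)
      gcongr
      norm_num
    · push Not at hXd
      have h1 : (J d (d + s) (Icc 1 (X : ℤ)) : ℝ) ≤ (X : ℝ) ^ (2 * (d + s)) := by
        exact_mod_cast J_Icc_le d (d + s) X
      refine h1.trans ?_
      have hX1 : (1 : ℝ) ≤ X := by exact_mod_cast hX
      have hX0 : (0 : ℝ) < X := by linarith
      set E : ℝ := 2 * ((d + s : ℕ) : ℝ) - N + δ * (1 - 1 / d) with hE
      have h2 : (X : ℝ) ^ (2 * (d + s)) ≤ (d : ℝ) ^ d ^ 3 * (X : ℝ) ^ E := by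
        calc (X : ℝ) ^ (2 * (d + s)) = (X : ℝ) ^ (N - δ * (1 - 1 / d)) * (X : ℝ) ^ E := by
              rw [← Real.rpow_add hX0, hE, ← Real.rpow_natCast]
              congr 1
              push_cast
              ring
          _ ≤ (X : ℝ) ^ (((d ^ 2 : ℕ) : ℝ)) * (X : ℝ) ^ E := by
              gcongr
              have : 0 ≤ δ * (1 - 1 / d : ℝ) := by positivity
              push_cast
              linarith
          _ ≤ (d : ℝ) ^ d ^ 3 * (X : ℝ) ^ E := by
              gcongr
              rw [Real.rpow_natCast]
              have : (X : ℝ) ≤ (d : ℝ) ^ d := by exact_mod_cast hXd.le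
              calc (X : ℝ) ^ d ^ 2 ≤ ((d : ℝ) ^ d) ^ d ^ 2 := by gcongr
                _ = _ := by rw [← pow_mul]; congr 1; ring
      refine h2.trans ?_
      rw [mul_assoc]
      exact le_mul_of_one_le_left (by positivity) (one_le_pow₀ hc1)

lemma natCast_le_exp (n : ℕ) : (n : ℝ) ≤ Real.exp n := by
  linarith [Real.add_one_le_exp (n : ℝ)]

/-- Vinogradov's mean value theorem with an explicit dependence on the degree. -/
theorem mean_value (R : ℕ) : ∃ C : ℝ, 0 < C ∧ ∀ d X : ℕ, 3 ≤ d → 1 ≤ X →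
    (J d ((R + 1) * d ^ 2) (Icc 1 (X : ℤ)) : ℝ) ≤ Real.exp (C * d ^ 4) *
      (X : ℝ) ^ (2 * (((R + 1) * d ^ 2 : ℕ) : ℝ) - d * (d + 1) / 2 + d ^ 2 * Real.exp (-R) :
          ℝ) := by
  refine ⟨R * (4 + 2 * (R + 1) * (R + 1 + 2) + 1 + 4 + 4 * (R + 1)) + 1, by positivity,
    fun d X hd hX => ?_⟩
  have hd3 : (3 : ℝ) ≤ d := by exact_mod_cast hd
  set S := (R + 1) * d ^ 2 with hS
  have hSr : d ^ 2 + (R * d) * d = S := by rw [hS]; ring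
  have h := J_iterate hd (R * d) (S := S) hSr.le hX
  rw [hSr] at h
  refine h.trans ?_
  have hX1 : (1 : ℝ) ≤ X := by exact_mod_cast hX
  have hNd : (d : ℝ) * (d + 1) / 2 ≤ (d : ℝ) ^ 2 := by nlinarith
  have h1d : (1 : ℝ) / d ≤ 1 := by rw [div_le_one (by positivity)]; linarith
  have hS1 : (1 : ℝ) ≤ S := by
    have : 1 ≤ S := by rw [hS]; nlinarith
    exact_mod_cast this
  have hde : (d : ℝ) ≤ Real.exp d := natCast_le_exp d
  have hSe : (S : ℝ) ≤ Real.exp ((R + 1 + 2) * d) := by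
    calc (S : ℝ) = ((R + 1 : ℕ) : ℝ) * ((d : ℝ) * d) := by rw [hS]; push_cast; ring
      _ ≤ Real.exp ((R + 1 : ℕ) : ℝ) * (Real.exp d * Real.exp d) := by
          gcongr
          exact natCast_le_exp _
      _ = Real.exp ((R + 1) + (d + d)) := by
          rw [Real.exp_add (_ + _), Real.exp_add d]
          push_cast
          rfl
      _ ≤ _ := by
          rw [Real.exp_le_exp]
          nlinarith [(Nat.cast_nonneg R : (0 : ℝ) ≤ R)]
  have h4 : (4 : ℝ) ≤ Real.exp 4 := by linarith [Real.add_one_le_exp (4 : ℝ)]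
  have hR0 : (0 : ℝ) ≤ R := Nat.cast_nonneg R
  have hp2 : (d : ℝ) ^ 2 ≤ d ^ 3 := pow_le_pow_right₀ (by linarith) (by norm_num)
  have hp3 : (1 : ℝ) ≤ d ^ 3 := one_le_pow₀ (by linarith)
  have hp4 : (d : ℝ) ^ 3 * d = d ^ 4 := by ring
  have hc : 4 * (S : ℝ) ^ (2 * S) * d ^ d * 4 ^ d ^ 2 * 4 ^ S
      ≤ Real.exp ((4 + 2 * (R + 1) * (R + 1 + 2) + 1 + 4 + 4 * (R + 1)) * d ^ 3) := by
    calc _ ≤ Real.exp 4 * Real.exp ((R + 1 + 2) * d) ^ (2 * S) * Real.exp d ^ d *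
          Real.exp 4 ^ d ^ 2 * Real.exp 4 ^ S := by gcongr
      _ = Real.exp (4 + (2 * S : ℕ) * ((R + 1 + 2) * d) + d * d + (d ^ 2 : ℕ) * 4 + S * 4) := by
          simp only [← Real.exp_nat_mul, Real.exp_add]
      _ ≤ _ := by
          rw [Real.exp_le_exp, hS]
          push_cast
          have e1 : (2 : ℝ) * ((R + 1) * d ^ 2) * ((R + 1 + 2) * d)
            = 2 * (R + 1) * (R + 1 + 2) * d ^ 3 := by ring
          have e2 : (R + 1 : ℝ) * d ^ 2 * 4 ≤ 4 * (R + 1) * d ^ 3 := by nlinarith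
          rw [e1]
          nlinarith
  have hdd : (d : ℝ) ^ d ^ 3 ≤ Real.exp (d ^ 4) := by
    calc _ ≤ Real.exp d ^ d ^ 3 := by gcongr
      _ = _ := by rw [← Real.exp_nat_mul]; push_cast; ring_nf
  have hexp : (d : ℝ) * (d + 1) / 2 * (1 - 1 / d) ^ (R * d) ≤ d ^ 2 * Real.exp (-R) := by
    have h5 : (1 - 1 / d : ℝ) ≤ Real.exp (-(1 / d)) := by
      linarith [Real.add_one_le_exp (-(1 / d) : ℝ)]
    calc _ ≤ (d : ℝ) ^ 2 * Real.exp (-(1 / d)) ^ (R * d) := by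
          gcongr
      _ = _ := by
          rw [← Real.exp_nat_mul]
          congr 2
          push_cast
          field_simp
  calc _ ≤ Real.exp ((4 + 2 * (R + 1) * (R + 1 + 2) + 1 + 4 + 4 * (R + 1)) * d ^ 3) ^ (R * d) *
        Real.exp (d ^ 4) * (X : ℝ) ^ (2 * (S : ℝ) - d * (d + 1) / 2 + d ^ 2 * Real.exp (-R) :
            ℝ) := by
        gcongr
    _ = _ := by
        rw [← Real.exp_nat_mul, ← Real.exp_add]
        congr 2
        push_cast
        ring

/-! ### Bilinear sums with polynomial phase -/

/-- The exponential sum over `A` of the polynomial with coefficients `β` and no constant term. -/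
noncomputable def curveSum {d : ℕ} (A : Finset ℤ) (β : Fin d → ℝ) : ℂ :=
  ∑ a ∈ A, e (∑ j, β j * (a : ℝ) ^ (j.val + 1))

lemma curveSum_pow {d : ℕ} (A : Finset ℤ) (β : Fin d → ℝ) (s : ℕ) :
    curveSum A β ^ s = ∑ x ∈ tup s A, e (∑ j, β j * (powSum d x j : ℝ)) := by
  have h : ∀ x : Fin s → ℤ, e (∑ j, β j * (powSum d x j : ℝ))
      = ∏ i, e (∑ j, β j * (x i : ℝ) ^ (j.val + 1)) := by
    intro x
    rw [← e_sum, sum_comm]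
    congr 1
    refine sum_congr rfl fun j _ => ?_
    rw [← mul_sum, powSum]
    push_cast
    rfl
  simp_rw [h]
  rw [tup, ← prod_univ_sum (fun _ => A) (fun _ a => e (∑ j, β j * (a : ℝ) ^ (j.val + 1)))]
  simp [curveSum]

lemma norm_curveSum_pow {d : ℕ} (A : Finset ℤ) (β : Fin d → ℝ) (s : ℕ) :
    ((‖curveSum A β‖ ^ (2 * s) : ℝ) : ℂ) = ∑ z ∈ tup s A ×ˢ tup s A,
      e (∑ j, β j * ((powSum d z.1 - powSum d z.2) j : ℝ)) := by
  have h1 : ((‖curveSum A β‖ ^ (2 * s) : ℝ) : ℂ)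
      = curveSum A β ^ s * (starRingEnd ℂ) (curveSum A β ^ s) := by
    rw [Complex.mul_conj', norm_pow]
    push_cast
    ring
  rw [h1, curveSum_pow, map_sum, sum_mul_sum, sum_product]
  refine sum_congr rfl fun x _ => sum_congr rfl fun y _ => ?_
  rw [← e_sub, ← sum_sub_distrib]
  congr 1
  refine sum_congr rfl fun j _ => ?_
  simp only [Pi.sub_apply]
  push_cast
  ring

lemma sum_pairs_le {α G : Type*} [AddCommGroup G] (A : Finset α) (φ : α → G) (L : Finset G)
    (hL : ∀ a ∈ A, ∀ b ∈ A, φ a - φ b ∈ L) (f : G → ℝ) (hf : ∀ m, 0 ≤ f m) :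
    ∑ z ∈ A ×ˢ A, f (φ z.1 - φ z.2) ≤ energy A φ * ∑ m ∈ L, f m := by
  classical
  rw [← sum_fiberwise_of_maps_to (t := L) (g := fun z : α × α => φ z.1 - φ z.2)
    (fun z hz => hL _ (mem_product.1 hz).1 _ (mem_product.1 hz).2), mul_sum]
  refine sum_le_sum fun m _ => ?_
  rw [sum_congr rfl (g := fun _ => f m) fun z hz => by rw [(mem_filter.1 hz).2], sum_const,
    nsmul_eq_mul]
  refine mul_le_mul_of_nonneg_right ?_ (hf m)
  have h := card_shift_le_energy A φ m
  have h2 : #{z ∈ A ×ˢ A | φ z.1 - φ z.2 = m} = #{z ∈ A ×ˢ A | φ z.1 = φ z.2 + m} := by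
    congr 1
    refine filter_congr fun z _ => ?_
    rw [sub_eq_iff_eq_add']
  rw [h2]
  have h3 : #{z ∈ A ×ˢ A | φ z.1 = φ z.2 + m} ≤ energy A φ := by
    convert h
  exact_mod_cast h3

/-- The values taken by differences of power sums. -/
noncomputable def box (d s Y : ℕ) : Finset (Fin d → ℤ) :=
  Fintype.piFinset fun j => Icc (-((s * Y ^ (j.val + 1) : ℕ) : ℤ)) ((s * Y ^ (j.val + 1) : ℕ) : ℤ)

lemma powSum_sub_mem_box {d s Y : ℕ} {x y : Fin s → ℤ} (hx : x ∈ tup s (Icc 1 (Y : ℤ)))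
    (hy : y ∈ tup s (Icc 1 (Y : ℤ))) : powSum d x - powSum d y ∈ box d s Y := by
  have h : ∀ x : Fin s → ℤ, x ∈ tup s (Icc 1 (Y : ℤ)) → ∀ j : Fin d,
      0 ≤ powSum d x j ∧ powSum d x j ≤ ((s * Y ^ (j.val + 1) : ℕ) : ℤ) := by
    intro x hx j
    have hx' := fun i => mem_Icc.1 (mem_tup.1 hx i)
    refine ⟨sum_nonneg fun i _ => pow_nonneg (by linarith [(hx' i).1]) _, ?_⟩
    refine (sum_le_card_nsmul _ _ ((Y : ℤ) ^ (j.val + 1)) fun i _ =>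
      pow_le_pow_left₀ (by linarith [(hx' i).1]) (hx' i).2 _).trans ?_
    simp
  rw [box, Fintype.mem_piFinset]
  intro j
  have h1 := h x hx j
  have h2 := h y hy j
  rw [mem_Icc, Pi.sub_apply]
  constructor <;> linarith

/-- A bilinear geometric sum. -/
noncomputable def bilin (M : ℕ) (α : ℝ) : ℝ :=
  ∑ l ∈ Icc (-(M : ℤ)) M, ‖∑ m ∈ Icc (-(M : ℤ)) M, e (α * m * l)‖

lemma sum_box_le {d s Y : ℕ} (α : Fin d → ℝ) :
    ∑ m ∈ box d s Y, ‖curveSum (Icc 1 (Y : ℤ)) (fun j => α j * m j)‖ ^ (2 * s)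
      ≤ J d s (Icc 1 (Y : ℤ)) * ∏ j : Fin d, bilin (s * Y ^ (j.val + 1)) (α j) := by
  set A := Icc 1 (Y : ℤ) with hA
  have h1 : ((∑ m ∈ box d s Y, ‖curveSum A (fun j => α j * m j)‖ ^ (2 * s) : ℝ) : ℂ)
      = ∑ z ∈ tup s A ×ˢ tup s A, ∑ m ∈ box d s Y,
        e (∑ j, α j * m j * ((powSum d z.1 - powSum d z.2) j : ℝ)) := by
    rw [Complex.ofReal_sum, sum_comm]
    exact sum_congr rfl fun m _ => norm_curveSum_pow A _ s
  have h0 : 0 ≤ ∑ m ∈ box d s Y, ‖curveSum A (fun j => α j * m j)‖ ^ (2 * s) :=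
    sum_nonneg fun _ _ => by positivity
  rw [← Complex.norm_of_nonneg h0, h1]
  refine (norm_sum_le _ _).trans ?_
  refine (sum_pairs_le (tup s A) (powSum d) (box d s Y) (fun a ha b hb => powSum_sub_mem_box ha hb)
    (fun l => ‖∑ m ∈ box d s Y, e (∑ j, α j * m j * (l j : ℝ))‖) fun _ => norm_nonneg _).trans_eq ?_
  rw [J]
  congr 1
  have h2 : ∀ l : Fin d → ℤ, ‖∑ m ∈ box d s Y, e (∑ j, α j * m j * (l j : ℝ))‖
      = ∏ j : Fin d, ‖∑ m ∈ Icc (-((s * Y ^ (j.val + 1) : ℕ) : ℤ)) ((s * Y ^ (j.val + 1) : ℕ) : ℤ),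
        e (α j * m * l j)‖ := by
    intro l
    simp_rw [e_sum]
    rw [← norm_prod, box, ← prod_univ_sum _ (fun j (m : ℤ) => e (α j * m * l j))]
  simp_rw [h2]
  rw [box, ← prod_univ_sum _ (fun (j : Fin d) (l : ℤ) =>
    ‖∑ m ∈ Icc (-((s * Y ^ (j.val + 1) : ℕ) : ℤ)) ((s * Y ^ (j.val + 1) : ℕ) : ℤ),
        e (α j * m * l)‖)]
  rfl

/-- The double exponential sum attached to a polynomial in `u v`. -/
noncomputable def doubleSum {d : ℕ} (Y : ℕ) (α : Fin d → ℝ) : ℂ :=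
  ∑ v ∈ Icc 1 (Y : ℤ), ∑ u ∈ Icc 1 (Y : ℤ), e (∑ j, α j * ((u : ℝ) * v) ^ (j.val + 1))

lemma norm_doubleSum_pow_le {d s Y : ℕ} (hs : 1 ≤ s) (α : Fin d → ℝ) :
    ‖doubleSum Y α‖ ^ (2 * s * (2 * s)) ≤ (Y : ℝ) ^ ((2 * s - 1) * (2 * s)) *
      ((Y : ℝ) ^ (2 * s * (2 * s - 1)) * ((J d s (Icc 1 (Y : ℤ)) : ℝ) ^ 2 *
        ∏ j : Fin d, bilin (s * Y ^ (j.val + 1)) (α j))) := by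
  set A := Icc 1 (Y : ℤ) with hA
  have hcA : #A = Y := by rw [Int.card_Icc, add_sub_cancel_right, Int.toNat_natCast]
  obtain ⟨k, hk⟩ : ∃ k, 2 * s = k + 1 := ⟨2 * s - 1, by omega⟩
  set H : (Fin d → ℤ) → ℝ := fun m => ‖curveSum A (fun j => α j * m j)‖ with hH
  set T := ∑ v ∈ A, ‖curveSum A (fun j => α j * (v : ℝ) ^ (j.val + 1))‖ ^ (2 * s) with hT
  have h1 : ‖doubleSum Y α‖ ^ (2 * s) ≤ (Y : ℝ) ^ (2 * s - 1) * T := by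
    have h2 : doubleSum Y α = ∑ v ∈ A, curveSum A (fun j => α j * (v : ℝ) ^ (j.val + 1)) := by
      rw [doubleSum]
      refine sum_congr rfl fun v _ => sum_congr rfl fun u _ => ?_
      congr 1
      refine sum_congr rfl fun j _ => ?_
      ring
    rw [h2, hT, hk, Nat.add_sub_cancel]
    exact norm_sum_pow_le A _ Y k hcA.le
  have hT0 : 0 ≤ T := sum_nonneg fun _ _ => by positivity
  have h3 : T ≤ ∑ z ∈ tup s A ×ˢ tup s A, H (powSum d z.1 - powSum d z.2) := by
    have h4 : (T : ℂ) = ∑ z ∈ tup s A ×ˢ tup s A,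
        curveSum A (fun j => α j * ((powSum d z.1 - powSum d z.2) j : ℤ)) := by
      rw [hT, Complex.ofReal_sum]
      simp_rw [norm_curveSum_pow A _ s]
      rw [sum_comm]
      refine sum_congr rfl fun z _ => sum_congr rfl fun v _ => ?_
      congr 1
      refine sum_congr rfl fun j _ => ?_
      ring
    rw [← Complex.norm_of_nonneg hT0, h4]
    exact norm_sum_le _ _
  have h5 : T ^ (2 * s) ≤ (Y : ℝ) ^ (2 * s * (2 * s - 1)) * ((J d s A : ℝ) ^ 2 *
        ∏ j : Fin d, bilin (s * Y ^ (j.val + 1)) (α j)) := by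
    calc T ^ (2 * s) ≤ (∑ z ∈ tup s A ×ˢ tup s A, H (powSum d z.1 - powSum d z.2)) ^ (2 * s) :=
          pow_le_pow_left₀ hT0 h3 _
      _ ≤ ((#(tup s A ×ˢ tup s A) : ℕ) : ℝ) ^ (2 * s - 1) *
          ∑ z ∈ tup s A ×ˢ tup s A, H (powSum d z.1 - powSum d z.2) ^ (2 * s) := by
          rw [hk, Nat.add_sub_cancel]
          exact pow_sum_le_card_mul_sum_pow (fun z _ => norm_nonneg _) k
      _ ≤ ((#(tup s A ×ˢ tup s A) : ℕ) : ℝ) ^ (2 * s - 1) *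
          (J d s A * ∑ m ∈ box d s Y, H m ^ (2 * s)) := by
          gcongr
          exact sum_pairs_le (tup s A) (powSum d) (box d s Y)
            (fun a ha b hb => powSum_sub_mem_box ha hb) (fun m => H m ^ (2 * s))
            fun m => by positivity
      _ ≤ ((#(tup s A ×ˢ tup s A) : ℕ) : ℝ) ^ (2 * s - 1) *
          (J d s A * (J d s A * ∏ j : Fin d, bilin (s * Y ^ (j.val + 1)) (α j))) := by
          gcongr
          exact sum_box_le α
      _ = _ := by
          rw [card_product, card_tup, hcA]
          push_cast
          rw [← pow_add, ← two_mul, ← pow_mul]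
          ring
  calc ‖doubleSum Y α‖ ^ (2 * s * (2 * s)) = (‖doubleSum Y α‖ ^ (2 * s)) ^ (2 * s) := by
        rw [← pow_mul]
    _ ≤ ((Y : ℝ) ^ (2 * s - 1) * T) ^ (2 * s) := by gcongr
    _ = (Y : ℝ) ^ ((2 * s - 1) * (2 * s)) * T ^ (2 * s) := by rw [mul_pow, ← pow_mul]
    _ ≤ _ := by gcongr

/-! ### Sums of truncated reciprocals -/

lemma four_mul_le_norm_one_sub_e (θ : ℝ) : 4 * |θ - round θ| ≤ ‖1 - e θ‖ := by
  set x := θ - round θ with hx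
  have hx2 : |x| ≤ 1 / 2 := abs_sub_round θ
  have h1 : e θ = e x := by
    rw [hx, sub_eq_add_neg, e_add]
    have : e (-(round θ : ℝ)) = 1 := by
      have := e_int (-round θ)
      push_cast at this
      exact this
    rw [this, mul_one]
  have h2 : e x = Complex.exp (Complex.I * ((2 * Real.pi * x : ℝ) : ℂ)) := by
    rw [e]; congr 1; push_cast; ring
  rw [h1, norm_sub_rev, h2, Complex.norm_exp_I_mul_ofReal_sub_one, norm_mul, Real.norm_eq_abs,
    Real.norm_eq_abs, abs_two]
  have h3 : |Real.sin (2 * Real.pi * x / 2)| = Real.sin (Real.pi * |x|) := by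
    rw [show 2 * Real.pi * x / 2 = Real.pi * x by ring]
    have h4 : 0 ≤ Real.sin (Real.pi * |x|) := by
      refine Real.sin_nonneg_of_nonneg_of_le_pi (by positivity) ?_
      nlinarith [Real.pi_pos]
    rcases abs_cases x with ⟨h, _⟩ | ⟨h, _⟩
    · rw [h] at h4 ⊢
      exact abs_of_nonneg h4
    · rw [h] at h4 ⊢
      rw [mul_neg, Real.sin_neg] at h4 ⊢
      rw [abs_of_nonpos (by linarith)]
  have h5 := Real.mul_le_sin (x := Real.pi * |x|) (by positivity) (by nlinarith [Real.pi_pos])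
  rw [h3]
  have h6 : 2 / Real.pi * (Real.pi * |x|) = 2 * |x| := by
    field_simp
  linarith

lemma sum_Icc_neg_eq {β : Type*} [AddCommMonoid β] (M : ℕ) (f : ℤ → β) :
    ∑ m ∈ Icc (-(M : ℤ)) M, f m = ∑ i ∈ range (2 * M + 1), f (i - M) := by
  refine (sum_nbij (fun i : ℕ => (i : ℤ) - M) ?_ ?_ ?_ fun _ _ => rfl).symm
  · intro i hi
    rw [mem_range] at hi
    rw [mem_Icc]
    constructor <;> omega
  · intro i _ j _ h
    simp only at h
    omega
  · intro m hm
    rw [mem_coe, mem_Icc] at hm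
    refine ⟨(m + M).toNat, ?_, ?_⟩
    · rw [mem_coe, mem_range]; omega
    · simp only; omega

lemma norm_sum_e_le {M : ℕ} {θ η : ℝ} (hη : 0 < η) (h : η ≤ |θ - round θ|) :
    ‖∑ m ∈ Icc (-(M : ℤ)) M, e (θ * m)‖ ≤ 1 / (2 * η) := by
  have h1 : ∑ m ∈ Icc (-(M : ℤ)) M, e (θ * m)
      = e (-(θ * M)) * ∑ i ∈ range (2 * M + 1), e θ ^ i := by
    rw [sum_Icc_neg_eq, mul_sum]
    refine sum_congr rfl fun i _ => ?_
    rw [← e_nat_mul, ← e_add]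
    congr 1
    push_cast
    ring
  have h2 := mul_neg_geom_sum (e θ) (2 * M + 1)
  have h3 : ‖1 - e θ‖ * ‖∑ i ∈ range (2 * M + 1), e θ ^ i‖ ≤ 2 := by
    rw [← norm_mul, h2]
    refine (norm_sub_le _ _).trans ?_
    rw [norm_pow, norm_e, norm_one, one_pow]
    norm_num
  have h4 := four_mul_le_norm_one_sub_e θ
  rw [h1, norm_mul, norm_e, one_mul, le_div_iff₀ (by positivity)]
  nlinarith [norm_nonneg (∑ i ∈ range (2 * M + 1), e θ ^ i)]

lemma card_int_le {T : Finset ℤ} {D : ℝ} (h : ∀ a ∈ T, ∀ b ∈ T, (a : ℝ) - b ≤ D) :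
    #T ≤ ⌊D⌋₊ + 1 := by
  rcases T.eq_empty_or_nonempty with rfl | hT
  · simp
  have h1 : T ⊆ Icc (T.min' hT) (T.max' hT) := fun a ha =>
    mem_Icc.2 ⟨T.min'_le a ha, T.le_max' a ha⟩
  refine (card_le_card h1).trans ?_
  rw [Int.card_Icc]
  have h2 := h _ (T.max'_mem hT) _ (T.min'_mem hT)
  have h3 : (T.max' hT - T.min' hT).toNat ≤ ⌊D⌋₊ := by
    refine Nat.le_floor ?_
    have h4 : T.min' hT ≤ T.max' hT := T.min'_le_max' hT
    have h5 : (((T.max' hT - T.min' hT).toNat : ℕ) : ℝ) = (T.max' hT : ℝ) - T.min' hT := by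
      have : (((T.max' hT - T.min' hT).toNat : ℕ) : ℤ) = T.max' hT - T.min' hT :=
        Int.toNat_of_nonneg (by omega)
      exact_mod_cast this
    rw [h5]
    exact h2
  omega

lemma card_near_integer_le (M : ℕ) {α η : ℝ} (hα : α ≠ 0) (hη : 0 < η) :
    ((#((Icc (-(M : ℤ)) M).filter fun l : ℤ => |α * l - round (α * l)| < η) : ℕ) : ℝ)
      ≤ (2 * |α| * M + 3) * (2 * η / |α| + 1) := by
  have hα0 : 0 < |α| := abs_pos.2 hα
  set B : ℤ := ⌊|α| * M + 1 / 2⌋ with hB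
  have hB0 : 0 ≤ B := Int.floor_nonneg.2 (by positivity)
  have h1 := card_le_mul_card_image_of_maps_to
    (f := fun l : ℤ => round (α * l))
    (s := ((Icc (-(M : ℤ)) M).filter fun l : ℤ => |α * l - round (α * l)| < η))
    (t := Icc (-B) B) ?_ (⌊2 * η / |α|⌋₊ + 1) ?_
  · have h2 : ((#(Icc (-B) B) : ℕ) : ℝ) ≤ 2 * |α| * M + 3 := by
      rw [Int.card_Icc]
      have h3 : (((B + 1 - -B).toNat : ℕ) : ℝ) = 2 * B + 1 := by
        have : (((B + 1 - -B).toNat : ℕ) : ℤ) = B + 1 - -B := Int.toNat_of_nonneg (by omega)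
        have h4 : (((B + 1 - -B).toNat : ℕ) : ℝ) = ((B + 1 - -B : ℤ) : ℝ) := by exact_mod_cast this
        rw [h4]; push_cast; ring
      rw [h3]
      have := Int.floor_le (|α| * M + 1 / 2)
      rw [← hB] at this
      linarith
    calc ((#((Icc (-(M : ℤ)) M).filter fun l : ℤ => |α * l - round (α * l)| < η) : ℕ) : ℝ)
        ≤ (((⌊2 * η / |α|⌋₊ + 1) * #(Icc (-B) B) : ℕ) : ℝ) := by exact_mod_cast h1
      _ = ((#(Icc (-B) B) : ℕ) : ℝ) * ((⌊2 * η / |α|⌋₊ : ℝ) + 1) := by push_cast; ring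
      _ ≤ _ := by
        gcongr
        exact Nat.floor_le (by positivity)
  · intro l hl
    rw [mem_filter, mem_Icc] at hl
    have h2 : |α * l| ≤ |α| * M := by
      rw [abs_mul]
      gcongr
      rw [abs_le]
      exact ⟨by exact_mod_cast hl.1.1, by exact_mod_cast hl.1.2⟩
    have h3 := abs_sub_round (α * l)
    have h4 : |(round (α * l) : ℝ)| ≤ |α| * M + 1 / 2 := by
      have := abs_sub_abs_le_abs_sub (round (α * l) : ℝ) (α * l)
      rw [abs_sub_comm] at this
      linarith
    rw [abs_le] at h4
    rw [mem_Icc]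
    constructor
    · have : -round (α * l) ≤ B := Int.le_floor.2 (by push_cast; linarith)
      linarith
    · exact Int.le_floor.2 h4.2
  · intro n _
    refine card_int_le fun a ha b hb => ?_
    simp only [mem_filter] at ha hb
    rw [le_div_iff₀ hα0]
    have h2 := ha.1.2
    have h3 := hb.1.2
    rw [ha.2] at h2
    rw [hb.2] at h3
    have h4 : |α * (a - b)| ≤ 2 * η := by
      have : α * ((a : ℝ) - b) = (α * a - n) - (α * b - n) := by ring
      rw [this]
      refine (abs_sub _ _).trans ?_
      linarith
    rw [abs_mul] at h4
    have := le_abs_self ((a : ℝ) - b)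
    nlinarith

lemma bilin_nonneg (M : ℕ) (α : ℝ) : 0 ≤ bilin M α := sum_nonneg fun _ _ => norm_nonneg _

lemma norm_sum_Icc_neg_le (M : ℕ) (f : ℤ → ℝ) : ‖∑ m ∈ Icc (-(M : ℤ)) M, e (f m)‖ ≤ 2 * M + 1 := by
  rw [sum_Icc_neg_eq]
  refine (norm_sum_le _ _).trans ?_
  simp [norm_e]

lemma bilin_le_trivial (M : ℕ) (α : ℝ) : bilin M α ≤ (2 * M + 1) ^ 2 := by
  rw [bilin, sum_Icc_neg_eq]
  refine (sum_le_sum fun l _ => norm_sum_Icc_neg_le M _).trans_eq ?_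
  rw [sum_const, card_range, nsmul_eq_mul]
  push_cast
  ring

lemma bilin_le (M : ℕ) {α η : ℝ} (hα : α ≠ 0) (hη : 0 < η) :
    bilin M α ≤ (2 * M + 1) * ((2 * |α| * M + 3) * (2 * η / |α| + 1) + 1 / (2 * η)) := by
  rw [bilin, ← sum_filter_add_sum_filter_not _ (fun l : ℤ => |α * l - round (α * l)| < η)]
  have h1 : ∑ l ∈ (Icc (-(M : ℤ)) M).filter fun l : ℤ => |α * l - round (α * l)| < η,
      ‖∑ m ∈ Icc (-(M : ℤ)) M, e (α * m * l)‖
      ≤ (2 * M + 1) * ((2 * |α| * M + 3) * (2 * η / |α| + 1)) := by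
    refine (sum_le_sum fun l _ => norm_sum_Icc_neg_le M _).trans ?_
    rw [sum_const, nsmul_eq_mul, mul_comm]
    gcongr
    exact card_near_integer_le M hα hη
  have h2 : ∑ l ∈ (Icc (-(M : ℤ)) M).filter fun l : ℤ => ¬ |α * l - round (α * l)| < η,
      ‖∑ m ∈ Icc (-(M : ℤ)) M, e (α * m * l)‖ ≤ (2 * M + 1) * (1 / (2 * η)) := by
    have h3 : ∀ l ∈ ((Icc (-(M : ℤ)) M).filter fun l : ℤ => ¬ |α * l - round (α * l)| < η),
        ‖∑ m ∈ Icc (-(M : ℤ)) M, e (α * m * l)‖ ≤ 1 / (2 * η) := by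
      intro l hl
      rw [mem_filter, not_lt] at hl
      refine le_trans (le_of_eq ?_) (norm_sum_e_le (M := M) hη hl.2)
      congr 1
      refine sum_congr rfl fun m _ => ?_
      ring_nf
    refine (sum_le_sum h3).trans ?_
    rw [sum_const, nsmul_eq_mul]
    gcongr
    have h4 := card_filter_le (Icc (-(M : ℤ)) M) (fun l : ℤ => ¬ |α * l - round (α * l)| < η)
    have h5 : #(Icc (-(M : ℤ)) M) = 2 * M + 1 := by rw [Int.card_Icc]; omega
    rw [h5] at h4
    exact_mod_cast h4
  linarith

/-- The saving for a coefficient of intermediate size. -/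
lemma bilin_le_window {s Y j : ℕ} (hs : 1 ≤ s) (hY : 1 ≤ Y) {α c : ℝ} (hc : c ≤ 1 / 2)
    (h1 : (Y : ℝ) ^ (-(j : ℝ)) ≤ |α|) (h2 : |α| ≤ (Y : ℝ) ^ (-(c * j))) :
    bilin (s * Y ^ j) α ≤ 9 * (Y : ℝ) ^ (-(c * j)) * (2 * ((s * Y ^ j : ℕ) : ℝ) + 1) ^ 2 := by
  have hY1 : (1 : ℝ) ≤ Y := by exact_mod_cast hY
  have hY0 : (0 : ℝ) < Y := by linarith
  have hs1 : (1 : ℝ) ≤ s := by exact_mod_cast hs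
  have hj : (0 : ℝ) ≤ j := Nat.cast_nonneg j
  set y : ℝ := (Y : ℝ) ^ ((j : ℝ) / 2) with hy
  have hy0 : 0 < y := by positivity
  have hyy : (Y : ℝ) ^ j = y * y := by
    rw [hy, ← Real.rpow_add hY0, ← Real.rpow_natCast]; congr 1; ring
  set z : ℝ := (Y : ℝ) ^ (-(c * j)) with hz
  have hz0 : 0 < z := by positivity
  have hα0 : 0 < |α| := lt_of_lt_of_le (by positivity) h1
  have hyz : y ≤ y * y * z := by
    rw [hy, hz, ← Real.rpow_add hY0, ← Real.rpow_add hY0]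
    refine Real.rpow_le_rpow_of_exponent_le hY1 ?_
    nlinarith
  have h1' : 1 ≤ |α| * (y * y) := by
    rw [Real.rpow_neg hY0.le, Real.rpow_natCast, hyy, inv_le_iff_one_le_mul₀ (by positivity)] at h1
    exact h1
  have h := bilin_le (s * Y ^ j) (abs_pos.1 hα0) (η := 1 / y) (by positivity)
  refine h.trans ?_
  push_cast
  rw [hyy]
  set m : ℝ := s * (y * y) with hm
  have hm0 : 0 < m := by positivity
  have hmα : 1 ≤ |α| * m := by
    have : y * y ≤ m := by rw [hm]; nlinarith [mul_pos hy0 hy0]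
    nlinarith
  have hyzm : y ≤ m * z := by
    refine hyz.trans ?_
    rw [hm]
    have : 0 < y * y * z := by positivity
    nlinarith
  have e1 : (2 * |α| * m + 3) * (2 * (1 / y) / |α| + 1)
      ≤ 5 * (|α| * m) * (2 * (1 / y) / |α| + 1) := by
    gcongr
    linarith
  have e2 : 5 * (|α| * m) * (2 * (1 / y) / |α| + 1) = 10 * (m / y) + 5 * (|α| * m) := by
    field_simp
    ring
  have e3 : m / y ≤ m * z := by
    have : 1 / y ≤ z := by
      rw [div_le_iff₀ hy0]
      have h7 : y * 1 ≤ y * (z * y) := by linarith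
      exact le_of_mul_le_mul_left h7 hy0
    calc m / y = m * (1 / y) := by ring
      _ ≤ _ := by gcongr
  have e4 : |α| * m ≤ m * z := by rw [mul_comm]; gcongr
  have e5 : 1 / (2 * (1 / y)) = y / 2 := by field_simp
  have e6 : (2 * |α| * m + 3) * (2 * (1 / y) / |α| + 1) + 1 / (2 * (1 / y)) ≤ 16 * (m * z) := by
    rw [e5]; nlinarith
  have e7 : 16 * (m * z) ≤ 9 * z * (2 * m + 1) := by nlinarith
  calc (2 * m + 1) * ((2 * |α| * m + 3) * (2 * (1 / y) / |α| + 1) + 1 / (2 * (1 / y)))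
      ≤ (2 * m + 1) * (9 * z * (2 * m + 1)) := by gcongr; exact e6.trans e7
    _ = _ := by ring

/-! ### The double sum estimate -/

lemma prod_bilin_le {d s Y : ℕ} (hs : 1 ≤ s) (hY : 1 ≤ Y) (α : Fin d → ℝ) {c : ℝ} (hc : c ≤ 1 / 2)
    (w : Finset (Fin d)) (hw : ∀ j ∈ w, (Y : ℝ) ^ (-((j.val + 1 : ℕ) : ℝ)) ≤ |α j| ∧
      |α j| ≤ (Y : ℝ) ^ (-(c * ((j.val + 1 : ℕ) : ℝ)))) :
    ∏ j : Fin d, bilin (s * Y ^ (j.val + 1)) (α j) ≤ ((9 * s : ℝ) ^ 2) ^ d *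
      (Y : ℝ) ^ (d * (d + 1) - c * ∑ j ∈ w, ((j.val + 1 : ℕ) : ℝ) : ℝ) := by
  classical
  have hY1 : (1 : ℝ) ≤ Y := by exact_mod_cast hY
  have hY0 : (0 : ℝ) < Y := by linarith
  have hs1 : (1 : ℝ) ≤ s := by exact_mod_cast hs
  have h1 : ∀ j : Fin d, bilin (s * Y ^ (j.val + 1)) (α j) ≤ (9 * s : ℝ) ^ 2 *
      (Y : ℝ) ^ (2 * ((j.val + 1 : ℕ) : ℝ) - if j ∈ w then c * ((j.val + 1 : ℕ) : ℝ) else 0) := by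
    intro j
    have hp : (2 * ((s * Y ^ (j.val + 1) : ℕ) : ℝ) + 1) ^ 2
        ≤ 9 * s ^ 2 * (Y : ℝ) ^ (2 * ((j.val + 1 : ℕ) : ℝ)) := by
      have h2 : (Y : ℝ) ^ (2 * ((j.val + 1 : ℕ) : ℝ)) = ((Y : ℝ) ^ (j.val + 1)) ^ 2 := by
        rw [mul_comm, Real.rpow_mul hY0.le, Real.rpow_natCast]
        norm_cast
      have h3 : (1 : ℝ) ≤ s * (Y : ℝ) ^ (j.val + 1) := by
        have : (1 : ℝ) ≤ (Y : ℝ) ^ (j.val + 1) := one_le_pow₀ hY1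
        nlinarith
      rw [h2]
      push_cast
      calc _ ≤ (3 * (s * (Y : ℝ) ^ (j.val + 1))) ^ 2 := by gcongr; linarith
        _ = _ := by ring
    split_ifs with hj
    · refine (bilin_le_window hs hY hc (hw j hj).1 (hw j hj).2).trans ?_
      rw [sub_eq_add_neg, Real.rpow_add hY0]
      calc _ ≤ 9 * (Y : ℝ) ^ (-(c * ((j.val + 1 : ℕ) : ℝ))) *
            (9 * s ^ 2 * (Y : ℝ) ^ (2 * ((j.val + 1 : ℕ) : ℝ))) := by gcongr
        _ = _ := by ring
    · refine (bilin_le_trivial _ _).trans (hp.trans ?_)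
      rw [sub_zero]
      gcongr
      nlinarith
  refine (prod_le_prod (fun j _ => bilin_nonneg _ _) fun j _ => h1 j).trans_eq ?_
  rw [prod_mul_distrib, prod_const, card_univ, Fintype.card_fin, ← Real.rpow_sum_of_pos hY0,
    sum_sub_distrib, sum_ite_mem, univ_inter, ← mul_sum, ← mul_sum]
  congr 3
  have h4 := sum_range_id_mul_two (d + 1)
  have h5 : ∑ j : Fin d, ((j.val + 1 : ℕ) : ℝ) = ((∑ i ∈ range (d + 1), i : ℕ) : ℝ) := by
    rw [Fin.sum_univ_eq_sum_range (fun i => ((i + 1 : ℕ) : ℝ)), sum_range_succ']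
    push_cast
    simp
  rw [h5]
  have h6 : ((∑ i ∈ range (d + 1), i : ℕ) : ℝ) * 2 = (d + 1) * d := by exact_mod_cast h4
  linarith

/-- A bound for the double sum with a saving from the coefficients of intermediate size. -/
theorem norm_doubleSum_le (R : ℕ) : ∃ C : ℝ, 0 < C ∧ ∀ d Y : ℕ, 3 ≤ d → 1 ≤ Y →
    ∀ (α : Fin d → ℝ) (c : ℝ), c ≤ 1 / 2 → ∀ w : Finset (Fin d),
    (∀ j ∈ w, (Y : ℝ) ^ (-((j.val + 1 : ℕ) : ℝ)) ≤ |α j| ∧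
      |α j| ≤ (Y : ℝ) ^ (-(c * ((j.val + 1 : ℕ) : ℝ)))) →
    ‖doubleSum Y α‖ ≤ (Y : ℝ) ^ 2 * Real.exp C *
      (Y : ℝ) ^ (-((c * ∑ j ∈ w, ((j.val + 1 : ℕ) : ℝ) - 2 * d ^ 2 * Real.exp (-R)) /
        (4 * (R + 1) ^ 2 * d ^ 4))) := by
  obtain ⟨C, hC, h⟩ := mean_value R
  refine ⟨2 * C + 18 * (R + 1), by positivity, fun d Y hd hY α c hc w hw => ?_⟩
  have hd3 : (3 : ℝ) ≤ d := by exact_mod_cast hd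
  have hY1 : (1 : ℝ) ≤ Y := by exact_mod_cast hY
  have hY0 : (0 : ℝ) < Y := by linarith
  set s := (R + 1) * d ^ 2 with hs
  have hs1 : 1 ≤ s := by rw [hs]; nlinarith
  have hsR : (s : ℝ) = (R + 1) * d ^ 2 := by rw [hs]; push_cast; ring
  set σ : ℝ := c * ∑ j ∈ w, ((j.val + 1 : ℕ) : ℝ) with hσ
  set n := 2 * s * (2 * s) with hn
  have hn0 : n ≠ 0 := by rw [hn]; positivity
  have hnR : (n : ℝ) = 4 * (R + 1) ^ 2 * d ^ 4 := by rw [hn]; push_cast; rw [hsR]; ring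
  have hn0' : (n : ℝ) ≠ 0 := by exact_mod_cast hn0
  refine le_of_pow_le_pow_left₀ hn0 (by positivity) ?_
  have hJ := h d Y hd hY
  have hP := prod_bilin_le hs1 hY α hc w hw
  have hP0 : 0 ≤ ∏ j : Fin d, bilin (s * Y ^ (j.val + 1)) (α j) :=
    prod_nonneg fun _ _ => bilin_nonneg _ _
  have hR0 : (0 : ℝ) ≤ R := Nat.cast_nonneg R
  have h81 : ((9 * s : ℝ) ^ 2) ^ d ≤ Real.exp (18 * (R + 1) * d ^ 4) := by
    have h1 : (9 * s : ℝ) ≤ Real.exp (9 * s) := by linarith [Real.add_one_le_exp (9 * s : ℝ)]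
    calc _ ≤ (Real.exp (9 * s) ^ 2) ^ d := by gcongr
      _ = Real.exp (18 * (R + 1) * d ^ 3) := by
        rw [← Real.exp_nat_mul, ← Real.exp_nat_mul, hsR]
        congr 1
        push_cast
        ring
      _ ≤ _ := by
        gcongr
        · linarith
        · norm_num
  set E : ℝ := 2 * (s : ℝ) - d * (d + 1) / 2 + d ^ 2 * Real.exp (-R) with hE
  calc ‖doubleSum Y α‖ ^ n ≤ (Y : ℝ) ^ ((2 * s - 1) * (2 * s)) *
      ((Y : ℝ) ^ (2 * s * (2 * s - 1)) * ((J d s (Icc 1 (Y : ℤ)) : ℝ) ^ 2 *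
        ∏ j : Fin d, bilin (s * Y ^ (j.val + 1)) (α j))) := norm_doubleSum_pow_le hs1 α
    _ ≤ (Y : ℝ) ^ ((2 * s - 1) * (2 * s)) *
      ((Y : ℝ) ^ (2 * s * (2 * s - 1)) * ((Real.exp (C * d ^ 4) * (Y : ℝ) ^ E) ^ 2 *
        (Real.exp (18 * (R + 1) * d ^ 4) * (Y : ℝ) ^ (d * (d + 1) - σ : ℝ)))) := by
        gcongr
        exact hP.trans (by gcongr)
    _ = Real.exp ((2 * C + 18 * (R + 1)) * d ^ 4) *
        (Y : ℝ) ^ (2 * (n : ℝ) - (σ - 2 * d ^ 2 * Real.exp (-R))) := by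
        have e1 : Real.exp ((2 * C + 18 * (R + 1)) * d ^ 4)
            = Real.exp (C * d ^ 4) ^ 2 * Real.exp (18 * (R + 1) * d ^ 4) := by
          rw [← Real.exp_nat_mul, ← Real.exp_add]; congr 1; push_cast; ring
        have e2 : (Y : ℝ) ^ (2 * (n : ℝ) - (σ - 2 * d ^ 2 * Real.exp (-R)))
            = (Y : ℝ) ^ ((2 * s - 1) * (2 * s)) * (Y : ℝ) ^ (2 * s * (2 * s - 1)) *
              ((Y : ℝ) ^ E) ^ 2 * (Y : ℝ) ^ (d * (d + 1) - σ : ℝ) := by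
          rw [← Real.rpow_natCast (Y : ℝ) ((2 * s - 1) * (2 * s)),
            ← Real.rpow_natCast (Y : ℝ) (2 * s * (2 * s - 1)), ← Real.rpow_natCast ((Y : ℝ) ^ E),
            ← Real.rpow_mul hY0.le, ← Real.rpow_add hY0, ← Real.rpow_add hY0, ← Real.rpow_add hY0]
          congr 1
          rw [hn, hE]
          push_cast [Nat.cast_sub (show 1 ≤ 2 * s by omega)]
          ring
        rw [e1, e2]
        ring
    _ ≤ Real.exp (2 * C + 18 * (R + 1)) ^ n *
        (Y : ℝ) ^ (2 * (n : ℝ) - (σ - 2 * d ^ 2 * Real.exp (-R))) := by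
        gcongr
        rw [← Real.exp_nat_mul, Real.exp_le_exp, hnR, mul_comm]
        gcongr
        have : (0 : ℝ) ≤ (d : ℝ) ^ 4 := by positivity
        nlinarith [mul_nonneg hR0 this, mul_nonneg (mul_nonneg hR0 hR0) this]
    _ = _ := by
        have e3 : ((Y : ℝ) ^ (-((σ - 2 * d ^ 2 * Real.exp (-R)) / (n : ℝ)))) ^ n
            = (Y : ℝ) ^ (-(σ - 2 * d ^ 2 * Real.exp (-R))) := by
          rw [← Real.rpow_natCast, ← Real.rpow_mul hY0.le, neg_mul, div_mul_cancel₀ _ hn0']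
        have e4 : ((Y : ℝ) ^ 2) ^ n = (Y : ℝ) ^ (2 * (n : ℝ)) := by
          rw [← pow_mul, ← Real.rpow_natCast]
          push_cast
          rfl
        rw [← hnR, mul_pow, mul_pow, e3, e4, sub_eq_add_neg, Real.rpow_add hY0]
        ring

/-! ### Taylor coefficients of `exp ((log t) ^ γ)` -/

lemma exists_norm_cpow_sub_one_le (c : ℂ) :
    ∃ M : ℝ, 0 ≤ M ∧ ∀ z : ℂ, ‖z‖ ≤ 1 / 2 → ‖(1 + z) ^ c - 1‖ ≤ M * ‖z‖ := by
  have hs : ∀ z ∈ Metric.closedBall (0 : ℂ) (1 / 2), 1 + z ∈ Complex.slitPlane := fun z hz =>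
    Complex.mem_slitPlane_of_norm_lt_one (by
      rw [mem_closedBall_zero_iff] at hz; linarith)
  have hd : ∀ z ∈ Metric.closedBall (0 : ℂ) (1 / 2),
      HasDerivAt (fun z : ℂ => (1 + z) ^ c) (c * (1 + z) ^ (c - 1) * 1) z := fun z hz =>
    ((hasDerivAt_id z).const_add 1).cpow_const (hs z hz)
  have hc : ContinuousOn (fun z : ℂ => c * (1 + z) ^ (c - 1) * 1)
      (Metric.closedBall (0 : ℂ) (1 / 2)) := by
    refine (continuousOn_const.mul (ContinuousOn.cpow_const ?_ hs)).mul continuousOn_const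
    fun_prop
  obtain ⟨M, hM⟩ := (isCompact_closedBall (0 : ℂ) (1 / 2)).exists_bound_of_continuousOn hc
  have h0 : (0 : ℂ) ∈ Metric.closedBall (0 : ℂ) (1 / 2) := by simp
  refine ⟨M, (norm_nonneg _).trans (hM 0 h0), fun z hz => ?_⟩
  have := (convex_closedBall (0 : ℂ) (1 / 2)).norm_image_sub_le_of_norm_hasDerivWithin_le
    (fun z hz => (hd z hz).hasDerivWithinAt) hM h0 (mem_closedBall_zero_iff.2 hz)
  simpa using this

lemma exists_norm_cpow_sub_linear_le (c : ℂ) :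
    ∃ M : ℝ, 0 ≤ M ∧ ∀ z : ℂ, ‖z‖ ≤ 1 / 2 → ‖(1 + z) ^ c - 1 - c * z‖ ≤ M * ‖z‖ ^ 2 := by
  obtain ⟨M, hM0, hM⟩ := exists_norm_cpow_sub_one_le (c - 1)
  refine ⟨‖c‖ * M, by positivity, fun z hz => ?_⟩
  have hd : ∀ x ∈ Metric.closedBall (0 : ℂ) ‖z‖,
      HasDerivWithinAt (fun z : ℂ => (1 + z) ^ c - 1 - c * z)
        (c * (1 + x) ^ (c - 1) * 1 - c * 1) (Metric.closedBall (0 : ℂ) ‖z‖) x := fun x hx => by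
    have h1 : 1 + x ∈ Complex.slitPlane := Complex.mem_slitPlane_of_norm_lt_one (by
      rw [mem_closedBall_zero_iff] at hx; linarith)
    exact (((((hasDerivAt_id x).const_add 1).cpow_const h1).sub_const 1).sub
      ((hasDerivAt_id x).const_mul c)).hasDerivWithinAt
  have := (convex_closedBall (0 : ℂ) ‖z‖).norm_image_sub_le_of_norm_hasDerivWithin_le
    (C := ‖c‖ * M * ‖z‖) hd (fun x hx => ?_) (show (0 : ℂ) ∈ _ by simp)
    (mem_closedBall_zero_iff.2 le_rfl)
  · simpa [pow_two, mul_assoc] using this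
  · rw [mem_closedBall_zero_iff] at hx
    rw [mul_one, mul_one, ← mul_sub_one, norm_mul, mul_assoc]
    have := hM x (hx.trans hz)
    gcongr
    exact this.trans (by gcongr)

/-- Applying the operators `d/ds + (a - i)`, `i < j`, to `H`. -/
noncomputable def twist (a : ℂ) (H : ℂ → ℂ) : ℕ → ℂ → ℂ
  | 0 => H
  | j + 1 => fun s => deriv (twist a H j) s + (a - j) * twist a H j s

lemma analyticOnNhd_twist {a : ℂ} {H : ℂ → ℂ} {S : Set ℂ} (hH : AnalyticOnNhd ℂ H S) (j : ℕ) :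
    AnalyticOnNhd ℂ (twist a H j) S := by
  induction j with
  | zero => exact hH
  | succ j ih => exact ih.deriv.add (analyticOnNhd_const.mul ih)

lemma iteratedDeriv_twist_succ {a : ℂ} {H : ℂ → ℂ} {S : Set ℂ} (hH : AnalyticOnNhd ℂ H S) {s : ℂ}
    (hs : s ∈ S) (j k : ℕ) :
    iteratedDeriv k (twist a H (j + 1)) s
      = iteratedDeriv (k + 1) (twist a H j) s + (a - j) * iteratedDeriv k (twist a H j) s := by
  have h1 := analyticOnNhd_twist (a := a) hH j
  have h2 : ContDiffAt ℂ k (deriv (twist a H j)) s := (h1.deriv s hs).contDiffAt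
  have h3 : ContDiffAt ℂ k (fun s => (a - j) * twist a H j s) s :=
    ((analyticOnNhd_const.mul h1) s hs).contDiffAt
  rw [iteratedDeriv_succ', ← iteratedDeriv_const_mul_field, ← iteratedDeriv_fun_add h2 h3]
  rfl

lemma norm_iteratedDeriv_twist_sub_le {a : ℝ} {H : ℂ → ℂ} {S : Set ℂ}
    (hH : AnalyticOnNhd ℂ H S) (hS : (0 : ℂ) ∈ S) (h0 : H 0 = 1) {η : ℝ} (hη0 : 0 ≤ η) {J : ℕ}
    (hη : ∀ k, 1 ≤ k → k ≤ J → ‖iteratedDeriv k H 0‖ ≤ η) (j : ℕ) :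
    (j : ℝ) ≤ a → ∀ k, j + k ≤ J →
      ‖iteratedDeriv k (twist a H j) 0 - (if k = 0 then ∏ i ∈ range j, ((a - i : ℝ) : ℂ) else 0)‖
        ≤ η * ∏ i ∈ range j, (a - i + 1) := by
  induction j with
  | zero =>
    intro _ k hk
    rcases Nat.eq_zero_or_pos k with rfl | hk0
    · simp [twist, h0, hη0]
    · simpa [twist, hk0.ne'] using hη k hk0 (by omega)
  | succ j ih =>
    intro hja k hk
    have hja' : (j : ℝ) ≤ a := by push_cast at hja; linarith
    have hP : 0 ≤ ∏ i ∈ range j, (a - i + 1) := prod_nonneg fun i hi => by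
      have : (i : ℝ) ≤ j := by exact_mod_cast (mem_range.1 hi).le
      linarith
    have h1 := ih hja' (k + 1) (by omega)
    have h2 := ih hja' k (by omega)
    rw [if_neg (by omega), sub_zero] at h1
    rw [iteratedDeriv_twist_succ hH hS, prod_range_succ, prod_range_succ]
    have : iteratedDeriv (k + 1) (twist a H j) 0 + (a - j) * iteratedDeriv k (twist a H j) 0
        - (if k = 0 then (∏ i ∈ range j, ((a - i : ℝ) : ℂ)) * ((a - j : ℝ) : ℂ) else 0)
        = iteratedDeriv (k + 1) (twist a H j) 0 + ((a - j : ℝ) : ℂ) *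
          (iteratedDeriv k (twist a H j) 0
            - (if k = 0 then ∏ i ∈ range j, ((a - i : ℝ) : ℂ) else 0)) := by
      split_ifs <;> push_cast <;> ring
    rw [this]
    refine (norm_add_le _ _).trans ?_
    rw [norm_mul, Complex.norm_real, Real.norm_of_nonneg (by linarith)]
    nlinarith [mul_le_mul_of_nonneg_left h2 (sub_nonneg.2 hja')]

lemma iteratedDeriv_comp_log {a : ℂ} {H : ℂ → ℂ} {U S : Set ℂ} (hU : IsOpen U)
    (h1 : ∀ w ∈ U, 1 + w ∈ Complex.slitPlane) (h2 : ∀ w ∈ U, Complex.log (1 + w) ∈ S)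
    (hH : AnalyticOnNhd ℂ H S) (j : ℕ) : ∀ w ∈ U,
    iteratedDeriv j (fun w => Complex.exp (a * Complex.log (1 + w)) * H (Complex.log (1 + w))) w
      = ((1 + w) ^ j)⁻¹ * (Complex.exp (a * Complex.log (1 + w)) *
        twist a H j (Complex.log (1 + w))) := by
  induction j with
  | zero => intro w _; simp [twist]
  | succ j ih =>
    intro w hw
    have hev : iteratedDeriv j
        (fun w => Complex.exp (a * Complex.log (1 + w)) * H (Complex.log (1 + w)))
        =ᶠ[nhds w] fun w => ((1 + w) ^ j)⁻¹ * (Complex.exp (a * Complex.log (1 + w)) *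
        twist a H j (Complex.log (1 + w))) :=
      Filter.eventually_of_mem (hU.mem_nhds hw) ih
    have hne : 1 + w ≠ 0 := Complex.slitPlane_ne_zero (h1 w hw)
    have hadd : HasDerivAt (fun w : ℂ => 1 + w) 1 w := (hasDerivAt_id w).const_add 1
    have hlog := hadd.clog (h1 w hw)
    have hV : HasDerivAt (fun w : ℂ => twist a H j (Complex.log (1 + w)))
        (deriv (twist a H j) (Complex.log (1 + w)) * (1 / (1 + w))) w :=
      HasDerivAt.comp w
        ((analyticOnNhd_twist hH j) _ (h2 w hw)).differentiableAt.hasDerivAt hlog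
    have hp : HasDerivAt (fun w : ℂ => ((1 + w) ^ j)⁻¹)
        (-(j * (1 + w) ^ (j - 1) * 1) / ((1 + w) ^ j) ^ 2) w :=
      (hadd.fun_pow j).inv (pow_ne_zero _ hne)
    have := hp.fun_mul ((hlog.const_mul a).cexp.fun_mul hV)
    rw [iteratedDeriv_succ, hev.deriv_eq]
    refine this.deriv.trans ?_
    simp only [twist]
    rcases j with _ | j
    · simp
      field_simp
      ring
    · simp only [Nat.add_sub_cancel]
      push_cast
      field_simp
      ring

/-! ### Linear approximation of complex powers -/

/-- The error in the linear approximation of `s ↦ (L + s) ^ γ` at `0`. -/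
noncomputable def cpowErr (γ L : ℝ) (s : ℂ) : ℂ :=
  ((L : ℂ) + s) ^ (γ : ℂ) - ((L ^ γ : ℝ) : ℂ) - ((γ * L ^ (γ - 1) : ℝ) : ℂ) * s

lemma exists_norm_cpowErr_le (γ : ℝ) : ∃ M : ℝ, 0 ≤ M ∧ ∀ L : ℝ, 0 < L → ∀ s : ℂ, ‖s‖ ≤ L / 2 →
    ‖cpowErr γ L s‖ ≤ M * L ^ (γ - 2) * ‖s‖ ^ 2 := by
  obtain ⟨M, hM0, hM⟩ := exists_norm_cpow_sub_linear_le (γ : ℂ)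
  refine ⟨M, hM0, fun L hL s hs => ?_⟩
  have hLc : (L : ℂ) ≠ 0 := by exact_mod_cast hL.ne'
  have hz : ‖s / L‖ = ‖s‖ / L := by
    rw [norm_div, Complex.norm_real, Real.norm_of_nonneg hL.le]
  have hz2 : ‖s / L‖ ≤ 1 / 2 := by
    rw [hz, div_le_iff₀ hL]; linarith
  have h1 : 1 + s / L ≠ 0 := Complex.slitPlane_ne_zero
    (Complex.mem_slitPlane_of_norm_lt_one (by linarith))
  have h2 : (L : ℂ) + s = L * (1 + s / L) := by field_simp
  have h3 : ((L : ℂ) + s) ^ (γ : ℂ) = ((L ^ γ : ℝ) : ℂ) * (1 + s / L) ^ (γ : ℂ) := by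
    rw [h2, Complex.ofReal_cpow hL.le, Complex.cpow_def_of_ne_zero (mul_ne_zero hLc h1),
      Complex.cpow_def_of_ne_zero hLc, Complex.cpow_def_of_ne_zero h1,
      Complex.log_ofReal_mul hL h1, ← Complex.exp_add, ← Complex.ofReal_log hL.le]
    ring_nf
  have h4 : cpowErr γ L s
      = ((L ^ γ : ℝ) : ℂ) * ((1 + s / L) ^ (γ : ℂ) - 1 - γ * (s / L)) := by
    rw [cpowErr, h3, Real.rpow_sub_one hL.ne']
    push_cast
    ring
  rw [h4, norm_mul, Complex.norm_real, Real.norm_of_nonneg (by positivity)]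
  calc L ^ γ * ‖(1 + s / L) ^ (γ : ℂ) - 1 - γ * (s / L)‖ ≤ L ^ γ * (M * ‖s / L‖ ^ 2) := by
        gcongr
        exact hM _ hz2
    _ = _ := by
        rw [hz, Real.rpow_sub hL, Real.rpow_two]
        ring

lemma differentiableOn_cpowErr {γ L : ℝ} (hL : 0 < L) :
    DifferentiableOn ℂ (cpowErr γ L) (Metric.ball 0 (L / 2)) := by
  intro s hs
  rw [mem_ball_zero_iff] at hs
  have h1 : (L : ℂ) + s ∈ Complex.slitPlane := by
    refine Or.inl ?_
    have := (abs_le.1 (Complex.abs_re_le_norm s)).1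
    simp
    linarith
  refine DifferentiableAt.differentiableWithinAt ?_
  unfold cpowErr
  refine ((DifferentiableAt.cpow_const ?_ h1).sub_const _).sub ?_ <;> fun_prop

lemma norm_iteratedDeriv_exp_cpowErr_le {γ M : ℝ}
    (hM : ∀ L : ℝ, 0 < L → ∀ s : ℂ, ‖s‖ ≤ L / 2 →
      ‖cpowErr γ L s‖ ≤ M * L ^ (γ - 2) * ‖s‖ ^ 2) {L : ℝ} (hL : 8 < L) {k : ℕ} (hk : 1 ≤ k)
    (hkL : (k : ℝ) ≤ 2 * L ^ (γ - 1)) :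
    ‖iteratedDeriv k (fun s => Complex.exp (cpowErr γ L s)) 0‖
      ≤ (Real.exp M * √(k * L ^ (γ - 2))) ^ k := by
  have hL0 : 0 < L := by linarith
  have hk0 : (0 : ℝ) < k := by exact_mod_cast hk
  have hε : 0 < L ^ (γ - 2) := by positivity
  have hr : 0 < √(k / L ^ (γ - 2)) := by positivity
  have hr2 : √(k / L ^ (γ - 2)) ^ 2 = k / L ^ (γ - 2) := Real.sq_sqrt (by positivity)
  have hrL : √(k / L ^ (γ - 2)) < L / 2 := by
    rw [Real.sqrt_lt' (by positivity), div_lt_iff₀ hε]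
    have : L ^ (γ - 1) = L * L ^ (γ - 2) := by
      rw [show γ - 1 = 1 + (γ - 2) by ring, Real.rpow_add hL0, Real.rpow_one]
    rw [this] at hkL
    nlinarith
  have hd := (differentiableOn_cpowErr (γ := γ) hL0).cexp
  refine (Complex.norm_iteratedDeriv_le_of_forall_mem_sphere_norm_le (C := Real.exp (M * k)) k hr
    ?_ ?_).trans ?_
  · refine DifferentiableOn.diffContOnCl ((hd.mono ?_))
    rw [closure_ball _ hr.ne']
    exact Metric.closedBall_subset_ball hrL
  · intro z hz
    rw [mem_sphere_zero_iff_norm] at hz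
    rw [Complex.norm_exp]
    refine Real.exp_le_exp.2 (((Complex.re_le_norm _).trans
      (hM L hL0 z (by rw [hz]; exact hrL.le))).trans_eq ?_)
    rw [hz, hr2]
    field_simp
  · rw [div_le_iff₀ (by positivity), ← mul_pow]
    have : Real.exp M * √(k * L ^ (γ - 2)) * √(k / L ^ (γ - 2)) = Real.exp M * k := by
      rw [mul_assoc, ← Real.sqrt_mul (by positivity)]
      congr 1
      rw [show (k : ℝ) * L ^ (γ - 2) * (k / L ^ (γ - 2)) = (k : ℝ) ^ 2 by field_simp]
      exact Real.sqrt_sq hk0.le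
    rw [this, mul_pow, ← Real.exp_nat_mul, mul_comm (k : ℝ) M, mul_comm]
    gcongr
    exact_mod_cast Nat.factorial_le_pow k

lemma prod_add_one_eq (a : ℝ) (j : ℕ) :
    (∏ i ∈ range j, (a - i + 1)) * (a - j + 1) = (a + 1) * ∏ i ∈ range j, (a - i) := by
  induction j with
  | zero => simp
  | succ j ih =>
    rw [prod_range_succ, prod_range_succ, ← mul_assoc, ← ih]
    push_cast
    ring

lemma factorial_le_prod_sub {a : ℝ} {j : ℕ} (h : (j : ℝ) ≤ a) :
    (j.factorial : ℝ) ≤ ∏ i ∈ range j, (a - i) := by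
  have : (j.factorial : ℝ) = ∏ i ∈ range j, ((j : ℝ) - i) := by
    rw [← Nat.descFactorial_self, Nat.descFactorial_eq_prod_range]
    push_cast
    exact prod_congr rfl fun i hi => by rw [Nat.cast_sub (mem_range.1 hi).le]
  rw [this]
  refine prod_le_prod (fun i hi => ?_) fun i hi => by linarith
  have : (i : ℝ) ≤ j := by exact_mod_cast (mem_range.1 hi).le
  linarith

/-- `w ↦ F (t (1 + w)) / F t`, extended to complex `w`, in terms of `L = log t`. -/
noncomputable def relF (γ L : ℝ) (w : ℂ) : ℂ :=
  Complex.exp (((γ * L ^ (γ - 1) : ℝ) : ℂ) * Complex.log (1 + w)) *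
    Complex.exp (cpowErr γ L (Complex.log (1 + w)))

lemma norm_log_one_add_lt {w : ℂ} (hw : ‖w‖ < 3 / 4) : ‖Complex.log (1 + w)‖ < 2 := by
  have h := Complex.norm_log_one_add_le (z := w) (by linarith)
  have h0 := norm_nonneg w
  have h1 : (1 - ‖w‖)⁻¹ ≤ 4 := inv_le_of_inv_le₀ (by norm_num) (by linarith)
  have h2 : ‖w‖ ^ 2 ≤ 9 / 16 := by nlinarith
  have h3 : ‖w‖ ^ 2 * (1 - ‖w‖)⁻¹ ≤ 9 / 16 * 4 := by
    apply mul_le_mul h2 h1 (inv_nonneg.2 (by linarith)) (by norm_num)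
  linarith

lemma one_add_mem_slitPlane {w : ℂ} (hw : ‖w‖ < 3 / 4) : 1 + w ∈ Complex.slitPlane :=
  Complex.mem_slitPlane_of_norm_lt_one (by linarith)

lemma differentiableOn_relF {γ L : ℝ} (hL : 8 < L) :
    DifferentiableOn ℂ (relF γ L) (Metric.ball 0 (3 / 4)) := by
  have hlog : DifferentiableOn ℂ (fun w : ℂ => Complex.log (1 + w)) (Metric.ball 0 (3 / 4)) := by
    intro w hw
    rw [mem_ball_zero_iff] at hw
    refine DifferentiableAt.differentiableWithinAt ?_
    exact DifferentiableAt.clog (by fun_prop) (one_add_mem_slitPlane hw)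
  refine (hlog.const_mul _).cexp.mul (DifferentiableOn.cexp ?_)
  refine (differentiableOn_cpowErr (by linarith)).comp hlog fun w hw => ?_
  rw [mem_ball_zero_iff] at hw ⊢
  linarith [norm_log_one_add_lt hw]

lemma relF_ofReal {γ L x : ℝ} (hL : 8 < L) (hx0 : 0 ≤ x) :
    relF γ L x = ((Real.exp ((L + Real.log (1 + x)) ^ γ) / Real.exp (L ^ γ) : ℝ) : ℂ) := by
  have h1 : Complex.log (1 + (x : ℂ)) = ((Real.log (1 + x) : ℝ) : ℂ) := by
    rw [Complex.ofReal_log (by linarith)]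
    push_cast
    rfl
  have h2 : 0 ≤ Real.log (1 + x) := Real.log_nonneg (by linarith)
  rw [relF, h1, cpowErr, ← Complex.exp_add, ← Real.exp_sub, Complex.ofReal_exp]
  congr 1
  rw [Complex.ofReal_sub, Complex.ofReal_cpow (show 0 ≤ L + Real.log (1 + x) by linarith)]
  push_cast
  ring

theorem exists_taylor (γ : ℝ) (hγ : 1 < γ) (hγ' : γ < 3 / 2) :
    ∃ C : ℝ, 0 < C ∧ ∃ L₀ : ℝ, 8 < L₀ ∧ ∀ t : ℝ, 0 < t → L₀ ≤ Real.log t → ∃ c : ℕ → ℝ,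
      (∀ j, |c j| ≤ Real.exp (C * Real.log t ^ (γ - 1)) * 2 ^ j) ∧
      (∀ j : ℕ, (j : ℝ) ≤ (1 + (γ - 1) / 2) * Real.log t ^ (γ - 1) → 1 / 2 ≤ c j) ∧
      ∀ x : ℝ, 0 ≤ x → x ≤ 1 / 4 → ∀ d : ℕ,
        |Fγ γ (t * (1 + x)) - Fγ γ t * ∑ j ∈ range d, c j * x ^ j|
          ≤ Fγ γ t * (2 * Real.exp (C * Real.log t ^ (γ - 1)) * (2 * x) ^ d) := by
  obtain ⟨M, hM0, hM⟩ := exists_norm_cpowErr_le γ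
  have hev : ∀ᶠ L : ℝ in Filter.atTop, 8 < L ∧ 2 ≤ L ^ (γ - 1) ∧
      Real.exp M * √2 * L ^ (-((3 - 2 * γ) / 2)) < (γ - 1) / 16 := by
    refine (Filter.eventually_gt_atTop 8).and
      (((tendsto_rpow_atTop (by linarith)).eventually_ge_atTop 2).and ?_)
    have := (tendsto_rpow_neg_atTop (show 0 < (3 - 2 * γ) / 2 by linarith)).const_mul
      (Real.exp M * √2)
    rw [mul_zero] at this
    exact this.eventually_lt_const (by linarith)
  obtain ⟨L₁, hL₁⟩ := Filter.eventually_atTop.1 hev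
  refine ⟨2 * γ + 4 * M, by linarith, max L₁ 9, lt_max_of_lt_right (by norm_num),
    fun t ht hL => ?_⟩
  obtain ⟨hL8, hn2, hη⟩ := hL₁ _ ((le_max_left _ _).trans hL)
  set L := Real.log t with hLdef
  have hL0 : 0 < L := by linarith
  set n := L ^ (γ - 1) with hn
  set c : ℕ → ℂ := fun j => ((j.factorial : ℂ))⁻¹ * iteratedDeriv j (relF γ L) 0 with hc
  have hE : L ^ (γ - 2) ≤ n := Real.rpow_le_rpow_of_exponent_le (by linarith) (by linarith)
  have hbd : ∀ w : ℂ, ‖w‖ < 3 / 4 → ‖relF γ L w‖ ≤ Real.exp ((2 * γ + 4 * M) * n) := by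
    intro w hw
    have hs := norm_log_one_add_lt hw
    rw [relF, ← Complex.exp_add, Complex.norm_exp]
    refine Real.exp_le_exp.2 ((Complex.re_le_norm _).trans ((norm_add_le _ _).trans ?_))
    have h1 := hM L hL0 (Complex.log (1 + w)) (by linarith)
    have h2 : M * L ^ (γ - 2) * ‖Complex.log (1 + w)‖ ^ 2 ≤ M * n * 2 ^ 2 := by gcongr
    rw [norm_mul, Complex.norm_real, Real.norm_of_nonneg (by positivity)]
    have h3 : γ * n * ‖Complex.log (1 + w)‖ ≤ γ * n * 2 := by gcongr
    linarith
  have hcb : ∀ j, ‖c j‖ ≤ Real.exp ((2 * γ + 4 * M) * n) * 2 ^ j := by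
    intro j
    have := Complex.norm_iteratedDeriv_le_of_forall_mem_sphere_norm_le (c := 0) (R := 1 / 2)
      (C := Real.exp ((2 * γ + 4 * M) * n)) (f := relF γ L) j (by norm_num) ?_ ?_
    · rw [hc]
      simp only
      rw [norm_mul, norm_inv, Complex.norm_natCast]
      have hj : (0 : ℝ) < j.factorial := by exact_mod_cast j.factorial_pos
      rw [inv_mul_le_iff₀ hj]
      refine this.trans_eq ?_
      rw [one_div, inv_pow, div_inv_eq_mul, mul_assoc]
    · refine DifferentiableOn.diffContOnCl ((differentiableOn_relF hL8).mono ?_)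
      rw [closure_ball _ (by norm_num)]
      exact Metric.closedBall_subset_ball (by norm_num)
    · intro z hz
      rw [mem_sphere_zero_iff_norm] at hz
      exact hbd z (by rw [hz]; norm_num)
  refine ⟨fun j => (c j).re, fun j => (Complex.abs_re_le_norm _).trans (hcb j), fun j hj => ?_,
    fun x hx0 hx d => ?_⟩
  · have hγn : (γ - 1) / 2 * n ≤ γ * n - j := by nlinarith
    have hja : (j : ℝ) ≤ γ * n := by nlinarith
    have hE0 : cpowErr γ L 0 = 0 := by
      have := hM L hL0 0 (by simp; linarith)
      simpa using this
    set H : ℂ → ℂ := fun s => Complex.exp (cpowErr γ L s) with hH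
    have hHan : AnalyticOnNhd ℂ H (Metric.ball 0 (L / 2)) :=
      (differentiableOn_cpowErr hL0).cexp.analyticOnNhd Metric.isOpen_ball
    have hjJ : j + 0 ≤ ⌊2 * n⌋₊ := Nat.le_floor (by push_cast; nlinarith)
    have hder := norm_iteratedDeriv_twist_sub_le (a := γ * n) (η := (γ - 1) / 16) hHan
      (by simpa using hL0) (by simp [hH, hE0]) (by linarith) (J := ⌊2 * n⌋₊) (fun k hk1 hkJ => by
        have hkn : (k : ℝ) ≤ 2 * n := (Nat.le_floor_iff (by positivity)).1 hkJ
        refine (norm_iteratedDeriv_exp_cpowErr_le hM hL8 hk1 hkn).trans ?_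
        have hb : Real.exp M * √(k * L ^ (γ - 2)) ≤ (γ - 1) / 16 := by
          refine le_trans ?_ hη.le
          rw [mul_assoc]
          gcongr
          have h2 : √2 * L ^ (-((3 - 2 * γ) / 2)) = √(2 * n * L ^ (γ - 2)) := by
            rw [mul_assoc, Real.sqrt_mul (by norm_num), hn, ← Real.rpow_add hL0,
              Real.sqrt_eq_rpow (L ^ _), ← Real.rpow_mul hL0.le]
            ring_nf
          rw [h2]
          gcongr
        exact (pow_le_of_le_one (by positivity) (by linarith) (by omega)).trans hb)
      j hja 0 hjJ
    have hiter : iteratedDeriv j (relF γ L) 0 = twist ((γ * n : ℝ) : ℂ) H j 0 := by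
      have := iteratedDeriv_comp_log (a := ((γ * n : ℝ) : ℂ)) (U := Metric.ball 0 (3 / 4))
        Metric.isOpen_ball (fun w hw => one_add_mem_slitPlane (mem_ball_zero_iff.1 hw))
        (fun w hw => by
          have := norm_log_one_add_lt (mem_ball_zero_iff.1 hw)
          rw [mem_ball_zero_iff]
          linarith) hHan j 0 (by simp)
      change iteratedDeriv j (fun w => Complex.exp (((γ * n : ℝ) : ℂ) * Complex.log (1 + w)) *
        H (Complex.log (1 + w))) 0 = _
      simpa using this
    rw [iteratedDeriv_zero, if_pos rfl, ← hiter, ← Complex.ofReal_prod] at hder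
    set P := ∏ i ∈ range j, (γ * n - i) with hP
    have hfac : (j.factorial : ℝ) ≤ P := factorial_le_prod_sub hja
    have hfac0 : (0 : ℝ) < j.factorial := by exact_mod_cast j.factorial_pos
    have hQ := prod_add_one_eq (γ * n) j
    set Q := ∏ i ∈ range j, (γ * n - i + 1) with hQdef
    have hQ0 : 0 ≤ Q := prod_nonneg fun i hi => by
      have : (i : ℝ) ≤ j := by exact_mod_cast (mem_range.1 hi).le
      linarith
    have hQP : (γ - 1) / 16 * Q ≤ P / 2 := by
      have h1 : Q * ((γ - 1) / 2 * n) ≤ 2 * n * P := by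
        calc Q * ((γ - 1) / 2 * n) ≤ Q * (γ * n - j + 1) := by gcongr; linarith
          _ = (γ * n + 1) * P := hQ
          _ ≤ 2 * n * P := by
            refine mul_le_mul_of_nonneg_right ?_ (hfac0.le.trans hfac)
            nlinarith
      have h2 : n * ((γ - 1) / 16 * Q) ≤ n * (P / 2) := by
        nlinarith [hfac0.le.trans hfac]
      exact le_of_mul_le_mul_left h2 (by linarith)
    have hre := (abs_le.1 ((Complex.abs_re_le_norm _).trans (hder.trans hQP))).1
    rw [Complex.sub_re, Complex.ofReal_re] at hre
    have hcre : (c j).re = (j.factorial : ℝ)⁻¹ * (iteratedDeriv j (relF γ L) 0).re := by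
      rw [hc]
      simp only
      rw [← Complex.ofReal_natCast, ← Complex.ofReal_inv, Complex.re_ofReal_mul]
    change 1 / 2 ≤ (c j).re
    rw [hcre, ← div_eq_inv_mul, le_div_iff₀ hfac0]
    linarith
  · have hsum : HasSum (fun j => c j * (x : ℂ) ^ j) (relF γ L x) := by
      have := Complex.hasSum_taylorSeries_on_ball (differentiableOn_relF (γ := γ) hL8)
        (z := (x : ℂ)) (by
          rw [mem_ball_zero_iff, Complex.norm_real, Real.norm_of_nonneg hx0]; linarith)
      simpa [hc, mul_comm, mul_left_comm, mul_assoc] using this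
    have hF : Fγ γ (t * (1 + x)) = Fγ γ t * (relF γ L x).re := by
      rw [relF_ofReal hL8 hx0, Complex.ofReal_re, Fγ, Fγ, Real.log_mul ht.ne' (by linarith),
        mul_div_cancel₀ _ (Real.exp_pos _).ne']
    have htail := (hasSum_nat_add_iff' d).2 hsum
    set X := Real.exp ((2 * γ + 4 * M) * n)
    have hX : 0 < X := Real.exp_pos _
    have hgeo : HasSum (fun i : ℕ => X * (2 * x) ^ d * (2 * x) ^ i)
        (X * (2 * x) ^ d * (1 - 2 * x)⁻¹) :=
      (hasSum_geometric_of_lt_one (by linarith) (by linarith)).mul_left _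
    have hb := htail.norm_le_of_bounded hgeo fun i => by
      rw [norm_mul, norm_pow, Complex.norm_real, Real.norm_of_nonneg hx0]
      calc ‖c (i + d)‖ * x ^ (i + d) ≤ X * 2 ^ (i + d) * x ^ (i + d) := by
            gcongr
            exact hcb _
        _ = _ := by rw [mul_pow, mul_pow]; ring
    have hFt : 0 < Fγ γ t := Real.exp_pos _
    rw [hF, ← mul_sub, abs_mul, abs_of_pos hFt]
    gcongr
    have h2 : (1 - 2 * x)⁻¹ ≤ 2 := inv_le_of_inv_le₀ (by norm_num) (by linarith)
    have hre : (relF γ L x).re - ∑ j ∈ range d, (c j).re * x ^ j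
        = (relF γ L x - ∑ j ∈ range d, c j * (x : ℂ) ^ j).re := by
      rw [Complex.sub_re, Complex.re_sum]
      congr 1
      refine sum_congr rfl fun j _ => ?_
      rw [← Complex.ofReal_pow, Complex.re_mul_ofReal]
    rw [hre]
    refine (Complex.abs_re_le_norm _).trans (hb.trans ?_)
    have : 0 ≤ X * (2 * x) ^ d := by positivity
    nlinarith

/-! ### Choice of parameters -/

lemma norm_e_sub_e_le (x y : ℝ) : ‖e x - e y‖ ≤ 2 * Real.pi * |x - y| := by
  have h : e x - e y = e y * (Complex.exp (Complex.I * ((2 * Real.pi * (x - y) : ℝ) : ℂ)) - 1) := by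
    rw [mul_sub_one, e, e, ← Complex.exp_add]
    push_cast
    ring_nf
  rw [h, norm_mul, norm_e, one_mul]
  refine (Real.norm_exp_I_mul_ofReal_sub_one_le).trans_eq ?_
  rw [Real.norm_eq_abs, abs_mul, abs_of_pos Real.two_pi_pos]

lemma norm_double_sum_sub_le {d Y : ℕ} {f : ℝ → ℝ} {a E : ℝ} {α : Fin d → ℝ}
    (h : ∀ m : ℝ, 1 ≤ m → m ≤ (Y : ℝ) ^ 2 → |f m - (a + ∑ j, α j * m ^ (j.val + 1))| ≤ E) :
    ‖∑ v ∈ Icc 1 (Y : ℤ), ∑ u ∈ Icc 1 (Y : ℤ), e (f (u * v))‖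
      ≤ ‖doubleSum Y α‖ + (Y : ℝ) ^ 2 * (2 * Real.pi * E) := by
  have h1 : ‖∑ v ∈ Icc 1 (Y : ℤ), ∑ u ∈ Icc 1 (Y : ℤ), e (f (u * v)) - e a * doubleSum Y α‖
      ≤ (Y : ℝ) ^ 2 * (2 * Real.pi * E) := by
    simp only [doubleSum, mul_sum, ← sum_sub_distrib, ← e_add]
    calc _ ≤ ∑ v ∈ Icc 1 (Y : ℤ), ∑ u ∈ Icc 1 (Y : ℤ), 2 * Real.pi * E := by
          refine (norm_sum_le _ _).trans (sum_le_sum fun v hv => ?_)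
          refine (norm_sum_le _ _).trans (sum_le_sum fun u hu => ?_)
          rw [mem_Icc] at hu hv
          have hu1 : (1 : ℝ) ≤ u := by exact_mod_cast hu.1
          have hv1 : (1 : ℝ) ≤ v := by exact_mod_cast hv.1
          have hu2 : (u : ℝ) ≤ Y := by exact_mod_cast hu.2
          have hv2 : (v : ℝ) ≤ Y := by exact_mod_cast hv.2
          refine (norm_e_sub_e_le _ _).trans ?_
          gcongr
          exact h _ (by nlinarith) (by nlinarith)
      _ = _ := by
          simp only [sum_const, Int.card_Icc, nsmul_eq_mul]
          simp
          ring
  have h2 := norm_sub_norm_le (∑ v ∈ Icc 1 (Y : ℤ), ∑ u ∈ Icc 1 (Y : ℤ), e (f (u * v)))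
    (e a * doubleSum Y α)
  rw [norm_mul, norm_e, one_mul] at h2
  linarith

lemma eventually_log_le {s : ℝ} (hs : 0 < s) (a b : ℝ) {c : ℝ} (hc : 0 < c) :
    ∀ᶠ L : ℝ in Filter.atTop, a + b * Real.log L ≤ c * L ^ s := by
  have h1 := (isLittleO_log_rpow_atTop hs).def (show 0 < c / (2 * (|b| + 1)) by positivity)
  have h2 := (tendsto_rpow_atTop hs).eventually_ge_atTop (2 * |a| / c)
  filter_upwards [h1, h2, Filter.eventually_ge_atTop 1] with L h1 h2 hL
  have hp : 0 < L ^ s := by positivity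
  rw [Real.norm_of_nonneg (Real.log_nonneg hL), Real.norm_of_nonneg hp.le] at h1
  rw [div_le_iff₀ hc] at h2
  have h3 : b * Real.log L ≤ (|b| + 1) * Real.log L :=
    mul_le_mul_of_nonneg_right (by linarith [le_abs_self b]) (Real.log_nonneg hL)
  have h4 : (|b| + 1) * Real.log L ≤ (|b| + 1) * (c / (2 * (|b| + 1)) * L ^ s) := by gcongr
  have h5 : (|b| + 1) * (c / (2 * (|b| + 1)) * L ^ s) = c / 2 * L ^ s := by
    field_simp
  linarith [le_abs_self a]

/-- A window of indices `i = j + 1` just above `n` carries a positive proportion of `n ^ 2`. -/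
lemma exists_window {n c : ℝ} (hc : 0 < c) (hc' : c < 1 / 8) (hn : 8 ≤ c * n) {d : ℕ}
    (hd : 2 * n ≤ d) : ∃ w : Finset (Fin d),
      (∀ j ∈ w, (1 + c) * n ≤ ((j.val + 1 : ℕ) : ℝ) ∧ ((j.val + 1 : ℕ) : ℝ) ≤ (1 + 2 * c) * n) ∧
      c / 2 * n ^ 2 ≤ ∑ j ∈ w, ((j.val + 1 : ℕ) : ℝ) := by
  have hn0 : 0 < n := by
    by_contra h
    push Not at h
    nlinarith
  set s := Icc ⌈(1 + c) * n⌉₊ ⌊(1 + 2 * c) * n⌋₊ with hs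
  have hmem : ∀ i ∈ s, (1 + c) * n ≤ (i : ℝ) ∧ (i : ℝ) ≤ (1 + 2 * c) * n := by
    intro i hi
    rw [hs, mem_Icc] at hi
    exact ⟨Nat.ceil_le.1 hi.1, (Nat.le_floor_iff (by positivity)).1 hi.2⟩
  have hpos : ∀ i ∈ s, 1 ≤ i ∧ i ≤ d := by
    intro i hi
    obtain ⟨h1, h2⟩ := hmem i hi
    refine ⟨by_contra fun h => ?_, ?_⟩
    · have : i = 0 := by omega
      rw [this] at h1
      push_cast at h1
      nlinarith
    · have : (i : ℝ) ≤ d := by nlinarith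
      exact_mod_cast this
  refine ⟨univ.filter fun j : Fin d => j.val + 1 ∈ s, fun j hj => hmem _ (mem_filter.1 hj).2, ?_⟩
  have himg : ∑ j ∈ univ.filter (fun j : Fin d => j.val + 1 ∈ s), ((j.val + 1 : ℕ) : ℝ)
      = ∑ i ∈ s, (i : ℝ) := by
    refine sum_bij (fun j _ => j.val + 1) (fun j hj => (mem_filter.1 hj).2)
      (fun a _ b _ h => Fin.ext (by simpa using h)) (fun i hi => ?_) fun _ _ => rfl
    obtain ⟨h1, h2⟩ := hpos i hi
    refine ⟨⟨i - 1, by omega⟩, ?_, by simp; omega⟩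
    rw [mem_filter]
    refine ⟨mem_univ _, ?_⟩
    simpa [Nat.sub_add_cancel h1] using hi
  rw [himg]
  have hcard : c * n / 2 ≤ ((#s : ℕ) : ℝ) := by
    have h1 := Nat.ceil_lt_add_one (show 0 ≤ (1 + c) * n by positivity)
    have h2 := Nat.lt_floor_add_one ((1 + 2 * c) * n)
    have h3 : ((⌊(1 + 2 * c) * n⌋₊ + 1 : ℕ) : ℝ) - (⌈(1 + c) * n⌉₊ : ℕ) ≤ ((#s : ℕ) : ℝ) := by
      rw [hs, Nat.card_Icc, sub_le_iff_le_add]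
      exact_mod_cast (by omega)
    push_cast at h3
    nlinarith
  calc c / 2 * n ^ 2 = c * n / 2 * n := by ring
    _ ≤ ((#s : ℕ) : ℝ) * n := by gcongr
    _ = ∑ i ∈ s, n := by rw [sum_const, nsmul_eq_mul]
    _ ≤ _ := sum_le_sum fun i hi => by nlinarith [(hmem i hi).1]

/-! ### Short exponential sums -/

set_option maxHeartbeats 1000000 in
theorem norm_sum_e_Fγ_le (γ : ℝ) (hγ : 1 < γ) (hγ' : γ < 3 / 2) (C D : ℝ) (hC : 0 < C)
    (hD : 0 < D) : ∃ L₁ : ℝ, ∀ t : ℝ, 0 < t → L₁ ≤ Real.log t → ∀ Y : ℕ,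
      t ^ (1 / 5 : ℝ) ≤ Y → (Y : ℝ) ≤ t ^ (1 / 4 : ℝ) → ∀ β : ℝ,
      Real.log t ^ (-C) ≤ |β| → |β| ≤ Real.log t ^ C →
      ‖∑ v ∈ Icc 1 (Y : ℤ), ∑ u ∈ Icc 1 (Y : ℤ), e (β * Fγ γ (t + u * v))‖
        ≤ (Y : ℝ) ^ 2 * Real.log t ^ (-D) := by
  obtain ⟨C₀, hC₀, L₀, hL₀, htaylor⟩ := exists_taylor γ hγ hγ'
  set c := (γ - 1) / 4 with hc
  have hc0 : 0 < c := by linarith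
  have hc8 : c < 1 / 8 := by linarith
  obtain ⟨R, hR⟩ : ∃ R : ℕ, 50 * Real.exp (-(R : ℝ)) ≤ c ^ 2 / 4 := by
    have h1 := (Real.tendsto_exp_neg_atTop_nhds_zero.comp
      tendsto_natCast_atTop_atTop).const_mul 50
    rw [mul_zero] at h1
    have h2 := (h1.eventually_lt_const (show 0 < c ^ 2 / 4 by positivity)).exists
    exact h2.imp fun R hR => hR.le
  obtain ⟨C₂, hC₂, hdouble⟩ := norm_doubleSum_le R
  set c₂ := c ^ 2 / 4 / (4 * ((R : ℝ) + 1) ^ 2 * 625) with hc₂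
  have hc₂0 : 0 < c₂ := by positivity
  set δ := min ((3 - 2 * γ) / 5) (c / 4) with hδ
  have hδ0 : 0 < δ := lt_min (by linarith) (by linarith)
  obtain ⟨L₁, hL₁⟩ := Filter.eventually_atTop.1
    ((Filter.eventually_ge_atTop L₀).and
      (((tendsto_rpow_atTop (show 0 < γ - 1 by linarith)).eventually_ge_atTop (8 / c)).and
      ((eventually_log_le one_pos (C₀ + 4) (C + D) hδ0).and
      (eventually_log_le (show 0 < 3 - 2 * γ by linarith) (C₂ + 1) D
        (show 0 < c₂ / 5 by positivity)))))
  refine ⟨L₁, fun t ht hL Y hY5 hY4 β hβ1 hβ2 => ?_⟩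
  obtain ⟨hLL, hn8, hlog1, hlog2⟩ := hL₁ _ hL
  obtain ⟨a, ha1, ha2, ha3⟩ := htaylor t ht hLL
  set L := Real.log t with hLdef
  set n := L ^ (γ - 1) with hn
  set l := Real.log L with hl
  have hL8 : 8 < L := by linarith
  have hL0 : 0 < L := by linarith
  have hl0 : 0 ≤ l := Real.log_nonneg (by linarith)
  have htL : t = Real.exp L := (Real.exp_log ht).symm
  have hcn : 8 ≤ c * n := by rwa [div_le_iff₀' hc0] at hn8
  have hn1 : 1 ≤ n := by nlinarith
  have hn0 : 0 < n := by linarith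
  have hpow : ∀ y : ℝ, L ^ y = Real.exp (l * y) := fun y => Real.rpow_def_of_pos hL0 y
  have hF : Fγ γ t = Real.exp (n * L) := by
    rw [Fγ, hn, Real.rpow_sub_one hL0.ne', div_mul_cancel₀ _ hL0.ne']
  rw [Real.rpow_one] at hlog1
  have hδ1 : δ * L ≤ (3 - 2 * γ) / 5 * L := by gcongr; exact min_le_left _ _
  have hδ2 : δ * L ≤ c / 4 * L := by gcongr; exact min_le_right _ _
  have hDl : 0 ≤ D * l := by positivity
  have hCl : 0 ≤ C * l := by positivity
  have hε2 : C * l + 1 ≤ (3 - 2 * γ) / 5 * L := by linarith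
  have hε3 : C * l + (C₀ + 2) ≤ c / 4 * L := by linarith
  have hε4 : (4 + (C + D) * l) + (C₀ + 4) ≤ L := by
    have : c * L ≤ 1 / 8 * L := by gcongr
    linarith
  have hY5' : Real.exp (L / 5) ≤ Y := by
    rwa [Real.rpow_def_of_pos ht, mul_one_div] at hY5
  have hY4' : (Y : ℝ) ≤ Real.exp (L / 4) := by
    rwa [Real.rpow_def_of_pos ht, mul_one_div] at hY4
  have hY0 : (0 : ℝ) < Y := (Real.exp_pos _).trans_le hY5'
  have hY1 : 1 ≤ Y := by exact_mod_cast hY0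
  have hYneg1 : ∀ y : ℝ, 0 ≤ y → (Y : ℝ) ^ (-y) ≤ Real.exp (-(L / 5 * y)) := by
    intro y hy
    rw [Real.rpow_neg hY0.le, Real.exp_neg]
    refine inv_anti₀ (Real.exp_pos _) ?_
    rw [Real.exp_mul]
    exact Real.rpow_le_rpow (Real.exp_pos _).le hY5' hy
  have hYneg2 : ∀ y : ℝ, 0 ≤ y → Real.exp (-(L / 4 * y)) ≤ (Y : ℝ) ^ (-y) := by
    intro y hy
    rw [Real.rpow_neg hY0.le, Real.exp_neg]
    refine inv_anti₀ (by positivity) ?_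
    rw [Real.exp_mul]
    exact Real.rpow_le_rpow hY0.le hY4' hy
  rw [hpow] at hβ1 hβ2
  set d := ⌈4 * n⌉₊ with hd
  have hd1 : 4 * n ≤ d := Nat.le_ceil _
  have hd2 : (d : ℝ) ≤ 5 * n := by linarith [Nat.ceil_lt_add_one (show 0 ≤ 4 * n by positivity)]
  have hd3 : 3 ≤ d := by
    have : (3 : ℝ) ≤ d := by linarith
    exact_mod_cast this
  obtain ⟨w, hw1, hw2⟩ := exists_window hc0 hc8 hcn (show 2 * n ≤ d by linarith)
  set α : Fin d → ℝ := fun j => β * Fγ γ t * a (j.val + 1) / t ^ (j.val + 1) with hα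
  have hαabs : ∀ j, |α j| = |β| * (Real.exp (n * L) * |a (j.val + 1)|
      * Real.exp (-(((j.val + 1 : ℕ) : ℝ) * L))) := by
    intro j
    rw [hα]
    simp only
    rw [hF, abs_div, abs_mul, abs_mul, Real.abs_exp, abs_of_pos (by positivity : 0 < t ^ _),
      Real.exp_neg, Real.exp_nat_mul, ← htL]
    ring
  have hwin : ∀ j ∈ w, (Y : ℝ) ^ (-((j.val + 1 : ℕ) : ℝ)) ≤ |α j| ∧
      |α j| ≤ (Y : ℝ) ^ (-(c * ((j.val + 1 : ℕ) : ℝ))) := by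
    intro j hj
    obtain ⟨hi1, hi2⟩ := hw1 j hj
    rw [hαabs]
    set i := j.val + 1 with hi
    have hi0 : (0 : ℝ) ≤ (i : ℝ) := Nat.cast_nonneg _
    have hi2n : (i : ℝ) ≤ 2 * n := by nlinarith
    constructor
    · refine (hYneg1 _ hi0).trans ?_
      have h1 : Real.exp (-1) ≤ |a i| := by
        have h2 : 1 / 2 ≤ a i := ha2 i (by rw [hc] at hi2; linarith)
        have h3 : Real.exp (-1) ≤ 1 / 2 := by
          rw [Real.exp_neg, one_div]
          exact inv_anti₀ (by norm_num) (by linarith [Real.exp_one_gt_d9])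
        exact h3.trans (h2.trans (le_abs_self _))
      calc Real.exp (-(L / 5 * i)) ≤ Real.exp (l * (-C)) * (Real.exp (n * L) * Real.exp (-1)
            * Real.exp (-(i * L))) := by
            rw [← Real.exp_add, ← Real.exp_add, ← Real.exp_add, Real.exp_le_exp]
            have h4 : n * (C * l + 1) ≤ n * ((3 - 2 * γ) / 5 * L) := by gcongr
            have h5 : L * i ≤ L * ((1 + 2 * c) * n) := by gcongr
            have h6 : C * l + 1 ≤ n * (C * l + 1) := le_mul_of_one_le_left (by linarith) hn1
            rw [hc] at h5
            linarith
        _ ≤ _ := by gcongr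
    · refine le_trans ?_ (hYneg2 _ (by positivity))
      have h1 : |a i| ≤ Real.exp (C₀ * n + i) := by
        refine (ha1 i).trans ?_
        rw [Real.exp_add, ← Real.exp_one_pow]
        gcongr
        linarith [Real.exp_one_gt_d9]
      calc |β| * (Real.exp (n * L) * |a i| * Real.exp (-(i * L)))
          ≤ Real.exp (l * C) * (Real.exp (n * L) * Real.exp (C₀ * n + i)
            * Real.exp (-(i * L))) := by gcongr
        _ ≤ _ := by
            rw [← Real.exp_add, ← Real.exp_add, ← Real.exp_add, Real.exp_le_exp]
            have h4 : n * (C * l + (C₀ + 2)) ≤ n * (c / 4 * L) := by gcongr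
            have h6 : C * l ≤ n * (C * l) := le_mul_of_one_le_left hCl hn1
            have h7 : (1 + c) * n * L ≤ i * L := by gcongr
            have h8 : c * L * i ≤ c * L * (2 * n) := by gcongr
            have h9 : 0 ≤ c * L * n := by positivity
            linarith
  have hmain := hdouble d Y hd3 hY1 α c (by linarith) w hwin
  have hexp : c₂ / n ^ 2 ≤ (c * ∑ j ∈ w, ((j.val + 1 : ℕ) : ℝ) - 2 * d ^ 2 * Real.exp (-R))
      / (4 * (R + 1) ^ 2 * d ^ 4) := by
    have hd0 : (0 : ℝ) < d := by linarith
    rw [le_div_iff₀ (by positivity)]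
    have h1 : c₂ / n ^ 2 * (4 * (R + 1) ^ 2 * (d : ℝ) ^ 4)
        ≤ c₂ / n ^ 2 * (4 * (R + 1) ^ 2 * (5 * n) ^ 4) := by gcongr
    have h2 : c₂ / n ^ 2 * (4 * (R + 1) ^ 2 * (5 * n) ^ 4) = c ^ 2 / 4 * n ^ 2 := by
      rw [hc₂]
      field_simp
      ring
    have h3 : 2 * (d : ℝ) ^ 2 * Real.exp (-R) ≤ 2 * (5 * n) ^ 2 * Real.exp (-R) := by gcongr
    have h4 : n ^ 2 * (50 * Real.exp (-(R : ℝ))) ≤ n ^ 2 * (c ^ 2 / 4) := by gcongr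
    have h5 : c * (c / 2 * n ^ 2) ≤ c * ∑ j ∈ w, ((j.val + 1 : ℕ) : ℝ) := by gcongr
    linarith
  have hmain2 : ‖doubleSum Y α‖ ≤ (Y : ℝ) ^ 2 * (Real.exp (-1) * L ^ (-D)) := by
    refine hmain.trans ?_
    rw [mul_assoc]
    refine mul_le_mul_of_nonneg_left ?_ (by positivity)
    have h1 : 0 ≤ c₂ / n ^ 2 := by positivity
    have h2 : L / n ^ 2 = L ^ (3 - 2 * γ) := by
      rw [hn, ← Real.rpow_natCast, ← Real.rpow_mul hL0.le]
      nth_rewrite 1 [← Real.rpow_one L]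
      rw [← Real.rpow_sub hL0]
      congr 1
      push_cast
      ring
    calc _ ≤ Real.exp C₂ * Real.exp (-(L / 5 * (c₂ / n ^ 2))) := by
          gcongr
          refine le_trans ?_ (hYneg1 _ h1)
          gcongr
          exact_mod_cast hY1
      _ ≤ Real.exp (-1) * Real.exp (l * (-D)) := by
          rw [← Real.exp_add, ← Real.exp_add, Real.exp_le_exp]
          have : L / 5 * (c₂ / n ^ 2) = c₂ / 5 * (L / n ^ 2) := by ring
          rw [this, h2]
          linarith
      _ = _ := by rw [hpow]
  have happ := norm_double_sum_sub_le (Y := Y) (f := fun m => β * Fγ γ (t + m))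
    (a := β * Fγ γ t * a 0) (α := α)
    (E := Real.exp (C * l + n * L + 1 + C₀ * n + (1 - L / 2) * (4 * n))) ?_
  · refine happ.trans ?_
    have hfin : 2 * Real.pi * Real.exp (C * l + n * L + 1 + C₀ * n + (1 - L / 2) * (4 * n))
        ≤ Real.exp (-1) * L ^ (-D) := by
      have hpi : 2 * Real.pi ≤ Real.exp 2 := by
        have h1 : Real.exp 2 = Real.exp 1 * Real.exp 1 := by rw [← Real.exp_add]; norm_num
        rw [h1]
        nlinarith [Real.exp_one_gt_d9, Real.pi_lt_d2]
      calc _ ≤ Real.exp 2 * Real.exp (C * l + n * L + 1 + C₀ * n + (1 - L / 2) * (4 * n)) := by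
            gcongr
        _ ≤ Real.exp (-1) * Real.exp (l * (-D)) := by
            rw [← Real.exp_add, ← Real.exp_add, Real.exp_le_exp]
            have h4 : n * ((4 + (C + D) * l) + (C₀ + 4)) ≤ n * L := by gcongr
            have h6 : 4 + (C + D) * l ≤ n * (4 + (C + D) * l) :=
              le_mul_of_one_le_left (by linarith) hn1
            linarith
        _ = _ := by rw [hpow]
    have h12 : Real.exp (-1) ≤ 1 / 2 := by
      rw [Real.exp_neg, one_div]
      exact inv_anti₀ (by norm_num) (by linarith [Real.exp_one_gt_d9])
    have hLD : 0 ≤ L ^ (-D) := by positivity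
    calc ‖doubleSum Y α‖ + (Y : ℝ) ^ 2 * (2 * Real.pi *
          Real.exp (C * l + n * L + 1 + C₀ * n + (1 - L / 2) * (4 * n)))
        ≤ (Y : ℝ) ^ 2 * (Real.exp (-1) * L ^ (-D)) + (Y : ℝ) ^ 2 * (Real.exp (-1) * L ^ (-D)) := by
          gcongr
      _ = (Y : ℝ) ^ 2 * ((2 * Real.exp (-1)) * L ^ (-D)) := by ring
      _ ≤ (Y : ℝ) ^ 2 * (1 * L ^ (-D)) := by gcongr; linarith
      _ = _ := by rw [one_mul]
  · intro m hm1 hm2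
    have hx : m / t ≤ Real.exp (-(L / 2)) := by
      rw [div_le_iff₀ ht]
      calc m ≤ (Y : ℝ) ^ 2 := hm2
        _ ≤ Real.exp (L / 4) ^ 2 := by gcongr
        _ = Real.exp (-(L / 2)) * t := by
          rw [htL, ← Real.exp_add, ← Real.exp_nat_mul]
          congr 1
          push_cast
          ring
    have hx4 : Real.exp (-(L / 2)) ≤ 1 / 4 := by
      rw [Real.exp_neg, one_div]
      exact inv_anti₀ (by norm_num) (by linarith [Real.add_one_le_exp (L / 2)])
    have hx0 : 0 ≤ m / t := by positivity
    have h := ha3 (m / t) hx0 (hx.trans hx4) (d + 1)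
    have htm : t * (1 + m / t) = t + m := by field_simp
    have hsum : β * Fγ γ t * a 0 + ∑ j, α j * m ^ (j.val + 1)
        = β * (Fγ γ t * ∑ j ∈ range (d + 1), a j * (m / t) ^ j) := by
      rw [sum_range_succ', Fin.sum_univ_eq_sum_range
        (fun j => β * Fγ γ t * a (j + 1) / t ^ (j + 1) * m ^ (j + 1)) d, mul_add, mul_add,
        mul_sum, mul_sum, add_comm]
      congr 1
      · refine sum_congr rfl fun j _ => ?_
        rw [div_pow]
        ring
      · ring
    rw [hsum, ← mul_sub, abs_mul, ← htm]
    calc _ ≤ Real.exp (l * C) * (Real.exp (n * L) *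
          (2 * Real.exp (C₀ * n) * (2 * (m / t)) ^ (d + 1))) := by
          rw [← hF]
          gcongr
      _ ≤ Real.exp (l * C) * (Real.exp (n * L) *
          (Real.exp 1 * Real.exp (C₀ * n) * Real.exp ((1 - L / 2) * (4 * n)))) := by
          have h2 : (2 : ℝ) ≤ Real.exp 1 := by linarith [Real.exp_one_gt_d9]
          have h3 : (2 * (m / t)) ^ (d + 1) ≤ Real.exp ((1 - L / 2) * (4 * n)) := by
            calc (2 * (m / t)) ^ (d + 1) ≤ (Real.exp 1 * Real.exp (-(L / 2))) ^ (d + 1) := by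
                  gcongr
              _ = Real.exp (((d + 1 : ℕ) : ℝ) * (1 - L / 2)) := by
                  rw [← Real.exp_add, ← Real.exp_nat_mul, sub_eq_add_neg]
              _ ≤ _ := by
                  rw [Real.exp_le_exp]
                  push_cast
                  have h4 : 0 ≤ ((d : ℝ) + 1 - 4 * n) * (L / 2 - 1) :=
                    mul_nonneg (by linarith) (by linarith)
                  linarith
          gcongr
      _ = _ := by
          rw [← Real.exp_add, ← Real.exp_add, ← Real.exp_add, ← Real.exp_add]
          congr 1
          ring

/-! ### Exponential sums over dyadic intervals -/

lemma norm_sum_Ioc_sub_shift_le {g : ℤ → ℂ} (hg : ∀ k, ‖g k‖ ≤ 1) (a b : ℤ) (m : ℕ) :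
    ‖∑ k ∈ Ioc a b, g k - ∑ k ∈ Ioc a b, g (k + m)‖ ≤ 2 * m := by
  rcases le_or_gt a b with hab | hab
  swap
  · simp [Ioc_eq_empty_of_le hab.le]
  have hone : ∀ h : ℤ → ℂ, ∑ k ∈ Ioc a b, h k - ∑ k ∈ Ioc a b, h (k + 1)
      = h (a + 1) - h (b + 1) := by
    intro h
    induction b, hab using Int.leInduction with
    | base => simp
    | succ b hab ih =>
      have : Ioc a (b + 1) = insert (b + 1) (Ioc a b) := by
        ext k
        simp only [mem_Ioc, mem_insert]
        omega
      rw [this, sum_insert (by simp), sum_insert (by simp)]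
      linear_combination ih
  induction m with
  | zero => simp
  | succ m ih =>
    have h1 := hone fun k => g (k + m)
    have h2 : ∑ k ∈ Ioc a b, g k - ∑ k ∈ Ioc a b, g (k + (m + 1 : ℕ))
        = (∑ k ∈ Ioc a b, g k - ∑ k ∈ Ioc a b, g (k + m)) + (g (a + 1 + m) - g (b + 1 + m)) := by
      rw [← h1]
      have : ∑ k ∈ Ioc a b, g (k + (m + 1 : ℕ)) = ∑ k ∈ Ioc a b, g (k + 1 + m) :=
        sum_congr rfl fun k _ => by
          congr 1
          push_cast
          ring
      rw [this]
      ring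
    rw [h2]
    refine (norm_add_le _ _).trans ?_
    have h3 := norm_sub_le (g (a + 1 + m)) (g (b + 1 + m))
    have h4 := hg (a + 1 + m)
    have h5 := hg (b + 1 + m)
    push_cast
    linarith

lemma norm_sum_Ioc_le_of_double {g : ℤ → ℂ} (hg : ∀ k, ‖g k‖ ≤ 1) (a b : ℤ) {Y : ℕ} (hY : 1 ≤ Y)
    {B : ℝ} (hB : ∀ k ∈ Ioc a b,
      ‖∑ v ∈ Icc 1 (Y : ℤ), ∑ u ∈ Icc 1 (Y : ℤ), g (k + u * v)‖ ≤ (Y : ℝ) ^ 2 * B) :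
    ‖∑ k ∈ Ioc a b, g k‖ ≤ ((#(Ioc a b) : ℕ) : ℝ) * B + 2 * (Y : ℝ) ^ 2 := by
  have hY0 : (0 : ℝ) < (Y : ℝ) ^ 2 := by positivity
  have hcard : ∀ z : ℂ, ∑ v ∈ Icc 1 (Y : ℤ), ∑ u ∈ Icc 1 (Y : ℤ), z = (Y : ℂ) ^ 2 * z := by
    intro z
    simp only [sum_const, Int.card_Icc, nsmul_eq_mul]
    simp
    ring
  have hcard' : ∀ z : ℝ, ∑ v ∈ Icc 1 (Y : ℤ), ∑ u ∈ Icc 1 (Y : ℤ), z = (Y : ℝ) ^ 2 * z := by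
    intro z
    simp only [sum_const, Int.card_Icc, nsmul_eq_mul]
    simp
    ring
  have h1 : ‖(Y : ℂ) ^ 2 * ∑ k ∈ Ioc a b, g k
      - ∑ v ∈ Icc 1 (Y : ℤ), ∑ u ∈ Icc 1 (Y : ℤ), ∑ k ∈ Ioc a b, g (k + u * v)‖
      ≤ (Y : ℝ) ^ 2 * (2 * (Y : ℝ) ^ 2) := by
    rw [← hcard, ← hcard']
    simp only [← sum_sub_distrib]
    refine (norm_sum_le _ _).trans (sum_le_sum fun v hv => ?_)
    refine (norm_sum_le _ _).trans (sum_le_sum fun u hu => ?_)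
    rw [mem_Icc] at hu hv
    have h2 := norm_sum_Ioc_sub_shift_le hg a b (u * v).toNat
    have huv : (((u * v).toNat : ℕ) : ℤ) = u * v := Int.toNat_of_nonneg (by nlinarith)
    have huv' : (((u * v).toNat : ℕ) : ℝ) = u * v := by
      rw [← Int.cast_natCast, huv]
      push_cast
      rfl
    rw [huv, huv', ← sum_sub_distrib] at h2
    refine h2.trans ?_
    have hu2 : (u : ℝ) ≤ Y := by exact_mod_cast hu.2
    have hv2 : (v : ℝ) ≤ Y := by exact_mod_cast hv.2
    have hv1 : (0 : ℝ) ≤ v := by exact_mod_cast (by omega : 0 ≤ v)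
    rw [pow_two]
    gcongr
  have h2 : ‖∑ v ∈ Icc 1 (Y : ℤ), ∑ u ∈ Icc 1 (Y : ℤ), ∑ k ∈ Ioc a b, g (k + u * v)‖
      ≤ (Y : ℝ) ^ 2 * (((#(Ioc a b) : ℕ) : ℝ) * B) := by
    have : ∑ v ∈ Icc 1 (Y : ℤ), ∑ u ∈ Icc 1 (Y : ℤ), ∑ k ∈ Ioc a b, g (k + u * v)
        = ∑ k ∈ Ioc a b, ∑ v ∈ Icc 1 (Y : ℤ), ∑ u ∈ Icc 1 (Y : ℤ), g (k + u * v) := by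
      rw [sum_comm, sum_congr rfl fun v _ => sum_comm, sum_comm]
      refine sum_congr rfl fun k _ => sum_comm
    rw [this]
    refine (norm_sum_le _ _).trans ((sum_le_sum hB).trans_eq ?_)
    rw [sum_const, nsmul_eq_mul]
    ring
  have h3 := norm_sub_norm_le ((Y : ℂ) ^ 2 * ∑ k ∈ Ioc a b, g k)
    (∑ v ∈ Icc 1 (Y : ℤ), ∑ u ∈ Icc 1 (Y : ℤ), ∑ k ∈ Ioc a b, g (k + u * v))
  rw [norm_mul, norm_pow, Complex.norm_natCast] at h3
  refine le_of_mul_le_mul_left ?_ hY0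
  linarith

theorem norm_sum_Ioc_e_Fγ_le (γ : ℝ) (hγ : 1 < γ) (hγ' : γ < 3 / 2) (C D : ℝ) (hC : 0 < C)
    (hD : 0 < D) : ∃ L₁ : ℝ, ∀ K : ℝ, 0 < K → L₁ ≤ Real.log K → ∀ K₁ : ℝ, K₁ ≤ 2 * K → ∀ β : ℝ,
      Real.log K ^ (-C) ≤ |β| → |β| ≤ Real.log K ^ C →
      ‖∑ k ∈ Ioc ⌊K⌋ ⌊K₁⌋, e (β * Fγ γ (k : ℝ))‖ ≤ 4 * K * Real.log K ^ (-D) := by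
  obtain ⟨L₀, hL₀⟩ := norm_sum_e_Fγ_le γ hγ hγ' C D hC hD
  obtain ⟨L₂, hL₂⟩ := Filter.eventually_atTop.1
    (eventually_log_le one_pos 0 D (show (0 : ℝ) < 1 / 2 by norm_num))
  refine ⟨max (max L₀ L₂) 40, fun K hK hL K₁ hK₁ β hβ1 hβ2 => ?_⟩
  have hLL₀ : L₀ ≤ Real.log K := (le_max_left _ _).trans ((le_max_left _ _).trans hL)
  have hlog := hL₂ _ ((le_max_right _ _).trans ((le_max_left _ _).trans hL))
  have hL40 : 40 ≤ Real.log K := (le_max_right _ _).trans hL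
  set L := Real.log K with hLdef
  have hL0 : 0 < L := by linarith
  have hKL : K = Real.exp L := (Real.exp_log hK).symm
  have hK1 : 1 < K := by
    rw [hKL]
    exact Real.one_lt_exp_iff.2 hL0
  have hD1 : K ^ (1 / 2 : ℝ) ≤ K * L ^ (-D) := by
    rw [Real.rpow_def_of_pos hL0, Real.rpow_def_of_pos hK, ← hLdef]
    nth_rewrite 1 [hKL]
    rw [← Real.exp_add, Real.exp_le_exp]
    rw [Real.rpow_one] at hlog
    linarith
  set Y := ⌊K ^ (1 / 4 : ℝ)⌋₊ with hY
  have hY4 : (Y : ℝ) ≤ K ^ (1 / 4 : ℝ) := Nat.floor_le (by positivity)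
  have hY5 : (2 * K) ^ (1 / 5 : ℝ) ≤ Y := by
    have h1 := Nat.sub_one_lt_floor (K ^ (1 / 4 : ℝ))
    have h2 : K ^ (1 / 4 : ℝ) = K ^ (1 / 5 : ℝ) * K ^ (1 / 20 : ℝ) := by
      rw [← Real.rpow_add hK]
      norm_num
    have h3 : 3 ≤ K ^ (1 / 20 : ℝ) := by
      rw [Real.rpow_def_of_pos hK, ← hLdef]
      linarith [Real.add_one_le_exp (L * (1 / 20))]
    have h4 : 1 ≤ K ^ (1 / 5 : ℝ) := Real.one_le_rpow hK1.le (by norm_num)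
    have h5 : (2 : ℝ) ^ (1 / 5 : ℝ) ≤ 2 := by
      calc (2 : ℝ) ^ (1 / 5 : ℝ) ≤ (2 : ℝ) ^ (1 : ℝ) :=
            Real.rpow_le_rpow_of_exponent_le (by norm_num) (by norm_num)
        _ = 2 := Real.rpow_one 2
    rw [Real.mul_rpow (by norm_num) hK.le]
    nlinarith
  have hY1 : 1 ≤ Y := by
    have : (0 : ℝ) < Y := lt_of_lt_of_le (by positivity) hY5
    exact_mod_cast this
  have hB : ∀ k ∈ Ioc ⌊K⌋ ⌊K₁⌋, ‖∑ v ∈ Icc 1 (Y : ℤ), ∑ u ∈ Icc 1 (Y : ℤ),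
      e (β * Fγ γ ((k + u * v : ℤ) : ℝ))‖ ≤ (Y : ℝ) ^ 2 * L ^ (-D) := by
    intro k hk
    rw [mem_Ioc] at hk
    have hkK : K < k := Int.floor_lt.1 hk.1
    have hk2 : (k : ℝ) ≤ 2 * K := (Int.le_floor.1 hk.2).trans hK₁
    have hk0 : (0 : ℝ) < k := hK.trans hkK
    have hlogk : L ≤ Real.log k := Real.log_le_log hK hkK.le
    have h1 := hL₀ k hk0 (hLL₀.trans hlogk) Y
      ((Real.rpow_le_rpow hk0.le hk2 (by norm_num)).trans hY5)
      (hY4.trans (Real.rpow_le_rpow hK.le hkK.le (by norm_num))) β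
      ((Real.rpow_le_rpow_of_nonpos hL0 hlogk (by linarith)).trans hβ1)
      (hβ2.trans (Real.rpow_le_rpow hL0.le hlogk hC.le))
    have h2 := Real.rpow_le_rpow_of_nonpos hL0 hlogk (show -D ≤ 0 by linarith)
    push_cast
    exact h1.trans (by gcongr)
  have h := norm_sum_Ioc_le_of_double (g := fun k => e (β * Fγ γ (k : ℝ)))
    (fun k => (norm_e _).le) ⌊K⌋ ⌊K₁⌋ hY1 hB
  have hcard : ((#(Ioc ⌊K⌋ ⌊K₁⌋) : ℕ) : ℝ) ≤ 2 * K := by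
    rw [Int.card_Ioc]
    have h1 : (((⌊K₁⌋ - ⌊K⌋).toNat : ℕ) : ℤ) ≤ max (⌊K₁⌋ - ⌊K⌋) 0 := by
      rw [Int.toNat_eq_max]
    have h2 : ((((⌊K₁⌋ - ⌊K⌋).toNat : ℕ) : ℤ) : ℝ) ≤ max ((⌊K₁⌋ : ℝ) - ⌊K⌋) 0 := by
      exact_mod_cast h1
    rw [Int.cast_natCast] at h2
    refine h2.trans (max_le ?_ (by linarith))
    linarith [Int.floor_le K₁, Int.lt_floor_add_one K]
  have hY2 : (Y : ℝ) ^ 2 ≤ K ^ (1 / 2 : ℝ) := by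
    calc (Y : ℝ) ^ 2 ≤ (K ^ (1 / 4 : ℝ)) ^ 2 := by gcongr
      _ = K ^ (1 / 2 : ℝ) := by
        rw [← Real.rpow_natCast, ← Real.rpow_mul hK.le]
        norm_num
  have h3 : ((#(Ioc ⌊K⌋ ⌊K₁⌋) : ℕ) : ℝ) * L ^ (-D) ≤ 2 * K * L ^ (-D) := by gcongr
  linarith

/-! ### Equidistribution in residue classes from exponential sums -/

lemma norm_sum_range_e_sq (M : ℕ) (u : ℝ) :
    ((‖∑ h ∈ range M, e (h * u)‖ ^ 2 : ℝ) : ℂ)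
      = ∑ h ∈ range M, ∑ h' ∈ range M, e ((((h : ℤ) - h' : ℤ) : ℝ) * u) := by
  rw [Complex.ofReal_pow, ← Complex.mul_conj', map_sum, sum_mul_sum]
  refine sum_congr rfl fun h _ => sum_congr rfl fun h' _ => ?_
  rw [← e_sub]
  congr 1
  push_cast
  ring

lemma sum_norm_sum_range_e_sq {M : ℕ} (hM : 0 < M) (u : ℝ) :
    ∑ i ∈ range M, ‖∑ h ∈ range M, e (h * (u - i / M))‖ ^ 2 = (M : ℝ) ^ 2 := by
  have h1 : ((∑ i ∈ range M, ‖∑ h ∈ range M, e (h * (u - i / M))‖ ^ 2 : ℝ) : ℂ)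
      = (M : ℂ) ^ 2 := by
    rw [Complex.ofReal_sum]
    simp_rw [norm_sum_range_e_sq]
    rw [sum_comm]
    have h2 : ∀ h ∈ range M, ∑ i ∈ range M, ∑ h' ∈ range M,
        e ((((h : ℤ) - h' : ℤ) : ℝ) * (u - i / M)) = M := by
      intro h hh
      rw [sum_comm, sum_eq_single_of_mem h hh]
      · simp [e_zero]
      · intro h' hh' hne
        have h3 : ∀ i ∈ range M, e ((((h : ℤ) - h' : ℤ) : ℝ) * (u - i / M))
            = e ((((h : ℤ) - h' : ℤ) : ℝ) * u) * e ((((h' : ℤ) - h : ℤ) : ℝ) * i / M) := by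
          intro i _
          rw [← e_add]
          congr 1
          push_cast
          ring
        rw [sum_congr rfl h3, ← mul_sum, sum_range_e M hM, if_neg, mul_zero]
        intro hdvd
        have h4 := Int.eq_zero_of_abs_lt_dvd hdvd (by
          rw [mem_range] at hh hh'
          rw [abs_lt]
          omega)
        omega
    rw [sum_congr rfl h2, sum_const, card_range, nsmul_eq_mul, pow_two]
  exact_mod_cast h1

lemma norm_sum_range_e_le {M : ℕ} {u η : ℝ} (hη : 0 < η) {m : ℤ} (h1 : η ≤ u - m)
    (h2 : u - m ≤ 1 - η) : ‖∑ h ∈ range M, e (h * u)‖ ≤ 1 / (2 * η) := by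
  have hr : η ≤ |u - round u| := by
    rcases le_or_gt (round u) m with h | h
    · have : ((round u : ℤ) : ℝ) ≤ m := by exact_mod_cast h
      exact le_trans (by linarith) (le_abs_self _)
    · have : ((m + 1 : ℤ) : ℝ) ≤ (round u : ℤ) := by exact_mod_cast h
      push_cast at this
      exact le_trans (by linarith) (neg_le_abs _)
  have h3 : (1 - e u) * ∑ h ∈ range M, e (h * u) = 1 - e u ^ M := by
    simp_rw [e_nat_mul]
    exact mul_neg_geom_sum _ _
  have h4 : ‖1 - e u‖ * ‖∑ h ∈ range M, e (h * u)‖ ≤ 2 := by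
    rw [← norm_mul, h3]
    refine (norm_sub_le _ _).trans ?_
    rw [norm_pow, norm_e, norm_one]
    norm_num
  have h5 := four_mul_le_norm_one_sub_e u
  rw [le_div_iff₀ (by positivity)]
  nlinarith [norm_nonneg (∑ h ∈ range M, e (h * u))]

lemma sum_norm_sq_le {S : Finset ℤ} {u : ℤ → ℝ} {M : ℕ} {B : ℝ} (hB0 : 0 ≤ B)
    (hB : ∀ h : ℤ, h ≠ 0 → |h| < M → ‖∑ k ∈ S, e (h * u k)‖ ≤ B) (θ : ℝ) :
    ∑ k ∈ S, ‖∑ h ∈ range M, e (h * (u k - θ))‖ ^ 2 ≤ M * ((#S : ℕ) : ℝ) + (M : ℝ) ^ 2 * B := by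
  have h1 : ((∑ k ∈ S, ‖∑ h ∈ range M, e (h * (u k - θ))‖ ^ 2 : ℝ) : ℂ)
      = ∑ h ∈ range M, ∑ h' ∈ range M, e (-(((h : ℤ) - h' : ℤ) : ℝ) * θ) *
        ∑ k ∈ S, e ((((h : ℤ) - h' : ℤ) : ℝ) * u k) := by
    rw [Complex.ofReal_sum]
    simp_rw [norm_sum_range_e_sq]
    rw [sum_comm]
    refine sum_congr rfl fun h _ => ?_
    rw [sum_comm]
    refine sum_congr rfl fun h' _ => ?_
    rw [mul_sum]
    refine sum_congr rfl fun k _ => ?_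
    rw [← e_add]
    congr 1
    ring
  have h2 : ‖((∑ k ∈ S, ‖∑ h ∈ range M, e (h * (u k - θ))‖ ^ 2 : ℝ) : ℂ)‖
      ≤ ∑ h ∈ range M, ∑ h' ∈ range M, ((if h = h' then ((#S : ℕ) : ℝ) else 0) + B) := by
    rw [h1]
    refine (norm_sum_le _ _).trans (sum_le_sum fun h hh => ?_)
    refine (norm_sum_le _ _).trans (sum_le_sum fun h' hh' => ?_)
    rw [norm_mul, norm_e, one_mul]
    rw [mem_range] at hh hh'
    split_ifs with heq
    · refine (norm_sum_le _ _).trans ?_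
      simp only [norm_e, sum_const, nsmul_eq_mul, mul_one]
      linarith
    · rw [zero_add]
      refine hB _ (by omega) ?_
      rw [abs_lt]
      omega
  rw [Complex.norm_real] at h2
  refine (le_abs_self _).trans (h2.trans_eq ?_)
  simp only [sum_add_distrib, sum_ite_eq, sum_const, card_range, nsmul_eq_mul]
  rw [sum_congr rfl fun h hh => if_pos hh]
  rw [sum_const, card_range, nsmul_eq_mul]
  ring

lemma card_le_of_exp_sum {S T : Finset ℤ} (hTS : T ⊆ S) {u : ℤ → ℝ} {M w I : ℕ} (hM : 0 < M)
    (hw : 0 < w) {B : ℝ} (hB0 : 0 ≤ B)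
    (hB : ∀ h : ℤ, h ≠ 0 → |h| < M → ‖∑ k ∈ S, e (h * u k)‖ ≤ B) {θ : ℝ}
    (hT : ∀ k ∈ T, ∀ i : ℕ, I ≤ i → i < M → ∃ m : ℤ,
      (w : ℝ) / M ≤ u k - θ - i / M - m ∧ u k - θ - i / M - m ≤ 1 - (w : ℝ) / M) :
    ((#T : ℕ) : ℝ) ≤ I * (((#S : ℕ) : ℝ) / M + B) + ((#T : ℕ) : ℝ) * (M / (4 * (w : ℝ) ^ 2)) := by
  have hM0 : (0 : ℝ) < M := by exact_mod_cast hM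
  have hw0 : (0 : ℝ) < w := by exact_mod_cast hw
  have hk : ∀ k ∈ T, (M : ℝ) ^ 2
      ≤ ∑ i ∈ range I, ‖∑ h ∈ range M, e (h * (u k - (θ + i / M)))‖ ^ 2
        + M * (1 / (2 * ((w : ℝ) / M))) ^ 2 := by
    intro k hk
    rw [← sum_norm_sum_range_e_sq hM (u k - θ), ← sum_filter_add_sum_filter_not (range M) (· < I)]
    refine add_le_add ?_ ?_
    · have : ∀ i ∈ (range M).filter (· < I), ‖∑ h ∈ range M, e (h * (u k - θ - i / M))‖ ^ 2
          = ‖∑ h ∈ range M, e (h * (u k - (θ + i / M)))‖ ^ 2 := fun i _ => by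
        simp_rw [sub_sub]
      rw [sum_congr rfl this]
      refine sum_le_sum_of_subset_of_nonneg (fun i hi => ?_) fun _ _ _ => by positivity
      exact mem_range.2 (mem_filter.1 hi).2
    · calc _ ≤ ∑ i ∈ (range M).filter (fun i => ¬ i < I), (1 / (2 * ((w : ℝ) / M))) ^ 2 := by
            refine sum_le_sum fun i hi => ?_
            rw [mem_filter, mem_range, not_lt] at hi
            obtain ⟨m, h1, h2⟩ := hT k hk i hi.2 hi.1
            have := norm_sum_range_e_le (M := M) (by positivity) h1 h2
            gcongr
        _ ≤ _ := by
            rw [sum_const, nsmul_eq_mul]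
            gcongr
            calc _ ≤ #(range M) := card_filter_le _ _
              _ = M := card_range M
  have hsum : ((#T : ℕ) : ℝ) * (M : ℝ) ^ 2
      ≤ I * (M * ((#S : ℕ) : ℝ) + (M : ℝ) ^ 2 * B)
        + ((#T : ℕ) : ℝ) * (M * (1 / (2 * ((w : ℝ) / M))) ^ 2) := by
    calc ((#T : ℕ) : ℝ) * (M : ℝ) ^ 2 = ∑ k ∈ T, (M : ℝ) ^ 2 := by rw [sum_const, nsmul_eq_mul]
      _ ≤ ∑ k ∈ T, (∑ i ∈ range I, ‖∑ h ∈ range M, e (h * (u k - (θ + i / M)))‖ ^ 2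
        + M * (1 / (2 * ((w : ℝ) / M))) ^ 2) := sum_le_sum hk
      _ = ∑ i ∈ range I, ∑ k ∈ T, ‖∑ h ∈ range M, e (h * (u k - (θ + i / M)))‖ ^ 2
        + ((#T : ℕ) : ℝ) * (M * (1 / (2 * ((w : ℝ) / M))) ^ 2) := by
        rw [sum_add_distrib, sum_comm, sum_const, nsmul_eq_mul]
      _ ≤ ∑ i ∈ range I, (M * ((#S : ℕ) : ℝ) + (M : ℝ) ^ 2 * B)
        + ((#T : ℕ) : ℝ) * (M * (1 / (2 * ((w : ℝ) / M))) ^ 2) := by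
        refine add_le_add_left (sum_le_sum fun i _ => ?_) _
        exact (sum_le_sum_of_subset_of_nonneg hTS fun _ _ _ => by positivity).trans
          (sum_norm_sq_le hB0 hB _)
      _ = _ := by rw [sum_const, nsmul_eq_mul, card_range]
  refine le_of_mul_le_mul_right ?_ (show (0 : ℝ) < (M : ℝ) ^ 2 by positivity)
  refine hsum.trans_eq ?_
  field_simp
  ring

lemma card_residue_le {S : Finset ℤ} {f : ℤ → ℝ} {q g : ℕ} (hq : 0 < q) (hg : 0 < g) {B : ℝ}
    (hB0 : 0 ≤ B)
    (hB : ∀ h : ℤ, h ≠ 0 → |h| < (q * g ^ 4 : ℕ) → ‖∑ k ∈ S, e (h / q * f k)‖ ≤ B) (r : ℤ) :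
    ((#(S.filter fun k : ℤ => ⌊f k⌋ % (q : ℤ) = r) : ℕ) : ℝ)
      ≤ ((#S : ℕ) : ℝ) / q + (3 * ((#S : ℕ) : ℝ) / g + 3 * q * g ^ 4 * B) := by
  set T := S.filter fun k : ℤ => ⌊f k⌋ % (q : ℤ) = r with hT
  have hTS : T ⊆ S := filter_subset _ _
  have hq0 : (0 : ℝ) < q := by exact_mod_cast hq
  have hg0 : (0 : ℝ) < g := by exact_mod_cast hg
  have hq1 : (1 : ℝ) ≤ q := by exact_mod_cast hq
  have hg1 : (1 : ℝ) ≤ g := by exact_mod_cast hg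
  have hM : 0 < q * g ^ 4 := by positivity
  have h := card_le_of_exp_sum hTS (u := fun k => f k / q) (M := q * g ^ 4) (w := q * g ^ 3)
    (I := g ^ 4 + 2 * (q * g ^ 3)) (θ := (r * g ^ 4 - q * g ^ 3) / (q * g ^ 4)) hM
    (by positivity) hB0
    (fun h h0 hh => by
      refine le_of_eq_of_le ?_ (hB h h0 hh)
      congr 1
      refine sum_congr rfl fun k _ => ?_
      congr 1
      ring)
    (fun k hk i hi1 hi2 => by
      have hr := (mem_filter.1 hk).2
      have hdiv := Int.emod_add_mul_ediv ⌊f k⌋ q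
      rw [hr] at hdiv
      have h1 := Int.floor_le (f k)
      have h2 := Int.lt_floor_add_one (f k)
      rw [← hdiv] at h1 h2
      push_cast at h1 h2
      have hi1' : (g : ℝ) ^ 4 + 2 * (q * g ^ 3) ≤ i := by exact_mod_cast hi1
      have hi2' : (i : ℝ) ≤ q * g ^ 4 := by exact_mod_cast hi2.le
      have hM0 : (0 : ℝ) < q * g ^ 4 := by positivity
      have hg4 : (0 : ℝ) < (g : ℝ) ^ 4 := by positivity
      refine ⟨⌊f k⌋ / q - 1, ?_⟩
      have key : f k / q - (r * g ^ 4 - q * g ^ 3) / (q * g ^ 4)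
          - i / ((q * g ^ 4 : ℕ) : ℝ) - ((⌊f k⌋ / q - 1 : ℤ) : ℝ)
          = ((f k - r - q * ((⌊f k⌋ / q : ℤ) : ℝ)) * g ^ 4 + q * g ^ 3 - i + q * g ^ 4)
            / (q * g ^ 4) := by
        push_cast
        field_simp
        ring
      have key2 : 1 - ((q * g ^ 3 : ℕ) : ℝ) / ((q * g ^ 4 : ℕ) : ℝ)
          = (q * g ^ 4 - q * g ^ 3) / (q * g ^ 4) := by
        push_cast
        field_simp
      rw [key, key2]
      push_cast
      have h3 := mul_nonneg (sub_nonneg.2 h1) hg4.le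
      have h4 := mul_pos (sub_pos.2 h2) hg4
      constructor
      · gcongr
        linarith
      · gcongr
        linarith)
  set N : ℝ := ((#S : ℕ) : ℝ) with hN
  have hN0 : 0 ≤ N := Nat.cast_nonneg _
  have hTN : ((#T : ℕ) : ℝ) ≤ N := Nat.cast_le.2 (card_le_card hTS)
  push_cast at h
  have e1 : (q : ℝ) * g ^ 4 / (4 * (q * g ^ 3) ^ 2) ≤ 1 / g := by
    rw [div_le_div_iff₀ (by positivity) hg0]
    have h5 : (1 : ℝ) ≤ 4 * q * g := by nlinarith
    have h6 : (0 : ℝ) ≤ (q : ℝ) * (g : ℝ) ^ 5 := by positivity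
    nlinarith [mul_le_mul_of_nonneg_left h5 h6]
  have e2 : ((g : ℝ) ^ 4 + 2 * (q * g ^ 3)) * (N / (q * g ^ 4)) = N / q + 2 * (N / g) := by
    field_simp
  have e3 : ((g : ℝ) ^ 4 + 2 * (q * g ^ 3)) * B ≤ 3 * q * g ^ 4 * B := by
    gcongr
    have h5 : (g : ℝ) ^ 4 ≤ q * g ^ 4 := le_mul_of_one_le_left (by positivity) hq1
    have h6 : (q : ℝ) * g ^ 3 ≤ q * g ^ 4 := by gcongr; omega
    linarith
  have e4 : ((#T : ℕ) : ℝ) * ((q : ℝ) * g ^ 4 / (4 * (q * g ^ 3) ^ 2)) ≤ N * (1 / g) := by gcongr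
  have e5 : N * (1 / g) = N / g := by ring
  have e6 : 3 * N / g = 3 * (N / g) := by ring
  linarith

theorem abs_card_residue_sub_le {S : Finset ℤ} {f : ℤ → ℝ} {q g : ℕ} (hq : 0 < q) (hg : 0 < g)
    {B : ℝ} (hB0 : 0 ≤ B)
    (hB : ∀ h : ℤ, h ≠ 0 → |h| < (q * g ^ 4 : ℕ) → ‖∑ k ∈ S, e (h / q * f k)‖ ≤ B) {r : ℤ}
    (hr0 : 0 ≤ r) (hr : r < q) :
    |((#(S.filter fun k : ℤ => ⌊f k⌋ % (q : ℤ) = r) : ℕ) : ℝ) - ((#S : ℕ) : ℝ) / q|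
      ≤ q * (3 * ((#S : ℕ) : ℝ) / g + 3 * q * g ^ 4 * B) := by
  have hq0 : (0 : ℝ) < q := by exact_mod_cast hq
  have hq1 : (1 : ℝ) ≤ q := by exact_mod_cast hq
  set N : ℝ := ((#S : ℕ) : ℝ) with hN
  set E := 3 * N / g + 3 * q * g ^ 4 * B with hE
  have hE0 : 0 ≤ E := by positivity
  have hup := fun s : ℤ => card_residue_le hq hg hB0 hB s
  have htot : N = ∑ s ∈ Ico 0 (q : ℤ),
      ((#(S.filter fun k : ℤ => ⌊f k⌋ % (q : ℤ) = s) : ℕ) : ℝ) := by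
    rw [hN]
    exact_mod_cast card_eq_sum_card_fiberwise fun k _ => by
      have hq' : (0 : ℤ) < q := by exact_mod_cast hq
      exact mem_coe.2 (mem_Ico.2 ⟨Int.emod_nonneg _ hq'.ne', Int.emod_lt_of_pos _ hq'⟩)
  have hmem : r ∈ Ico 0 (q : ℤ) := mem_Ico.2 ⟨hr0, hr⟩
  rw [← add_sum_erase _ _ hmem] at htot
  have hother : ∑ s ∈ (Ico 0 (q : ℤ)).erase r,
      ((#(S.filter fun k : ℤ => ⌊f k⌋ % (q : ℤ) = s) : ℕ) : ℝ) ≤ (q - 1) * (N / q + E) := by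
    refine (sum_le_sum fun s _ => hup s).trans_eq ?_
    rw [sum_const, card_erase_of_mem hmem, Int.card_Ico, nsmul_eq_mul]
    simp only [sub_zero, Int.toNat_natCast]
    rw [Nat.cast_sub hq, Nat.cast_one]
  have hNq : (q - 1) * (N / q + E) = N - N / q + (q - 1) * E := by
    field_simp
  rw [abs_le]
  constructor
  · nlinarith
  · have := hup r
    nlinarith

/-! ### The counting function in residue classes -/

open Filter

lemma exists_log_bounds {γ : ℝ} (hγ : 1 < γ) (hγ' : γ < 3 / 2) (B R : ℝ) :
    ∃ x₀ : ℝ, 2 ≤ x₀ ∧ ∀ x : ℝ, x₀ ≤ x → 1 ≤ Real.log x ∧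
      ∀ K : ℝ, 0 < Real.log K → x * Real.log x ^ (-B) ≤ Fγ γ K →
        R ≤ Real.log K ∧ Real.log x ≤ Real.log K ^ (2 : ℝ) := by
  set S := max R 4 with hS
  have hS4 : 4 ≤ S := le_max_right _ _
  have hev : ∀ᶠ Z : ℝ in atTop, 1 ≤ Z ∧ 2 * S ^ γ ≤ Z ∧ B * Real.log Z ≤ Z / 2 := by
    filter_upwards [eventually_ge_atTop 1, eventually_ge_atTop (2 * S ^ γ),
      eventually_log_le (s := 1) one_pos 0 B (c := 1 / 2) (by norm_num)] with Z h1 h2 h3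
    refine ⟨h1, h2, ?_⟩
    rw [Real.rpow_one] at h3
    linarith
  obtain ⟨x₀, hx₀⟩ := eventually_atTop.1 (Real.tendsto_log_atTop.eventually hev)
  refine ⟨max x₀ 2, le_max_right _ _, fun x hx => ?_⟩
  obtain ⟨h1, h2, h3⟩ := hx₀ x ((le_max_left _ _).trans hx)
  refine ⟨h1, fun K hL hlo => ?_⟩
  have hx0 : 0 < x := by linarith [(le_max_right x₀ 2).trans hx]
  set Z := Real.log x with hZ
  set L := Real.log K with hLK
  have hZ0 : 0 < Z := by linarith
  have hlo' : Z / 2 ≤ L ^ γ := by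
    have h4 : Z + Z.log * (-B) ≤ L ^ γ := by
      rw [← Real.exp_le_exp, Real.exp_add, ← Real.rpow_def_of_pos hZ0, hZ, Real.exp_log hx0]
      exact hlo
    linarith
  have hSL : S ≤ L := by
    by_contra! hlt
    have := Real.rpow_lt_rpow hL.le hlt (by linarith : 0 < γ)
    linarith
  have hL4 : 4 ≤ L := hS4.trans hSL
  refine ⟨(le_max_left _ _).trans hSL, ?_⟩
  · have h5 : (2 : ℝ) ≤ L ^ (2 - γ) := calc
      (2 : ℝ) = 4 ^ (1 / 2 : ℝ) := by
        rw [show (4 : ℝ) = 2 ^ (2 : ℝ) by norm_num, ← Real.rpow_mul (by norm_num)]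
        norm_num
      _ ≤ L ^ (1 / 2 : ℝ) := Real.rpow_le_rpow (by norm_num) hL4 (by norm_num)
      _ ≤ L ^ (2 - γ) := Real.rpow_le_rpow_of_exponent_le (by linarith) (by linarith)
    have h6 : L ^ (2 : ℝ) = L ^ (2 - γ) * L ^ γ := by
      rw [← Real.rpow_add hL]
      congr 1
      ring
    have h7 : 0 ≤ L ^ γ := by positivity
    nlinarith

theorem abs_card_Ioc_residue_sub_le {γ : ℝ} (hγ : 1 < γ) (hγ' : γ < 3 / 2) {a b : ℝ}
    (ha : 0 < a) (hb : 0 < b) :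
    ∃ L₁ : ℝ, ∀ K : ℝ, 0 < K → L₁ ≤ Real.log K → ∀ K₁ : ℝ, K ≤ K₁ → K₁ ≤ 2 * K →
      ∀ q : ℕ, 0 < q → (q : ℝ) ≤ Real.log K ^ a → ∀ r : ℤ, 0 ≤ r → r < q →
        |((#((Ioc ⌊K⌋ ⌊K₁⌋).filter fun k : ℤ => ⌊Fγ γ (k : ℝ)⌋ % (q : ℤ) = r) : ℕ) : ℝ)
          - (K₁ - K) / q| ≤ 200 * K * Real.log K ^ (-b) := by
  set W := a + b with hW
  have hW0 : 0 < W := by positivity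
  obtain ⟨L₀, hexp⟩ := norm_sum_Ioc_e_Fγ_le γ hγ hγ' (4 * W + 1 + a) (2 * a + 4 * W + b)
    (by positivity) (by positivity)
  obtain ⟨L₂, hL₂⟩ := eventually_atTop.1
    (eventually_log_le (s := 1) one_pos 0 b (c := 1) one_pos)
  refine ⟨max (max L₀ L₂) 16, fun K hK hL K₁ hKK hKK' q hq hqL r hr0 hr => ?_⟩
  have hL0 : L₀ ≤ Real.log K := ((le_max_left _ _).trans (le_max_left _ _)).trans hL
  have hL2 := hL₂ _ (((le_max_right _ _).trans (le_max_left _ _)).trans hL)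
  have hL16 : 16 ≤ Real.log K := (le_max_right _ _).trans hL
  rw [Real.rpow_one, zero_add, one_mul] at hL2
  replace hexp := hexp K hK hL0 K₁ hKK'
  set L := Real.log K with hLK
  have hLp : 0 < L := by linarith
  have hL1 : 1 ≤ L := by linarith
  have hq0 : (0 : ℝ) < q := by exact_mod_cast hq
  have hq1 : (1 : ℝ) ≤ q := by exact_mod_cast hq
  have hLW : 1 ≤ L ^ W := Real.one_le_rpow hL1 hW0.le
  set g := ⌈L ^ W⌉₊ with hg
  have hgl : L ^ W ≤ g := Nat.le_ceil _
  have hgu : (g : ℝ) ≤ 2 * L ^ W := by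
    have := Nat.ceil_lt_add_one (by positivity : 0 ≤ L ^ W)
    linarith
  have hg0 : (0 : ℝ) < g := by linarith
  have hgp : 0 < g := by exact_mod_cast hg0
  have hg4 : (g : ℝ) ^ 4 ≤ 16 * L ^ (4 * W) := by
    have h1 : (g : ℝ) ^ 4 ≤ (2 * L ^ W) ^ 4 := by gcongr
    have h2 : L ^ (4 * W) = (L ^ W) ^ 4 := by
      rw [mul_comm, Real.rpow_mul hLp.le]
      norm_cast
    rw [h2]
    linarith [h1, (by ring : (2 * L ^ W) ^ 4 = 16 * (L ^ W) ^ 4)]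
  have hKb : 1 ≤ K * L ^ (-b) := by
    have h1 : K * L ^ (-b) = Real.exp (L + Real.log L * (-b)) := by
      rw [Real.exp_add, hLK, Real.exp_log hK, ← Real.rpow_def_of_pos hLp]
    rw [h1]
    exact Real.one_le_exp (by linarith)
  have hK1 : 1 ≤ K := by
    refine hKb.trans (mul_le_of_le_one_right hK.le ?_)
    exact Real.rpow_le_one_of_one_le_of_nonpos hL1 (by linarith)
  have hmain := abs_card_residue_sub_le (S := Ioc ⌊K⌋ ⌊K₁⌋) (f := fun k : ℤ => Fγ γ (k : ℝ))
    (q := q) (g := g) hq hgp (B := 4 * K * L ^ (-(2 * a + 4 * W + b))) (by positivity)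
    (fun h h0 hh => by
      have hh1 : (1 : ℝ) ≤ |(h : ℝ)| := by exact_mod_cast Int.one_le_abs h0
      have hh2 : |(h : ℝ)| ≤ q * g ^ 4 := by exact_mod_cast hh.le
      refine hexp (h / q) ?_ ?_
      · rw [abs_div, abs_of_pos hq0]
        calc L ^ (-(4 * W + 1 + a)) ≤ L ^ (-a) :=
            Real.rpow_le_rpow_of_exponent_le hL1 (by linarith)
          _ = 1 / L ^ a := by rw [Real.rpow_neg hLp.le, one_div]
          _ ≤ |(h : ℝ)| / q := by gcongr
      · rw [abs_div, abs_of_pos hq0, div_le_iff₀ hq0]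
        have h1 : (g : ℝ) ^ 4 ≤ L ^ (4 * W + 1 + a) := calc
          (g : ℝ) ^ 4 ≤ 16 * L ^ (4 * W) := hg4
          _ ≤ L * L ^ (4 * W) := by gcongr
          _ = L ^ (4 * W + 1) := by rw [Real.rpow_add_one hLp.ne', mul_comm]
          _ ≤ _ := Real.rpow_le_rpow_of_exponent_le hL1 (by linarith)
        calc |(h : ℝ)| ≤ q * g ^ 4 := hh2
          _ ≤ q * L ^ (4 * W + 1 + a) := by gcongr
          _ = _ := mul_comm _ _) hr0 hr
  have hcard : ((#(Ioc ⌊K⌋ ⌊K₁⌋) : ℕ) : ℝ) = (⌊K₁⌋ : ℝ) - ⌊K⌋ := by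
    rw [Int.card_Ioc]
    have : ((⌊K₁⌋ - ⌊K⌋).toNat : ℤ) = ⌊K₁⌋ - ⌊K⌋ :=
      Int.toNat_of_nonneg (sub_nonneg.2 (Int.floor_le_floor hKK))
    exact_mod_cast this
  rw [hcard] at hmain
  have hf1 := Int.floor_le K
  have hf2 := Int.lt_floor_add_one K
  have hf3 := Int.floor_le K₁
  have hf4 := Int.lt_floor_add_one K₁
  set N : ℝ := (⌊K₁⌋ : ℝ) - ⌊K⌋ with hN
  have hN2 : N ≤ 2 * K := by linarith
  have hN0 : 0 ≤ N := by
    rw [← hcard]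
    exact Nat.cast_nonneg _
  have hround : |N / q - (K₁ - K) / q| ≤ K * L ^ (-b) := by
    rw [← sub_div, abs_div, abs_of_pos hq0]
    refine le_trans ((div_le_one hq0).2 (le_trans ?_ hq1)) hKb
    rw [abs_le]
    constructor <;> linarith
  have hab : L ^ a * L ^ (-W) = L ^ (-b) := by
    rw [← Real.rpow_add hLp]
    congr 1
    ring
  have hE1 : q * (3 * N / g) ≤ 6 * (K * L ^ (-b)) := by
    calc q * (3 * N / g) ≤ L ^ a * (3 * (2 * K) / L ^ W) := by
          have : 0 ≤ 3 * (2 * K) / L ^ W := by positivity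
          gcongr
      _ = 6 * (K * (L ^ a * L ^ (-W))) := by
          rw [Real.rpow_neg hLp.le]
          ring
      _ = _ := by rw [hab]
  have hE2 : q * (3 * q * g ^ 4 * (4 * K * L ^ (-(2 * a + 4 * W + b))))
      ≤ 192 * (K * L ^ (-b)) := by
    calc q * (3 * q * g ^ 4 * (4 * K * L ^ (-(2 * a + 4 * W + b))))
        ≤ L ^ a * (3 * L ^ a * (16 * L ^ (4 * W)) * (4 * K * L ^ (-(2 * a + 4 * W + b)))) := by
          gcongr
      _ = 192 * (K * (L ^ a * L ^ a * L ^ (4 * W) * L ^ (-(2 * a + 4 * W + b)))) := by ring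
      _ = _ := by
          rw [← Real.rpow_add hLp, ← Real.rpow_add hLp, ← Real.rpow_add hLp]
          congr 3
          ring
  have hKb0 : 0 ≤ K * L ^ (-b) := by linarith
  calc _ ≤ _ := abs_sub_le _ (N / q) _
    _ ≤ _ := add_le_add hmain hround
    _ ≤ 6 * (K * L ^ (-b)) + 192 * (K * L ^ (-b)) + K * L ^ (-b) := by
      rw [mul_add]
      gcongr
    _ ≤ _ := by linarith

end Vinogradov

theorem statement9 (γ : ℝ) (hγ : 1 < γ) (hγ' : γ < 3/2) (C₁ : ℝ) (hC₁ : 1 / (3 - 2*γ) < C₁)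
    (A B C₅ : ℝ) (hA : 1 < A) (hB : 0 < B) (hC₅ : 0 < C₅) :
    ∃ κ > (0:ℝ), ∃ x₀ : ℝ, 2 ≤ x₀ ∧ ∀ x : ℝ, x₀ ≤ x →
      ∀ K K₁ : ℝ, K ≤ K₁ → K₁ ≤ 2 * K →
        Real.log (Real.log x) ^ C₁ < Real.log K →
        x * Real.log x ^ (-B) ≤ Fγ γ K → Fγ γ K ≤ x →
        ∀ q : ℤ, 1 < q → (q : ℝ) ≤ Real.log x ^ C₅ → ∀ ℓ : ℤ,
          |(((Finset.Ioc ⌊K⌋ ⌊K₁⌋).filter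
                (fun k : ℤ => ⌊Fγ γ (k : ℝ)⌋ % q = ℓ % q)).card : ℝ)
              - (K₁ - K) / (q : ℝ)|
            ≤ κ * K * Real.log x ^ (-(4 * A)) := by
  obtain ⟨L₁, hmain⟩ := Vinogradov.abs_card_Ioc_residue_sub_le hγ hγ'
    (a := 2 * C₅) (b := 2 * (4 * A)) (by positivity) (by positivity)
  obtain ⟨x₀, hx₀2, hx₀⟩ := Vinogradov.exists_log_bounds hγ hγ' B L₁
  refine ⟨200, by norm_num, x₀, hx₀2, fun x hx K K₁ hKK hKK' hloglog hlo _ q hq hqx ℓ => ?_⟩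
  obtain ⟨hZ, hbounds⟩ := hx₀ x hx
  have hL : 0 < Real.log K :=
    (Real.rpow_nonneg (Real.log_nonneg hZ) _).trans_lt hloglog
  have hK : 0 < K := by
    refine lt_of_le_of_ne (by linarith) fun h0 => ?_
    rw [← h0, Real.log_zero] at hL
    exact hL.false
  obtain ⟨hL₁, hZL⟩ := hbounds K hL hlo
  lift q to ℕ using by omega
  have hqL : (q : ℝ) ≤ Real.log K ^ (2 * C₅) := by
    rw [Real.rpow_mul hL.le]
    refine le_trans (by exact_mod_cast hqx) (Real.rpow_le_rpow (by linarith) hZL hC₅.le)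
  have hLpow : Real.log K ^ (-(2 * (4 * A))) ≤ Real.log x ^ (-(4 * A)) := by
    rw [← mul_neg, Real.rpow_mul hL.le]
    exact Real.rpow_le_rpow_of_nonpos (by linarith) hZL (by linarith)
  refine (hmain K hK hL₁ K₁ hKK hKK' q (by omega) hqL (ℓ % q)
    (Int.emod_nonneg _ (by omega)) (Int.emod_lt_of_pos _ (by omega))).trans ?_
  gcongr
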